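/- Suppose the Melnikov function M(θ) is not constant. Then for every open neighborhood U of Γ̂ in ℝ^{2N+3} and every integer q with 1 ≤ q ≤ 2N+3, the autonomous system ẋ = JDH(x) + εa₀(x) + Σ_{j=1}^{N}(a_j(x)u_j + b_j(x)v_j), ε̇ = 0, u̇_j = −jωv_j, v̇_j = jωu_j is not (q, 2N+3−q)-integrable in the Bogoyavlenskij sense with real-analytic data on U. (This is the real-analytic consequence of the paper's Theorem 1.1, which asserts real-meromorphic nonintegrability.) -/

import Mathlib

open MeasureTheory Filter Topology

/-- Bogoyavlenskij `(q, m)`-integrability with real-analytic data on an open set `U`: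
there are `q` real-analytic vector fields `f₁ = f, …, f_q` on `U`, linearly independent
at almost every point of `U` and pairwise commuting, and `m` real-analytic functions
`F₁, …, F_m` on `U` whose derivatives are linearly independent at almost every point of
`U` and which are first integrals of every `f_j`. -/
def BogoyavlenskijIntegrable {E : Type*} [NormedAddCommGroup E] [NormedSpace ℝ E]
    [MeasureSpace E] (f : E → E) (U : Set E) (q m : ℕ) : Prop :=
  ∃ (fs : Fin q → E → E) (Fs : Fin m → E → ℝ),
    (∀ (h : 0 < q) (x : E), x ∈ U → fs ⟨0, h⟩ x = f x) ∧
    (∀ j, AnalyticOnNhd ℝ (fs j) U) ∧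
    (∀ k, AnalyticOnNhd ℝ (Fs k) U) ∧
    (∀ j k, ∀ x ∈ U, fderiv ℝ (fs k) x (fs j x) - fderiv ℝ (fs j) x (fs k x) = 0) ∧
    (∀ᵐ x ∂(volume.restrict U), LinearIndependent ℝ (fun j => fs j x)) ∧
    (∀ᵐ x ∂(volume.restrict U), LinearIndependent ℝ (fun k => fderiv ℝ (Fs k) x)) ∧
    (∀ k j, ∀ x ∈ U, fderiv ℝ (Fs k) x (fs j x) = 0)

/-- First partial derivative `∂H/∂x₁`. -/
noncomputable def D1 (H : ℝ × ℝ → ℝ) (x : ℝ × ℝ) : ℝ := fderiv ℝ H x (1, 0)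

/-- Second partial derivative `∂H/∂x₂`. -/
noncomputable def D2 (H : ℝ × ℝ → ℝ) (x : ℝ × ℝ) : ℝ := fderiv ℝ H x (0, 1)

/-- The Hamiltonian vector field `JDH(x) = (∂₂H(x), −∂₁H(x))`, `J = [[0,1],[−1,0]]`. -/
noncomputable def JDH (H : ℝ × ℝ → ℝ) (x : ℝ × ℝ) : ℝ × ℝ := (D2 H x, -(D1 H x))

/-- The phase space `ℝ^{2N+3}` of the autonomous system, with coordinates
`(x, ε, u, v) ∈ ℝ² × ℝ × ℝ^N × ℝ^N`. -/
abbrev PhaseSpace (N : ℕ) := (ℝ × ℝ) × ℝ × (Fin N → ℝ) × (Fin N → ℝ)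

/-- The vector field of the autonomous system
`ẋ = JDH(x) + ε a₀(x) + Σ_{j=1}^{N} (a_j(x) u_j + b_j(x) v_j)`, `ε̇ = 0`,
`u̇_j = −jω v_j`, `v̇_j = jω u_j` (the index `j : Fin N` encodes the mode `j+1`). -/
noncomputable def autonomousField (N : ℕ) (ω : ℝ) (H : ℝ × ℝ → ℝ)
    (a₀ : ℝ × ℝ → ℝ × ℝ) (a b : Fin N → ℝ × ℝ → ℝ × ℝ)
    (p : PhaseSpace N) : PhaseSpace N :=
  (JDH H p.1 + p.2.1 • a₀ p.1
      + ∑ j : Fin N, (p.2.2.1 j • a j p.1 + p.2.2.2 j • b j p.1),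
   0,
   fun j => -((((j : ℕ) : ℝ) + 1) * ω * p.2.2.2 j),
   fun j => (((j : ℕ) : ℝ) + 1) * ω * p.2.2.1 j)

/-- The time-periodic perturbation
`g(x, θ) = a₀(x) + Σ_{j=1}^{N} (a_j(x) cos jθ + b_j(x) sin jθ)`, which is the real form
of the finite Fourier series `g(x, θ) = Σ_{j=−N}^{N} ĝ_j(x) e^{ijθ}` with
`a₀ = ĝ₀`, `a_j = ĝ_j + ĝ_{−j}`, `b_j = i(ĝ_j − ĝ_{−j})`. -/
noncomputable def perturbation (N : ℕ) (a₀ : ℝ × ℝ → ℝ × ℝ)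
    (a b : Fin N → ℝ × ℝ → ℝ × ℝ) (x : ℝ × ℝ) (θ : ℝ) : ℝ × ℝ :=
  a₀ x + ∑ j : Fin N, (Real.cos ((((j : ℕ) : ℝ) + 1) * θ) • a j x
    + Real.sin ((((j : ℕ) : ℝ) + 1) * θ) • b j x)

/-- The Melnikov function `M(θ) = ∫_{−∞}^{∞} DH(x^h(t)) · g(x^h(t), ωt + θ) dt`. -/
noncomputable def melnikov (N : ℕ) (ω : ℝ) (H : ℝ × ℝ → ℝ) (a₀ : ℝ × ℝ → ℝ × ℝ)
    (a b : Fin N → ℝ × ℝ → ℝ × ℝ) (xh : ℝ → ℝ × ℝ) (θ : ℝ) : ℝ :=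
  ∫ t : ℝ, (D1 H (xh t) * (perturbation N a₀ a b (xh t) (ω * t + θ)).1
    + D2 H (xh t) * (perturbation N a₀ a b (xh t) (ω * t + θ)).2)

set_option linter.unusedSectionVars false

section Hadamard
variable {E V : Type*} [NormedAddCommGroup E] [NormedSpace ℝ E]
  [NormedAddCommGroup V] [NormedSpace ℝ V]

theorem AnalyticAt.clm_apply_fun {G : Type*} [NormedAddCommGroup G] [NormedSpace ℝ G]
    {L : G → E →L[ℝ] V} {v : G → E} {p : G} (hL : AnalyticAt ℝ L p) (hv : AnalyticAt ℝ v p) :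
    AnalyticAt ℝ (fun x => L x (v x)) p :=
  AnalyticAt.comp₂ ((ContinuousLinearMap.id ℝ (E →L[ℝ] V)).analyticAt_bilinear (L p, v p)) hL hv

theorem hasFDerivAt_coord (ζ : E →L[ℝ] V) (p x : E) :
    HasFDerivAt (fun x => ζ (x - p)) ζ x := by
  have := ζ.hasFDerivAt.comp x ((hasFDerivAt_id x).sub_const p)
  rwa [ContinuousLinearMap.comp_id] at this

/-- Analytic Hadamard lemma. -/
theorem AnalyticAt.exists_eq_add_clm_apply [CompleteSpace V] {φ : E → V} {p : E}
    (h : AnalyticAt ℝ φ p) :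
    ∃ Φ : E → (E →L[ℝ] V), AnalyticAt ℝ Φ p ∧ ∀ᶠ x in 𝓝 p, φ x = φ p + Φ x (x - p) := by
  obtain ⟨s, r, hr⟩ := h
  have hrad : 0 < s.shift.radius := by
    rw [FormalMultilinearSeries.radius_shift]
    exact lt_of_lt_of_le hr.r_pos hr.r_le
  have h1 := s.shift.hasFPowerSeriesOnBall hrad
  have h2 : HasFPowerSeriesOnBall (fun x => s.shift.sum (x - p)) s.shift p s.shift.radius := by
    have := h1.comp_sub p
    simpa using this
  refine ⟨fun x => s.shift.sum (x - p), h2.analyticAt, ?_⟩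
  have h3 := h2.unshift (z := s 0 0)
  have h4 : s.shift.unshift (s 0 0) = s := by
    ext n v
    cases n with
    | zero =>
      simp only [FormalMultilinearSeries.unshift]
      simp [Subsingleton.elim v 0]
    | succ n =>
      simp [FormalMultilinearSeries.unshift, FormalMultilinearSeries.shift]
  rw [h4] at h3
  have h5 : s 0 0 = φ p := hr.coeff_zero 0
  have h6 := hr.hasFPowerSeriesAt.analyticAt
  rw [h5] at h3
  obtain ⟨ρ, hρ, hb1, hb2⟩ : ∃ ρ : ENNReal, 0 < ρ ∧ ρ ≤ r ∧ ρ ≤ s.shift.radius :=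
    ⟨min r s.shift.radius, lt_min hr.r_pos hrad, min_le_left _ _, min_le_right _ _⟩
  have h7 := (hr.mono hρ hb1).unique (h3.mono hρ hb2)
  filter_upwards [Metric.eball_mem_nhds p hρ] with x hx using h7 hx

end Hadamard

section Vanishing
variable {E : Type*} [NormedAddCommGroup E] [NormedSpace ℝ E]
variable {V : Type*} [NormedAddCommGroup V] [NormedSpace ℝ V]

/-- Analytic germs at `p` lying in the `k`-th power of the ideal generated by the linear
coordinates `ξ`, `η` centred at `p`. -/
def VanishesToOrder (ξ η : E →L[ℝ] ℝ) (p : E) : ℕ → (E → V) → Prop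
  | 0, Z => AnalyticAt ℝ Z p
  | k + 1, Z => ∃ Z₁ Z₂ : E → V, VanishesToOrder ξ η p k Z₁ ∧ VanishesToOrder ξ η p k Z₂ ∧
      Z =ᶠ[𝓝 p] fun x => ξ (x - p) • Z₁ x + η (x - p) • Z₂ x

variable {ξ η : E →L[ℝ] ℝ} {p : E}

namespace VanishesToOrder

theorem congr {k : ℕ} {Z W : E → V} (h : VanishesToOrder ξ η p k Z) (e : W =ᶠ[𝓝 p] Z) :
    VanishesToOrder ξ η p k W := by
  cases k with
  | zero => exact AnalyticAt.congr h e.symm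
  | succ k =>
    obtain ⟨Z₁, Z₂, h₁, h₂, h⟩ := h
    exact ⟨Z₁, Z₂, h₁, h₂, e.trans h⟩

theorem coord_analyticAt (ζ : E →L[ℝ] ℝ) (p q : E) : AnalyticAt ℝ (fun x => ζ (x - p)) q :=
  (ζ.analyticAt _).comp (analyticAt_id.sub analyticAt_const)

theorem analyticAt {k : ℕ} {Z : E → V} (h : VanishesToOrder ξ η p k Z) : AnalyticAt ℝ Z p := by
  induction k generalizing Z with
  | zero => exact h
  | succ k ih =>
    obtain ⟨Z₁, Z₂, h₁, h₂, h⟩ := h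
    refine AnalyticAt.congr ?_ h.symm
    exact ((coord_analyticAt ξ p p).smul (ih h₁)).add ((coord_analyticAt η p p).smul (ih h₂))

theorem succ_le {k : ℕ} {Z : E → V} (h : VanishesToOrder ξ η p (k + 1) Z) :
    VanishesToOrder ξ η p k Z := by
  induction k generalizing Z with
  | zero => exact h.analyticAt
  | succ k ih =>
    obtain ⟨Z₁, Z₂, h₁, h₂, h⟩ := h
    exact ⟨Z₁, Z₂, ih h₁, ih h₂, h⟩

theorem add {k : ℕ} {Z W : E → V} (hZ : VanishesToOrder ξ η p k Z)
    (hW : VanishesToOrder ξ η p k W) : VanishesToOrder ξ η p k (fun x => Z x + W x) := by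
  induction k generalizing Z W with
  | zero => exact AnalyticAt.add hZ hW
  | succ k ih =>
    obtain ⟨Z₁, Z₂, h₁, h₂, h⟩ := hZ
    obtain ⟨W₁, W₂, g₁, g₂, g⟩ := hW
    refine ⟨_, _, ih h₁ g₁, ih h₂ g₂, ?_⟩
    filter_upwards [h, g] with x hx gx
    rw [hx, gx]
    module

theorem smul {j k : ℕ} {φ : E → ℝ} {Z : E → V} (hφ : VanishesToOrder ξ η p j φ)
    (hZ : VanishesToOrder ξ η p k Z) : VanishesToOrder ξ η p (k + j) (fun x => φ x • Z x) := by
  induction j generalizing φ with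
  | zero =>
    induction k generalizing Z with
    | zero => exact AnalyticAt.smul hφ hZ
    | succ k ih =>
      obtain ⟨Z₁, Z₂, h₁, h₂, h⟩ := hZ
      refine ⟨_, _, ih h₁, ih h₂, ?_⟩
      filter_upwards [h] with x hx
      rw [hx]
      module
  | succ j ih =>
    obtain ⟨φ₁, φ₂, h₁, h₂, h⟩ := hφ
    refine ⟨_, _, ih h₁, ih h₂, ?_⟩
    filter_upwards [h] with x hx
    rw [hx]
    simp only [smul_eq_mul]
    module

theorem coord_left {k : ℕ} {Z : E → V} (h : VanishesToOrder ξ η p k Z) :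
    VanishesToOrder ξ η p (k + 1) (fun x => ξ (x - p) • Z x) := by
  refine ⟨Z, fun _ => 0, h, ?_, by simp⟩
  have := smul (φ := fun _ => 0) (ξ := ξ) (η := η) (p := p) (j := 0) analyticAt_const h
  simpa using this

theorem coord_right {k : ℕ} {Z : E → V} (h : VanishesToOrder ξ η p k Z) :
    VanishesToOrder ξ η p (k + 1) (fun x => η (x - p) • Z x) := by
  refine ⟨fun _ => 0, Z, ?_, h, by simp⟩
  have := smul (φ := fun _ => 0) (ξ := ξ) (η := η) (p := p) (j := 0) analyticAt_const h
  simpa using this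

theorem isBigO {k : ℕ} {Z : E → V} (h : VanishesToOrder ξ η p k Z) :
    Z =O[𝓝 p] fun x => ‖x - p‖ ^ k := by
  induction k generalizing Z with
  | zero =>
    simpa using h.analyticAt.continuousAt.isBigO_one ℝ
  | succ k ih =>
    obtain ⟨Z₁, Z₂, h₁, h₂, h⟩ := h
    refine h.isBigO.trans ?_
    have key : ∀ ζ : E →L[ℝ] ℝ, (fun x => ζ (x - p)) =O[𝓝 p] fun x => ‖x - p‖ := fun ζ =>
      Asymptotics.IsBigO.of_bound ‖ζ‖ (Eventually.of_forall fun x => by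
        simpa using ζ.le_opNorm (x - p))
    simp only [pow_succ']
    exact ((key ξ).smul (ih h₁)).add ((key η).smul (ih h₂))

variable [CompleteSpace V] {e₁ e₂ : E}

theorem of_apply_eq_zero (he : ∀ v, v = ξ v • e₁ + η v • e₂) {Z : E → V}
    (hZ : AnalyticAt ℝ Z p) (h0 : Z p = 0) : VanishesToOrder ξ η p 1 Z := by
  obtain ⟨Φ, hΦ, h⟩ := hZ.exists_eq_add_clm_apply
  refine ⟨fun x => Φ x e₁, fun x => Φ x e₂, hΦ.clm_apply_fun analyticAt_const,
    hΦ.clm_apply_fun analyticAt_const, ?_⟩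
  filter_upwards [h] with x hx
  rw [hx, h0, zero_add]
  conv_lhs => rw [he (x - p)]
  simp

theorem of_fderiv_eq_zero (he : ∀ v, v = ξ v • e₁ + η v • e₂) {Z : E → V}
    (hZ : AnalyticAt ℝ Z p) (h0 : Z p = 0) (h1 : fderiv ℝ Z p = 0) :
    VanishesToOrder ξ η p 2 Z := by
  obtain ⟨Φ, hΦ, h⟩ := hZ.exists_eq_add_clm_apply
  have hΦp : Φ p = 0 := by
    have h2 : HasFDerivAt (fun x => Z p + Φ x (x - p)) (Φ p) p := by
      have := (hΦ.differentiableAt.hasFDerivAt.clm_apply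
        ((hasFDerivAt_id p).sub_const p)).const_add (Z p)
      rwa [id, sub_self, map_zero, add_zero, ContinuousLinearMap.comp_id] at this
    rw [← h2.fderiv, ← h1]
    exact (EventuallyEq.fderiv_eq h).symm
  refine ⟨fun x => Φ x e₁, fun x => Φ x e₂,
    of_apply_eq_zero he (hΦ.clm_apply_fun analyticAt_const) (by simp [hΦp]),
    of_apply_eq_zero he (hΦ.clm_apply_fun analyticAt_const) (by simp [hΦp]), ?_⟩
  filter_upwards [h] with x hx
  rw [hx, h0, zero_add]
  conv_lhs => rw [he (x - p)]
  simp

end VanishesToOrder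

/-- The first-order operator `Z ↦ DZ·f + N Z - c Z`. -/
noncomputable def transportOp (f : E → E) (N : E → V →L[ℝ] V) (c : ℝ) (Z : E → V) : E → V :=
  fun x => fderiv ℝ Z x (f x) + N x (Z x) - c • Z x

/-- Composition of the operators `transportOp f N c`, for `c` in a list. -/
noncomputable def transportOps (f : E → E) (N : E → V →L[ℝ] V) : List ℝ → (E → V) → (E → V)
  | [], Z => Z
  | c :: l, Z => transportOps f N l (transportOp f N c Z)

variable {f : E → E} {N : E → V →L[ℝ] V}

theorem transportOp_congr {c : ℝ} {Z W : E → V} (h : Z =ᶠ[𝓝 p] W) :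
    transportOp f N c Z =ᶠ[𝓝 p] transportOp f N c W := by
  filter_upwards [h, h.fderiv (𝕜 := ℝ)] with x h₁ h₂
  simp [transportOp, h₁, h₂]

theorem transportOps_congr {l : List ℝ} {Z W : E → V} (h : Z =ᶠ[𝓝 p] W) :
    transportOps f N l Z =ᶠ[𝓝 p] transportOps f N l W := by
  induction l generalizing Z W with
  | nil => exact h
  | cons c l ih => exact ih (transportOp_congr h)

theorem transportOps_append (l₁ l₂ : List ℝ) (Z : E → V) :
    transportOps f N (l₁ ++ l₂) Z = transportOps f N l₂ (transportOps f N l₁ Z) := by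
  induction l₁ generalizing Z with
  | nil => rfl
  | cons c l ih => exact ih _

variable [CompleteSpace V]

theorem transportOp_add {c : ℝ} {Z W : E → V} (hZ : AnalyticAt ℝ Z p) (hW : AnalyticAt ℝ W p) :
    transportOp f N c (fun x => Z x + W x) =ᶠ[𝓝 p]
      fun x => transportOp f N c Z x + transportOp f N c W x := by
  have h₁ := hZ.eventually_analyticAt
  have h₂ := hW.eventually_analyticAt
  filter_upwards [h₁, h₂] with x h₁ h₂
  simp only [transportOp]
  rw [fderiv_fun_add h₁.differentiableAt h₂.differentiableAt]
  simp only [add_apply, map_add]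
  module

theorem transportOp_smul {c σ : ℝ} (ζ : E →L[ℝ] ℝ) {Z : E → V} (hZ : AnalyticAt ℝ Z p) :
    transportOp f N (c + σ) (fun x => ζ (x - p) • Z x) =ᶠ[𝓝 p]
      fun x => ζ (x - p) • transportOp f N c Z x + (ζ (f x) - σ * ζ (x - p)) • Z x := by
  have h₁ := hZ.eventually_analyticAt
  filter_upwards [h₁] with x h₁
  have hζ := hasFDerivAt_coord ζ p x
  simp only [transportOp]
  rw [(hζ.fun_smul h₁.differentiableAt.hasFDerivAt).fderiv]
  simp only [add_apply, smul_apply,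
    ContinuousLinearMap.smulRight_apply, map_smul]
  module

theorem analyticAt_transportOp {c : ℝ} (hf : AnalyticAt ℝ f p) (hN : AnalyticAt ℝ N p)
    {Z : E → V} (hZ : AnalyticAt ℝ Z p) : AnalyticAt ℝ (transportOp f N c Z) p :=
  ((hZ.fderiv.clm_apply_fun hf).add (hN.clm_apply_fun hZ)).sub (analyticAt_const.smul hZ)

theorem analyticAt_transportOps {l : List ℝ} (hf : AnalyticAt ℝ f p) (hN : AnalyticAt ℝ N p)
    {Z : E → V} (hZ : AnalyticAt ℝ Z p) : AnalyticAt ℝ (transportOps f N l Z) p := by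
  induction l generalizing Z with
  | nil => exact hZ
  | cons c l ih => exact ih (analyticAt_transportOp hf hN hZ)

theorem transportOps_add {l : List ℝ} (hf : AnalyticAt ℝ f p) (hN : AnalyticAt ℝ N p)
    {Z W : E → V} (hZ : AnalyticAt ℝ Z p) (hW : AnalyticAt ℝ W p) :
    transportOps f N l (fun x => Z x + W x) =ᶠ[𝓝 p]
      fun x => transportOps f N l Z x + transportOps f N l W x := by
  induction l generalizing Z W with
  | nil => exact EventuallyEq.rfl
  | cons c l ih =>
    exact (transportOps_congr (transportOp_add hZ hW)).trans
      (ih (analyticAt_transportOp hf hN hZ) (analyticAt_transportOp hf hN hW))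

/-- Data of a saddle point `p` of the planar analytic vector field `f`, in terms of linear
coordinates `ξ`, `η` diagonalizing the linear part. -/
structure SaddlePoint (f : E → E) (p : E) (lam : ℝ) (ξ η : E →L[ℝ] ℝ) (e₁ e₂ : E) : Prop where
  analyticAt : AnalyticAt ℝ f p
  apply_eq_zero : f p = 0
  pos : 0 < lam
  decomp : ∀ v, v = ξ v • e₁ + η v • e₂
  left : ∀ v, ξ (fderiv ℝ f p v) = lam * ξ v
  right : ∀ v, η (fderiv ℝ f p v) = -lam * η v

namespace SaddlePoint
variable {lam : ℝ} {e₁ e₂ : E}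

theorem vanishes_remainder (hs : SaddlePoint f p lam ξ η e₁ e₂) {ζ : E →L[ℝ] ℝ} {σ : ℝ}
    (h : ∀ v, ζ (fderiv ℝ f p v) = σ * ζ v) :
    VanishesToOrder ξ η p 2 (fun x => ζ (f x) - σ * ζ (x - p)) := by
  have hc := VanishesToOrder.coord_analyticAt ζ p p
  refine VanishesToOrder.of_fderiv_eq_zero hs.decomp
    (((ζ.analyticAt _).comp hs.analyticAt).sub (analyticAt_const.mul hc))
    (by simp [hs.apply_eq_zero]) ?_
  have h₁ := ζ.hasFDerivAt.comp p hs.analyticAt.differentiableAt.hasFDerivAt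
  have hζ := hasFDerivAt_coord ζ p p
  have h₂ : HasFDerivAt (fun x => ζ (f x) - σ * ζ (x - p)) _ p := h₁.sub (hζ.const_mul σ)
  rw [h₂.fderiv]
  ext v
  simp [h]

theorem vanishes_transportOp (hs : SaddlePoint f p lam ξ η e₁ e₂) (hN : AnalyticAt ℝ N p)
    {c : ℝ} {k : ℕ} {Z : E → V} (hZ : VanishesToOrder ξ η p k Z) :
    VanishesToOrder ξ η p k (transportOp f N c Z) := by
  induction k generalizing Z c with
  | zero => exact analyticAt_transportOp hs.analyticAt hN hZ
  | succ k ih =>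
    obtain ⟨Z₁, Z₂, h₁, h₂, h⟩ := hZ
    refine VanishesToOrder.congr ?_ ((transportOp_congr h).trans (transportOp_add
      h₁.coord_left.analyticAt h₂.coord_right.analyticAt))
    refine VanishesToOrder.add ?_ ?_
    · have e := transportOp_smul (f := f) (N := N) (c := c - lam) (σ := lam) ξ h₁.analyticAt
      rw [sub_add_cancel] at e
      exact ((ih h₁).coord_left.add
        ((hs.vanishes_remainder hs.left).smul h₁).succ_le).congr e
    · have e := transportOp_smul (f := f) (N := N) (c := c - -lam) (σ := -lam) η h₂.analyticAt
      rw [sub_add_cancel] at e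
      exact ((ih h₂).coord_right.add
        ((hs.vanishes_remainder hs.right).smul h₂).succ_le).congr e

theorem vanishes_transportOps (hs : SaddlePoint f p lam ξ η e₁ e₂) (hN : AnalyticAt ℝ N p)
    {l : List ℝ} {k : ℕ} {Z : E → V} (hZ : VanishesToOrder ξ η p k Z) :
    VanishesToOrder ξ η p k (transportOps f N l Z) := by
  induction l generalizing Z with
  | nil => exact hZ
  | cons c l ih => exact ih (hs.vanishes_transportOp hN hZ)

theorem transportOps_coord (hs : SaddlePoint f p lam ξ η e₁ e₂) (hN : AnalyticAt ℝ N p)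
    {ζ : E →L[ℝ] ℝ} {σ : ℝ} (h : ∀ v, ζ (fderiv ℝ f p v) = σ * ζ v) (l : List ℝ) {k : ℕ}
    {Z W : E → V} (hZ : VanishesToOrder ξ η p k Z) (hW : VanishesToOrder ξ η p (k + 2) W) :
    ∃ W' : E → V, VanishesToOrder ξ η p (k + 2) W' ∧
      transportOps f N (l.map (· + σ)) (fun x => ζ (x - p) • Z x + W x) =ᶠ[𝓝 p]
        fun x => ζ (x - p) • transportOps f N l Z x + W' x := by
  induction l generalizing Z W with
  | nil => exact ⟨W, hW, EventuallyEq.rfl⟩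
  | cons c l ih =>
    obtain ⟨W', hW', e⟩ := ih (hs.vanishes_transportOp (c := c) hN hZ)
      (((hs.vanishes_remainder h).smul hZ).add (hs.vanishes_transportOp (c := c + σ) hN hW))
    refine ⟨W', hW', EventuallyEq.trans ?_ e⟩
    refine transportOps_congr (f := f) (N := N) (l := l.map (· + σ)) ?_
    have hζZ : AnalyticAt ℝ (fun x => ζ (x - p) • Z x) p :=
      (VanishesToOrder.coord_analyticAt ζ p p).smul hZ.analyticAt
    filter_upwards [transportOp_add (f := f) (N := N) (c := c + σ) hζZ hW.analyticAt,
      transportOp_smul (f := f) (N := N) (c := c) (σ := σ) ζ hZ.analyticAt] with x h₁ h₂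
    rw [h₁, h₂, add_assoc]

/-- If some composition of transport operators kills values at `p`, then suitable compositions
map all analytic germs into arbitrarily high powers of the maximal ideal. -/
theorem exists_flattening (hs : SaddlePoint f p lam ξ η e₁ e₂) (hN : AnalyticAt ℝ N p)
    (h0 : ∃ l : List ℝ, ∀ Z : E → V, AnalyticAt ℝ Z p → transportOps f N l Z p = 0) (k : ℕ) :
    ∃ l : List ℝ, ∀ Z : E → V, AnalyticAt ℝ Z p →
      VanishesToOrder ξ η p k (transportOps f N l Z) := by
  have main : ∀ k, ∃ l : List ℝ, ∀ Z : E → V, VanishesToOrder ξ η p k Z →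
      VanishesToOrder ξ η p (k + 1) (transportOps f N l Z) := by
    intro k
    induction k with
    | zero =>
      obtain ⟨l, hl⟩ := h0
      exact ⟨l, fun Z hZ => VanishesToOrder.of_apply_eq_zero hs.decomp
        (analyticAt_transportOps hs.analyticAt hN hZ) (hl Z hZ)⟩
    | succ k ih =>
      obtain ⟨l, hl⟩ := ih
      refine ⟨l.map (· + lam) ++ l.map (· + -lam), fun Z ⟨Z₁, Z₂, h₁, h₂, h⟩ => ?_⟩
      rw [transportOps_append]
      have hz : VanishesToOrder ξ η p (k + 2) (fun _ : E => (0 : V)) := by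
        have := h₁.coord_left.coord_left
        have := VanishesToOrder.smul (φ := fun _ => 0) (ξ := ξ) (η := η) (p := p) (j := 0)
          analyticAt_const this
        simpa using this
      obtain ⟨A, hA, eA⟩ := hs.transportOps_coord hN hs.left l h₁ hz
      obtain ⟨B, hB, eB⟩ := hs.transportOps_coord hN hs.right (l.map (· + 2 * lam)) h₂ hz
      obtain ⟨C, hC, eC⟩ := hs.transportOps_coord hN hs.right l
        (hs.vanishes_transportOps (l := l.map (· + 2 * lam)) hN h₂)
        ((hl _ h₁).coord_left.add (hA.add hB))
      refine VanishesToOrder.congr ?_ ((transportOps_congr ?_).trans eC)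
      · refine VanishesToOrder.add ?_ hC
        refine VanishesToOrder.coord_right ?_
        exact hl _ (hs.vanishes_transportOps hN h₂)
      · rw [List.map_map] at eB
        have e2 : ((· + -lam) ∘ (· + 2 * lam) : ℝ → ℝ) = (· + lam) := by
          funext c
          simp only [Function.comp]
          ring
        rw [e2] at eB
        simp only [add_zero] at eA eB
        filter_upwards [eA, eB, (transportOps_congr (f := f) (N := N) h).trans
          (transportOps_add hs.analyticAt hN h₁.coord_left.analyticAt
            h₂.coord_right.analyticAt)] with x h₁ h₂ h₃
        rw [h₃, h₁, h₂]
        abel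
  induction k with
  | zero => exact ⟨[], fun Z hZ => hZ⟩
  | succ k ih =>
    obtain ⟨l, hl⟩ := ih
    obtain ⟨l', hl'⟩ := main k
    exact ⟨l ++ l', fun Z hZ => by rw [transportOps_append]; exact hl' _ (hl Z hZ)⟩

end SaddlePoint
end Vanishing

section
variable {E V : Type*} [NormedAddCommGroup E] [NormedSpace ℝ E]
  [NormedAddCommGroup V] [NormedSpace ℝ V] [CompleteSpace V]

theorem fderiv_fderiv_apply {r : E → V} {X : E → E} {x : E} (hr : AnalyticAt ℝ r x)
    (hX : DifferentiableAt ℝ X x) (v : E) :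
    fderiv ℝ (fun y => fderiv ℝ r y (X y)) x v
      = fderiv ℝ (fderiv ℝ r) x v (X x) + fderiv ℝ r x (fderiv ℝ X x v) := by
  have h := (hr.fderiv.differentiableAt.hasFDerivAt.clm_apply hX.hasFDerivAt)
  rw [h.fderiv]
  simp [add_comm]

theorem fderiv_fderiv_symm {r : E → V} {x : E} (hr : AnalyticAt ℝ r x) (v w : E) :
    fderiv ℝ (fderiv ℝ r) x v w = fderiv ℝ (fderiv ℝ r) x w v :=
  (hr.contDiffAt (n := 2)).isSymmSndFDerivAt (by simp) v w

theorem fderiv_fderiv_apply_comm {r : E → V} {X f : E → E} {x : E} (hr : AnalyticAt ℝ r x)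
    (hX : DifferentiableAt ℝ X x) (hf : DifferentiableAt ℝ f x)
    (h : fderiv ℝ X x (f x) = fderiv ℝ f x (X x)) :
    fderiv ℝ (fun y => fderiv ℝ r y (X y)) x (f x)
      = fderiv ℝ (fun y => fderiv ℝ r y (f y)) x (X x) := by
  rw [fderiv_fderiv_apply hr hX, fderiv_fderiv_apply hr hf, fderiv_fderiv_symm hr, h]

theorem SaddlePoint.transportOps_zero_base {f : E → E} {p : E} (hp : f p = 0) :
    ∃ l : List ℝ, ∀ Z : E → V, AnalyticAt ℝ Z p →
      transportOps f (fun _ => 0) l Z p = 0 :=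
  ⟨[0], fun Z _ => by simp [transportOps, transportOp, hp]⟩

theorem SaddlePoint.transportOps_neg_fderiv_base {f : E → E} {p : E} {lam : ℝ}
    {ξ η : E →L[ℝ] ℝ} {e₁ e₂ : E} (hs : SaddlePoint f p lam ξ η e₁ e₂) :
    ∃ l : List ℝ, ∀ Z : E → E, AnalyticAt ℝ Z p →
      transportOps f (fun x => -fderiv ℝ f x) l Z p = 0 := by
  refine ⟨[lam, -lam], fun Z _ => ?_⟩
  simp only [transportOps, transportOp, hs.apply_eq_zero, map_zero, zero_add]
  rw [hs.decomp (_ - _)]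
  simp only [neg_apply, map_sub, map_neg, map_smul, hs.left, hs.right, smul_eq_mul]
  ring_nf
  simp

end

section Approximation
variable {E : Type*} [NormedAddCommGroup E] [NormedSpace ℝ E] [CompleteSpace E]

/-- A formal solution, to any order at an equilibrium, of the inhomogeneous transport equation
`DZ·f + iν Z = β r + Dr·X`. -/
theorem exists_approx_transport {f : E → E} {p : E} (hf : AnalyticAt ℝ f p) (hp : f p = 0)
    {ν : ℝ} (hν : ν ≠ 0) {β : E → ℝ} {X : E → E} (hβ : AnalyticAt ℝ β p)
    (hX : AnalyticAt ℝ X p)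
    (hβf : ∀ᶠ x in 𝓝 p, fderiv ℝ β x (f x) = 0)
    (hXf : ∀ᶠ x in 𝓝 p, fderiv ℝ X x (f x) = fderiv ℝ f x (X x)) (l : List ℝ)
    {Z r : E → ℂ} (hZ : AnalyticAt ℝ Z p) (hr : AnalyticAt ℝ r p) (hr0 : r p = 0)
    (h : ∀ᶠ x in 𝓝 p, fderiv ℝ Z x (f x) + Complex.I * ν * Z x
      = β x * r x + fderiv ℝ r x (X x)) :
    ∃ (u : E → ℂ) (C : ℂ), AnalyticAt ℝ u p ∧ u p = 0 ∧
      ∀ᶠ x in 𝓝 p, Z x = β x * u x + fderiv ℝ u x (X x)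
        + C * transportOps f (fun _ => 0) l Z x := by
  induction l generalizing Z r with
  | nil => exact ⟨fun _ => 0, 1, analyticAt_const, rfl, by simp [transportOps]⟩
  | cons c l ih =>
    have hN : AnalyticAt ℝ (fun _ : E => (0 : ℂ →L[ℝ] ℂ)) p := analyticAt_const
    have hκ : (Complex.I * ν + c : ℂ) ≠ 0 := by
      intro h0
      have := congrArg Complex.im h0
      simp at this
      exact hν this
    obtain ⟨u', C', hu', hu'0, e⟩ := ih (Z := transportOp f (fun _ => 0) c Z)
      (r := transportOp f (fun _ => 0) c r) (analyticAt_transportOp hf hN hZ)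
      (analyticAt_transportOp hf hN hr) (by simp [transportOp, hp, hr0]) (by
        filter_upwards [h.eventually_nhds, hβf, hXf, hf.eventually_analyticAt,
          hZ.eventually_analyticAt, hr.eventually_analyticAt, hβ.eventually_analyticAt,
          hX.eventually_analyticAt] with x h hβf hXf hf hZ hr hβ hX
        have hx := h.self_of_nhds
        have hd := (EventuallyEq.fderiv_eq (𝕜 := ℝ) h)
        have hDZ := (hZ.fderiv.clm_apply_fun hf).differentiableAt
        have hDrX := (hr.fderiv.clm_apply_fun hX).differentiableAt
        have hDrf := (hr.fderiv.clm_apply_fun hf).differentiableAt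
        have hβC : HasFDerivAt (fun x => (β x : ℂ))
            (Complex.ofRealCLM.comp (fderiv ℝ β x)) x :=
          Complex.ofRealCLM.hasFDerivAt.comp x hβ.differentiableAt.hasFDerivAt
        have hd := congrArg (fun L => L (f x)) hd
        beta_reduce at hd
        rw [(hDZ.hasFDerivAt.fun_add (hZ.differentiableAt.hasFDerivAt.const_mul _)).fderiv,
          ((hβC.fun_mul hr.differentiableAt.hasFDerivAt).fun_add hDrX.hasFDerivAt).fderiv] at hd
        simp only [add_apply, smul_apply, smul_eq_mul, ContinuousLinearMap.comp_apply,
          Complex.ofRealCLM_apply, hβf, Complex.ofReal_zero, mul_zero, add_zero] at hd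
        rw [fderiv_fderiv_apply_comm hr hX.differentiableAt hf.differentiableAt hXf] at hd
        have e1 : transportOp f (fun _ => 0) c Z
            = fun x => fderiv ℝ Z x (f x) - c • Z x := by
          funext x; simp [transportOp]
        have e2 : transportOp f (fun _ => 0) c r
            = fun x => fderiv ℝ r x (f x) - c • r x := by
          funext x; simp [transportOp]
        rw [e1, e2, (hDZ.hasFDerivAt.fun_sub
          (hZ.differentiableAt.hasFDerivAt.fun_const_smul c) :
            HasFDerivAt (fun x => fderiv ℝ Z x (f x) - c • Z x) _ x).fderiv,
          (hDrf.hasFDerivAt.fun_sub (hr.differentiableAt.hasFDerivAt.fun_const_smul c) :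
            HasFDerivAt (fun x => fderiv ℝ r x (f x) - c • r x) _ x).fderiv]
        simp only [sub_apply, smul_apply, Complex.real_smul]
        linear_combination hd - c * hx)
    refine ⟨fun x => (Complex.I * ν + c)⁻¹ * (r x - u' x), -(Complex.I * ν + c)⁻¹ * C',
      analyticAt_const.mul (hr.sub hu'), by simp [hr0, hu'0], ?_⟩
    filter_upwards [h, e, hr.eventually_analyticAt, hu'.eventually_analyticAt] with x h e hr hu'
    rw [((hr.differentiableAt.hasFDerivAt.fun_sub hu'.differentiableAt.hasFDerivAt).const_mul
      ((Complex.I * ν + c)⁻¹) : HasFDerivAt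
        (fun x => (Complex.I * ν + c : ℂ)⁻¹ * (r x - u' x)) _ x).fderiv]
    simp only [transportOp, zero_apply, add_zero, Complex.real_smul] at e
    simp only [transportOps, smul_apply, sub_apply, smul_eq_mul]
    have e' : ∀ T : ℂ, fderiv ℝ Z x (f x) - c * Z x = β x * u' x + fderiv ℝ u' x (X x)
        + C' * T → Z x = β x * ((Complex.I * ν + c)⁻¹ * (r x - u' x))
          + (Complex.I * ν + c)⁻¹ * (fderiv ℝ r x (X x) - fderiv ℝ u' x (X x))
          + -(Complex.I * ν + c)⁻¹ * C' * T := by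
      intro T hT
      field_simp
      linear_combination h - hT
    apply e'
    exact e

end Approximation

section Convergence
variable {E : Type*} [NormedAddCommGroup E] [NormedSpace ℝ E]
variable {f : E → E} {p : E} {lam : ℝ} {ξ η : E →L[ℝ] ℝ} {e₁ e₂ : E}

theorem SaddlePoint.eventually_abs_remainder_le (hs : SaddlePoint f p lam ξ η e₁ e₂)
    {ζ : E →L[ℝ] ℝ} {σ : ℝ} (h : ∀ v, ζ (fderiv ℝ f p v) = σ * ζ v) {ε : ℝ} (hε : 0 < ε) :
    ∀ᶠ x in 𝓝 p, |ζ (f x) - σ * ζ (x - p)| ≤ ε * (|ξ (x - p)| + |η (x - p)|) := by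
  set K : ℝ := (‖ζ‖ + 1) * (‖e₁‖ + ‖e₂‖ + 1) with hK
  have hKpos : 0 < K := by positivity
  have hlo := hs.analyticAt.differentiableAt.hasFDerivAt.isLittleO
  have hb := hlo.def (div_pos hε hKpos)
  filter_upwards [hb] with x hx
  rw [hs.apply_eq_zero, sub_zero] at hx
  rw [← h (x - p), ← map_sub, ← Real.norm_eq_abs]
  have h1 : ‖x - p‖ ≤ (‖e₁‖ + ‖e₂‖ + 1) * (|ξ (x - p)| + |η (x - p)|) := by
    conv_lhs => rw [hs.decomp (x - p)]
    refine (norm_add_le _ _).trans ?_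
    rw [norm_smul, norm_smul, Real.norm_eq_abs, Real.norm_eq_abs]
    nlinarith [abs_nonneg (ξ (x - p)), abs_nonneg (η (x - p)), norm_nonneg e₁, norm_nonneg e₂,
      mul_nonneg (abs_nonneg (ξ (x - p))) (norm_nonneg e₂),
      mul_nonneg (abs_nonneg (η (x - p))) (norm_nonneg e₁)]
  calc ‖ζ (f x - fderiv ℝ f p (x - p))‖ ≤ ‖ζ‖ * ‖f x - fderiv ℝ f p (x - p)‖ := ζ.le_opNorm _
    _ ≤ (‖ζ‖ + 1) * (ε / K * ‖x - p‖) := by gcongr; linarith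
    _ ≤ (‖ζ‖ + 1) * (ε / K * ((‖e₁‖ + ‖e₂‖ + 1) * (|ξ (x - p)| + |η (x - p)|))) := by gcongr
    _ = ε * (|ξ (x - p)| + |η (x - p)|) := by
      rw [hK]
      field_simp

/-- A solution converging to a saddle converges exponentially fast. -/
theorem SaddlePoint.exists_exp_bound (hs : SaddlePoint f p lam ξ η e₁ e₂) {γ : ℝ → E}
    (hγ : ∀ t, HasDerivAt γ (f (γ t)) t) (hlim : Tendsto γ atTop (𝓝 p)) :
    ∃ C > 0, ∃ μ > 0, ∀ t ≥ 0, ‖γ t - p‖ ≤ C * Real.exp (-μ * t) := by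
  have hlam := hs.pos
  have h4 : 0 < lam / 4 := by linarith
  have hev := hlim.eventually ((hs.eventually_abs_remainder_le hs.left h4).and
    (hs.eventually_abs_remainder_le hs.right h4))
  obtain ⟨T, hT⟩ := (hev.and (eventually_ge_atTop 0)).exists_forall_of_atTop
  have hT0 : 0 ≤ T := (hT T le_rfl).2
  set a : ℝ → ℝ := fun t => ξ (γ t - p)
  set b : ℝ → ℝ := fun t => η (γ t - p)
  have ha : ∀ t, HasDerivAt a (ξ (f (γ t))) t := fun t =>
    ξ.hasFDerivAt.comp_hasDerivAt t ((hγ t).sub_const p)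
  have hb : ∀ t, HasDerivAt b (η (f (γ t))) t := fun t =>
    η.hasFDerivAt.comp_hasDerivAt t ((hγ t).sub_const p)
  have hR1 : ∀ t ≥ T, |ξ (f (γ t)) - lam * a t| ≤ lam / 4 * (|a t| + |b t|) :=
    fun t ht => (hT t ht).1.1
  have hR2 : ∀ t ≥ T, |η (f (γ t)) + lam * b t| ≤ lam / 4 * (|a t| + |b t|) := fun t ht => by
    have := (hT t ht).1.2
    rwa [neg_mul, sub_neg_eq_add] at this
  have hlim0 : ∀ ζ : E →L[ℝ] ℝ, Tendsto (fun t => ζ (γ t - p)) atTop (𝓝 0) := fun ζ => by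
    have := (ζ.continuous.tendsto (p - p)).comp (hlim.sub_const p)
    rwa [sub_self, map_zero] at this
  -- the quadratic form `a² - b²` increases to zero
  have hS : MonotoneOn (fun t => a t ^ 2 - b t ^ 2) (Set.Ici T) := by
    have hd : ∀ t, HasDerivAt (fun t => a t ^ 2 - b t ^ 2)
        (2 * a t * ξ (f (γ t)) - 2 * b t * η (f (γ t))) t := fun t => by
      have := ((ha t).fun_pow 2).fun_sub ((hb t).fun_pow 2)
      simpa only [Nat.cast_ofNat, Nat.add_one_sub_one, pow_one, Nat.reduceSub] using this
    refine monotoneOn_of_deriv_nonneg (convex_Ici T)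
      (fun t _ => (hd t).continuousAt.continuousWithinAt)
      (fun t _ => (hd t).differentiableAt.differentiableWithinAt) fun t ht => ?_
    rw [interior_Ici] at ht
    rw [(hd t).deriv]
    have h1 := hR1 t ht.le
    have h2 := hR2 t ht.le
    have k1 : |a t * (ξ (f (γ t)) - lam * a t)| ≤ |a t| * (lam / 4 * (|a t| + |b t|)) := by
      rw [abs_mul]; gcongr
    have k2 : |b t * (η (f (γ t)) + lam * b t)| ≤ |b t| * (lam / 4 * (|a t| + |b t|)) := by
      rw [abs_mul]; gcongr
    have k1' := (abs_le.1 k1).1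
    have k2' := (abs_le.1 k2).2
    nlinarith [sq_abs (a t), sq_abs (b t), sq_nonneg (|a t| - |b t|), sq_nonneg (a t),
      sq_nonneg (b t)]
  have hSle : ∀ t ≥ T, a t ^ 2 ≤ b t ^ 2 := fun t ht => by
    have hl : Tendsto (fun t => a t ^ 2 - b t ^ 2) atTop (𝓝 0) := by
      have := ((hlim0 ξ).pow 2).sub ((hlim0 η).pow 2)
      rwa [sub_self] at this
    have := ge_of_tendsto hl ((eventually_ge_atTop t).mono fun s hs =>
      hS (Set.mem_Ici.2 ht) (Set.mem_Ici.2 (le_trans ht hs)) hs)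
    simpa using this
  have hA : AntitoneOn (fun t => b t ^ 2 * Real.exp (lam * t)) (Set.Ici T) := by
    have hd : ∀ t, HasDerivAt (fun t => b t ^ 2 * Real.exp (lam * t))
        (2 * b t * η (f (γ t)) * Real.exp (lam * t)
          + b t ^ 2 * (Real.exp (lam * t) * lam)) t := fun t => by
      have h1 := ((hasDerivAt_id t).const_mul lam).exp
      have := ((hb t).fun_pow 2).fun_mul h1
      simpa only [Nat.cast_ofNat, Nat.add_one_sub_one, pow_one, Nat.reduceSub, id, mul_one]
        using this
    refine antitoneOn_of_deriv_nonpos (convex_Ici T)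
      (fun t _ => (hd t).continuousAt.continuousWithinAt)
      (fun t _ => (hd t).differentiableAt.differentiableWithinAt) fun t ht => ?_
    rw [interior_Ici] at ht
    rw [(hd t).deriv]
    have h2 := hR2 t ht.le
    have h3 : |a t| ≤ |b t| := sq_le_sq.1 (hSle t ht.le)
    have k2 : |b t * (η (f (γ t)) + lam * b t)| ≤ |b t| * (lam / 4 * (|b t| + |b t|)) := by
      rw [abs_mul]
      gcongr
      exact h2.trans (by gcongr)
    have k2' := (abs_le.1 k2).2
    have : 2 * b t * η (f (γ t)) + b t ^ 2 * lam ≤ 0 := by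
      nlinarith [sq_abs (b t)]
    have := mul_nonpos_of_nonpos_of_nonneg this (Real.exp_pos (lam * t)).le
    linarith
  -- pointwise bound for large times
  set D : ℝ := |b T| * Real.exp (lam / 2 * T)
  have hbt : ∀ t ≥ T, |b t| ≤ D * Real.exp (-(lam / 2) * t) := fun t ht => by
    have h1 : b t ^ 2 * Real.exp (lam * t) ≤ b T ^ 2 * Real.exp (lam * T) :=
      hA (Set.mem_Ici.2 le_rfl) (Set.mem_Ici.2 ht) ht
    have h2 : |b t| * Real.exp (lam / 2 * t) ≤ D := by
      refine abs_le_of_sq_le_sq' ?_ (by positivity) |>.2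
      rw [mul_pow, mul_pow, sq_abs, sq_abs, ← Real.exp_nat_mul, ← Real.exp_nat_mul]
      have e : ∀ s, ((2 : ℕ) : ℝ) * (lam / 2 * s) = lam * s := fun s => by push_cast; ring
      rwa [e, e]
    calc |b t| = |b t| * Real.exp (lam / 2 * t) * Real.exp (-(lam / 2) * t) := by
          rw [mul_assoc, ← Real.exp_add]; simp
      _ ≤ _ := by gcongr
  have hcont : Continuous γ := continuous_iff_continuousAt.2 fun t => (hγ t).continuousAt
  obtain ⟨B, hB⟩ := (isCompact_Icc (a := 0) (b := T)).exists_bound_of_continuousOn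
    (hcont.sub continuous_const : Continuous fun t => γ t - p).continuousOn
  refine ⟨(‖e₁‖ + ‖e₂‖) * D + |B| * Real.exp (lam / 2 * T) + 1, by positivity, lam / 2,
    by linarith, fun t ht => ?_⟩
  rcases le_total t T with h | h
  · calc ‖γ t - p‖ ≤ |B| := (hB t ⟨ht, h⟩).trans (le_abs_self B)
      _ = |B| * Real.exp (lam / 2 * T) * Real.exp (-(lam / 2) * T) := by
          rw [mul_assoc, ← Real.exp_add]; simp
      _ ≤ ((‖e₁‖ + ‖e₂‖) * D + |B| * Real.exp (lam / 2 * T) + 1)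
          * Real.exp (-(lam / 2) * t) := by
          refine mul_le_mul ?_ (Real.exp_le_exp.2 ?_) (Real.exp_pos _).le (by positivity)
          · have : 0 ≤ (‖e₁‖ + ‖e₂‖) * D := by positivity
            linarith
          · nlinarith
  · have h3 : |a t| ≤ |b t| := sq_le_sq.1 (hSle t h)
    calc ‖γ t - p‖ = ‖a t • e₁ + b t • e₂‖ := by rw [← hs.decomp (γ t - p)]
      _ ≤ |a t| * ‖e₁‖ + |b t| * ‖e₂‖ := by
          refine (norm_add_le _ _).trans (le_of_eq ?_)
          rw [norm_smul, norm_smul, Real.norm_eq_abs, Real.norm_eq_abs]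
      _ ≤ |b t| * ‖e₁‖ + |b t| * ‖e₂‖ := by gcongr
      _ = (‖e₁‖ + ‖e₂‖) * |b t| := by ring
      _ ≤ (‖e₁‖ + ‖e₂‖) * (D * Real.exp (-(lam / 2) * t)) := by gcongr; exact hbt t h
      _ = (‖e₁‖ + ‖e₂‖) * D * Real.exp (-(lam / 2) * t) := by ring
      _ ≤ _ := by
          gcongr
          have : 0 ≤ |B| * Real.exp (lam / 2 * T) := by positivity
          linarith

end Convergence

section NearbyOrbits
variable {E : Type*} [NormedAddCommGroup E] [NormedSpace ℝ E]

theorem norm_le_mul_exp_of_hasDerivWithinAt {V V' : ℝ → E} {t L : ℝ}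
    (hV : ∀ τ ∈ Set.Icc 0 t, HasDerivWithinAt V (V' τ) (Set.Icc 0 t) τ)
    (hb : ∀ τ ∈ Set.Icc 0 t, ‖V' τ‖ ≤ L * ‖V τ‖) :
    ∀ τ ∈ Set.Icc 0 t, ‖V τ‖ ≤ ‖V 0‖ * Real.exp (L * τ) := by
  intro τ hτ
  have := norm_le_gronwallBound_of_norm_deriv_right_le (f := V) (f' := V') (δ := ‖V 0‖) (K := L)
    (ε := 0) (a := 0) (b := t) (fun s hs => (hV s hs).continuousWithinAt)
    (fun s hs => (hV s ⟨hs.1, hs.2.le⟩).mono_of_mem_nhdsWithin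
      (Icc_mem_nhdsGE_of_mem hs)) le_rfl
    (fun s hs => by simpa using hb s ⟨hs.1, hs.2.le⟩) τ hτ
  rwa [gronwallBound_ε0, sub_zero] at this

variable [FiniteDimensional ℝ E]

/-- Orbits starting close to a bounded forward orbit exist and stay close. -/
theorem exists_nearby_orbit {f : E → E} (hf : ContDiff ℝ 1 f) {γ : ℝ → E} {p : E}
    (hγ : ∀ t, HasDerivAt γ (f (γ t)) t) (hlim : Tendsto γ atTop (𝓝 p)) :
    ∃ L > 0, ∀ t ≥ 0, ∀ x₀ : E, ‖x₀ - γ 0‖ * Real.exp (L * t) ≤ 1 →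
      ∃ x : ℝ → E, x 0 = x₀ ∧
        (∀ τ ∈ Set.Icc 0 t, HasDerivWithinAt x (f (x τ)) (Set.Icc 0 t) τ) ∧
        (∀ τ ∈ Set.Icc 0 t, ‖x τ - γ τ‖ ≤ ‖x₀ - γ 0‖ * Real.exp (L * τ)) ∧
        (∀ τ ∈ Set.Icc 0 t, ‖fderiv ℝ f (x τ)‖ ≤ L) := by
  have hcont : Continuous γ := continuous_iff_continuousAt.2 fun t => (hγ t).continuousAt
  obtain ⟨R, hR0, hR⟩ : ∃ R > 0, ∀ t ≥ 0, ‖γ t‖ ≤ R := by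
    have h1 : ∀ᶠ t in atTop, ‖γ t‖ ≤ ‖p‖ + 1 :=
      (hlim.norm.eventually_le_const (by linarith))
    obtain ⟨T, hT⟩ := h1.exists_forall_of_atTop
    obtain ⟨B, hB⟩ := (isCompact_Icc (a := 0) (b := T)).exists_bound_of_continuousOn
      hcont.continuousOn
    refine ⟨max (‖p‖ + 1) B, lt_max_of_lt_left (by positivity), fun t ht => ?_⟩
    rcases le_total t T with h | h
    · exact le_max_of_le_right (hB t ⟨ht, h⟩)
    · exact le_max_of_le_left (hT t h)
  let χ : ContDiffBump (0 : E) := ⟨R + 2, R + 3, by linarith, by linarith⟩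
  set F : E → E := fun x => χ x • f x
  have hF : ContDiff ℝ 1 F := χ.contDiff.smul hf
  have hFc : HasCompactSupport F := χ.hasCompactSupport.smul_right
  have hFf : ∀ x, ‖x‖ ≤ R + 2 → F x = f x := fun x hx => by
    simp only [F]
    rw [χ.one_of_mem_closedBall (by simpa using hx), one_smul]
  obtain ⟨K, hK⟩ := hF.lipschitzWith_of_hasCompactSupport hFc (by simp)
  obtain ⟨M, hM⟩ := hFc.exists_bound_of_continuous hF.continuous
  have hγF : ∀ t ≥ 0, HasDerivAt γ (F (γ t)) t := fun t ht => by
    rw [hFf _ ((hR t ht).trans (by linarith))]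
    exact hγ t
  refine ⟨K + 1, by positivity, fun t ht x₀ hx₀ => ?_⟩
  have hM0 : 0 ≤ M := (norm_nonneg _).trans (hM 0)
  have hPL : IsPicardLindelof (fun _ => F) (tmin := 0) (tmax := t) ⟨0, le_rfl, ht⟩ x₀
      ⟨M * t, by positivity⟩ 0 ⟨M, hM0⟩ K :=
    { lipschitzOnWith := fun _ _ => hK.lipschitzOnWith
      continuousOn := fun _ _ => continuousOn_const
      norm_le := fun _ _ x _ => hM x
      mul_max_le := by
        simp only [sub_zero, sub_self, max_eq_left ht, NNReal.coe_zero]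
        exact le_rfl }
  obtain ⟨x, hx0, hx⟩ := hPL.exists_eq_forall_mem_Icc_hasDerivWithinAt₀
  have hdist : ∀ τ ∈ Set.Icc 0 t, ‖x τ - γ τ‖ ≤ ‖x₀ - γ 0‖ * Real.exp (K * τ) := by
    intro τ hτ
    have := dist_le_of_trajectories_ODE (v := fun _ => F) (f := x) (g := γ) (a := 0) (b := t)
      (δ := ‖x₀ - γ 0‖) (fun _ => hK) (fun s hs => (hx s hs).continuousWithinAt)
      (fun s hs => (hx s ⟨hs.1, hs.2.le⟩).mono_of_mem_nhdsWithin (Icc_mem_nhdsGE_of_mem hs))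
      hcont.continuousOn (fun s hs => (hγF s hs.1).hasDerivWithinAt)
      (by rw [dist_eq_norm]; exact le_of_eq (by rw [← hx0])) τ hτ
    rwa [dist_eq_norm, sub_zero] at this
  have hexp : ∀ τ ≥ 0, Real.exp (K * τ) ≤ Real.exp ((K + 1) * τ) := fun τ hτ =>
    Real.exp_le_exp.2 (by nlinarith)
  have hnorm : ∀ τ ∈ Set.Icc 0 t, ‖x τ‖ ≤ R + 1 := fun τ hτ => by
    have h1 := hdist τ hτ
    have h2 : ‖x₀ - γ 0‖ * Real.exp (K * τ) ≤ ‖x₀ - γ 0‖ * Real.exp ((K + 1) * t) := by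
      gcongr
      · exact hτ.1
      · linarith
      · exact hτ.2
    have h3 := norm_add_le (x τ - γ τ) (γ τ)
    rw [sub_add_cancel] at h3
    linarith [hR τ hτ.1]
  refine ⟨x, hx0, fun τ hτ => ?_, fun τ hτ => (hdist τ hτ).trans ?_, fun τ hτ => ?_⟩
  · have := hx τ hτ
    rwa [hFf _ ((hnorm τ hτ).trans (by linarith))] at this
  · exact mul_le_mul_of_nonneg_left (hexp τ hτ.1) (norm_nonneg _)
  · have he : f =ᶠ[𝓝 (x τ)] F := by
      have : Metric.ball (0 : E) (R + 2) ∈ 𝓝 (x τ) := Metric.isOpen_ball.mem_nhds (by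
        rw [mem_ball_zero_iff]; linarith [hnorm τ hτ])
      filter_upwards [this] with y hy
      rw [mem_ball_zero_iff] at hy
      exact (hFf y hy.le).symm
    rw [he.fderiv_eq]
    linarith [norm_fderiv_le_of_lipschitz ℝ (x₀ := x τ) hK]

end NearbyOrbits

section Tube
variable {E : Type*} [NormedAddCommGroup E] [NormedSpace ℝ E]

theorem isCompact_insert_forward_orbit {γ : ℝ → E} {p : E} (hγ : Continuous γ)
    (hlim : Tendsto γ atTop (𝓝 p)) : IsCompact (insert p (γ '' Set.Ici 0)) := by
  have h : Tendsto (fun s : NNReal => γ s) (cocompact NNReal) (𝓝 p) := by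
    rw [cocompact_eq_atTop]
    exact hlim.comp (NNReal.tendsto_coe_atTop.2 tendsto_id)
  have := h.isCompact_insert_range_of_cocompact (hγ.comp NNReal.continuous_coe)
  convert this using 2
  ext y
  constructor
  · rintro ⟨t, ht, rfl⟩
    exact ⟨⟨t, ht⟩, rfl⟩
  · rintro ⟨t, rfl⟩
    exact ⟨t, t.2, rfl⟩

theorem exists_tube_fderiv_bound [FiniteDimensional ℝ E] {W : Type*} [NormedAddCommGroup W]
    [NormedSpace ℝ W] [CompleteSpace W] {γ : ℝ → E} {p : E} (hγ : Continuous γ)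
    (hlim : Tendsto γ atTop (𝓝 p)) {O : Set E} (hO : IsOpen O) (hp : p ∈ O)
    (hγO : ∀ t ≥ 0, γ t ∈ O) {r : E → W} (hr : AnalyticOnNhd ℝ r O) :
    ∃ ρ > 0, ∃ B ≥ 0, ∀ t ≥ 0, ∀ y, ‖y - γ t‖ ≤ ρ → y ∈ O ∧ ‖fderiv ℝ r y‖ ≤ B := by
  have hK := isCompact_insert_forward_orbit hγ hlim
  have hKO : insert p (γ '' Set.Ici 0) ⊆ O := by
    rintro y (rfl | ⟨t, ht, rfl⟩)
    exacts [hp, hγO t ht]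
  obtain ⟨ρ, hρ, hρO⟩ := hK.exists_cthickening_subset_open hO hKO
  obtain ⟨B, hB⟩ := (hK.cthickening (r := ρ)).exists_bound_of_continuousOn
    (f := fderiv ℝ r) (fun y hy => (hr y (hρO hy)).fderiv.continuousAt.continuousWithinAt)
  refine ⟨ρ, hρ, |B|, abs_nonneg B, fun t ht y hy => ?_⟩
  have hmem : y ∈ Metric.cthickening ρ (insert p (γ '' Set.Ici 0)) :=
    Metric.mem_cthickening_of_dist_le y (γ t) ρ _ (Or.inr ⟨t, ht, rfl⟩) (by rwa [dist_eq_norm])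
  exact ⟨hρO hmem, (hB y hmem).trans (le_abs_self B)⟩

theorem integrableOn_exp_mul_comp {γ : ℝ → E} {p : E} {C μ ν : ℝ} (hγ : Continuous γ)
    (hμ : 0 < μ) (hb : ∀ t ≥ 0, ‖γ t - p‖ ≤ C * Real.exp (-μ * t)) {r : E → ℂ}
    (hlim : Tendsto γ atTop (𝓝 p))
    (hr : DifferentiableAt ℝ r p) (hr0 : r p = 0) (hc : ∀ t ≥ 0, ContinuousAt r (γ t)) :
    IntegrableOn (fun t : ℝ => Complex.exp (Complex.I * ν * t) * r (γ t)) (Set.Ioi 0) := by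
  have hcont : ContinuousOn (fun t : ℝ => Complex.exp (Complex.I * ν * t) * r (γ t))
      (Set.Ici 0) := by
    refine ContinuousOn.mul (by fun_prop) fun t ht => ?_
    exact ((hc t ht).comp hγ.continuousAt).continuousWithinAt
  have hO : (fun t => r (γ t)) =O[atTop] fun t => Real.exp (-μ * t) := by
    have h1 : (fun x => r x - r p) =O[𝓝 p] fun x => x - p := hr.isBigO_sub
    simp only [hr0, sub_zero] at h1
    refine (h1.comp_tendsto hlim).trans ?_
    refine Asymptotics.IsBigO.of_bound C ?_
    filter_upwards [eventually_ge_atTop 0] with t ht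
    rw [Real.norm_eq_abs, abs_of_pos (Real.exp_pos _)]
    exact hb t ht
  have hn : IntegrableOn (fun t : ℝ => ‖Complex.exp (Complex.I * ν * t) * r (γ t)‖)
      (Set.Ioi 0) := by
    refine integrable_of_isBigO_exp_neg hμ hcont.norm ?_
    refine Asymptotics.IsBigO.trans ?_ hO
    refine Asymptotics.IsBigO.of_bound 1 (Eventually.of_forall fun t => ?_)
    rw [norm_norm, norm_mul, Complex.norm_exp]
    simp
  exact (integrable_norm_iff
    ((hcont.mono Set.Ioi_subset_Ici_self).aestronglyMeasurable measurableSet_Ioi)).1 hn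

end Tube

section OrbitEstimate
variable {E : Type*} [NormedAddCommGroup E] [NormedSpace ℝ E]
  {f X : E → E} {β : E → ℝ} {Z r : E → ℂ} {O : Set E} {ν : ℝ}

/-- The system of equations `DZ·f + iνZ = β r + Dr·X`, `Dβ·f = 0`, `DX·f = Df·X` on `O`. -/
structure TransportData (f : E → E) (O : Set E) (ν : ℝ) (Z r : E → ℂ) (β : E → ℝ)
    (X : E → E) : Prop where
  analytic_Z : AnalyticOnNhd ℝ Z O
  analytic_r : AnalyticOnNhd ℝ r O
  analytic_β : AnalyticOnNhd ℝ β O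
  analytic_X : AnalyticOnNhd ℝ X O
  eq_Z : ∀ x ∈ O, fderiv ℝ Z x (f x) + Complex.I * ν * Z x = β x * r x + fderiv ℝ r x (X x)
  eq_β : ∀ x ∈ O, fderiv ℝ β x (f x) = 0
  eq_X : ∀ x ∈ O, fderiv ℝ X x (f x) = fderiv ℝ f x (X x)

namespace TransportData

theorem β_orbit (h : TransportData f O ν Z r β X) {x : ℝ → E} {t : ℝ}
    (hx : ∀ τ ∈ Set.Icc 0 t, HasDerivWithinAt x (f (x τ)) (Set.Icc 0 t) τ)
    (hxO : ∀ τ ∈ Set.Icc 0 t, x τ ∈ O) : ∀ τ ∈ Set.Icc 0 t, β (x τ) = β (x 0) := by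
  have hd : ∀ τ ∈ Set.Icc 0 t, HasDerivWithinAt (fun τ => β (x τ)) 0 (Set.Icc 0 t) τ := by
    intro τ hτ
    have := (h.analytic_β _ (hxO τ hτ)).differentiableAt.hasFDerivAt.comp_hasDerivWithinAt τ
      (hx τ hτ)
    rwa [h.eq_β _ (hxO τ hτ)] at this
  intro τ hτ
  have := norm_image_sub_le_of_norm_deriv_le_segment' (C := 0) hd (fun _ _ => by simp) τ hτ
  rw [zero_mul] at this
  exact sub_eq_zero.1 (norm_le_zero_iff.1 this)

theorem X_orbit (h : TransportData f O ν Z r β X) {x : ℝ → E} {t L α : ℝ}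
    (hf : Differentiable ℝ f)
    (hx : ∀ τ ∈ Set.Icc 0 t, HasDerivWithinAt x (f (x τ)) (Set.Icc 0 t) τ)
    (hxO : ∀ τ ∈ Set.Icc 0 t, x τ ∈ O) (hL : ∀ τ ∈ Set.Icc 0 t, ‖fderiv ℝ f (x τ)‖ ≤ L) :
    ∀ τ ∈ Set.Icc 0 t, ‖X (x τ) - α • f (x τ)‖ ≤ ‖X (x 0) - α • f (x 0)‖ * Real.exp (L * τ) := by
  refine norm_le_mul_exp_of_hasDerivWithinAt (V := fun τ => X (x τ) - α • f (x τ))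
    (V' := fun τ => fderiv ℝ f (x τ) (X (x τ) - α • f (x τ))) (fun τ hτ => ?_) (fun τ hτ => ?_)
  · have h1 := (h.analytic_X _ (hxO τ hτ)).differentiableAt.hasFDerivAt.comp_hasDerivWithinAt τ
      (hx τ hτ)
    have h2 := (hf (x τ)).hasFDerivAt.comp_hasDerivWithinAt τ (hx τ hτ)
    have := h1.fun_sub (h2.fun_const_smul α)
    rw [map_sub, map_smul, ← h.eq_X _ (hxO τ hτ)]
    exact this
  · exact (ContinuousLinearMap.le_opNorm _ _).trans
      (mul_le_mul_of_nonneg_right (hL τ hτ) (norm_nonneg _))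

theorem orbit_estimate (h : TransportData f O ν Z r β X) {x γ : ℝ → E} {t L α B D ρ : ℝ}
    (ht : 0 ≤ t) (hf : Differentiable ℝ f) (hγ : Continuous γ) (hγO : ∀ t, γ t ∈ O)
    (hB0 : 0 ≤ B) (hL0 : 0 ≤ L)
    (hρ : ∀ t ≥ 0, ∀ y, ‖y - γ t‖ ≤ ρ → y ∈ O ∧ ‖fderiv ℝ r y‖ ≤ B)
    (hx : ∀ τ ∈ Set.Icc 0 t, HasDerivWithinAt x (f (x τ)) (Set.Icc 0 t) τ)
    (hD : ∀ τ ∈ Set.Icc 0 t, ‖x τ - γ τ‖ ≤ D) (hDρ : D ≤ ρ)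
    (hL : ∀ τ ∈ Set.Icc 0 t, ‖fderiv ℝ f (x τ)‖ ≤ L) :
    ‖Complex.exp (Complex.I * ν * t) * (Z (x t) - α * r (x t))
      - (β (x 0) - Complex.I * ν * α) *
        (∫ s in (0 : ℝ)..t, Complex.exp (Complex.I * ν * s) * r (γ s))
      - (Z (x 0) - α * r (x 0))‖
      ≤ ((|β (x 0)| + |ν| * |α|) * (B * D)
          + B * (‖X (x 0) - α • f (x 0)‖ * Real.exp (L * t))) * t := by
  have hxO : ∀ τ ∈ Set.Icc 0 t, x τ ∈ O := fun τ hτ =>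
    (hρ τ hτ.1 _ ((hD τ hτ).trans hDρ)).1
  have hβ := h.β_orbit hx hxO
  have hX := h.X_orbit (α := α) hf hx hxO hL
  have hcr : Continuous fun s : ℝ => Complex.exp (Complex.I * ν * s) * r (γ s) := by
    refine Continuous.mul (by fun_prop) (continuous_iff_continuousAt.2 fun s => ?_)
    exact (h.analytic_r _ (hγO s)).continuousAt.comp hγ.continuousAt
  set κ : ℂ := β (x 0) - Complex.I * ν * α
  have hexp : ∀ τ : ℝ, HasDerivAt (fun τ : ℝ => Complex.exp (Complex.I * ν * τ))
      (Complex.exp (Complex.I * ν * τ) * (Complex.I * ν)) τ := fun τ => by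
    have := ((Complex.ofRealCLM.hasDerivAt (x := τ)).const_mul (Complex.I * ν)).cexp
    simpa using this
  have hd : ∀ τ ∈ Set.Icc 0 t, HasDerivWithinAt
      (fun τ : ℝ => Complex.exp (Complex.I * ν * τ) * (Z (x τ) - α * r (x τ))
        - κ * ∫ s in (0 : ℝ)..τ, Complex.exp (Complex.I * ν * s) * r (γ s))
      (Complex.exp (Complex.I * ν * τ) * (κ * (r (x τ) - r (γ τ))
        + fderiv ℝ r (x τ) (X (x τ) - α • f (x τ)))) (Set.Icc 0 t) τ := by
    intro τ hτ
    have h1 := (h.analytic_Z _ (hxO τ hτ)).differentiableAt.hasFDerivAt.comp_hasDerivWithinAt τ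
      (hx τ hτ)
    have h2 := (h.analytic_r _ (hxO τ hτ)).differentiableAt.hasFDerivAt.comp_hasDerivWithinAt τ
      (hx τ hτ)
    have h3 := (hcr.integral_hasStrictDerivAt 0 τ).hasDerivAt.hasDerivWithinAt
      (s := Set.Icc 0 t)
    have h4 := ((hexp τ).hasDerivWithinAt.fun_mul
      (h1.fun_sub (h2.const_mul (α : ℂ)))).fun_sub (h3.const_mul κ)
    refine h4.congr_deriv ?_
    have h5 := h.eq_Z _ (hxO τ hτ)
    rw [hβ τ hτ] at h5
    simp only [Function.comp, map_sub, map_smul, Complex.real_smul, κ]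
    linear_combination Complex.exp (Complex.I * ν * τ) * h5
  have hbd : ∀ τ ∈ Set.Ico 0 t, ‖Complex.exp (Complex.I * ν * τ) * (κ * (r (x τ) - r (γ τ))
        + fderiv ℝ r (x τ) (X (x τ) - α • f (x τ)))‖
      ≤ (|β (x 0)| + |ν| * |α|) * (B * D)
          + B * (‖X (x 0) - α • f (x 0)‖ * Real.exp (L * t)) := by
    intro τ hτ'
    have hτ : τ ∈ Set.Icc 0 t := ⟨hτ'.1, hτ'.2.le⟩
    have e1 : ‖Complex.exp (Complex.I * ν * τ)‖ = 1 := by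
      rw [Complex.norm_exp]; simp
    have e2 : ‖κ‖ ≤ |β (x 0)| + |ν| * |α| := by
      refine (norm_sub_le _ _).trans (le_of_eq ?_)
      simp
    have hD0 : 0 ≤ D := (norm_nonneg _).trans (hD τ hτ)
    have e3 : ‖r (x τ) - r (γ τ)‖ ≤ B * D := by
      have hb : ∀ y ∈ Metric.closedBall (γ τ) D, y ∈ O ∧ ‖fderiv ℝ r y‖ ≤ B := fun y hy =>
        hρ τ hτ.1 y ((mem_closedBall_iff_norm.1 hy).trans hDρ)
      have := (convex_closedBall (γ τ) D).norm_image_sub_le_of_norm_fderiv_le (𝕜 := ℝ)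
        (f := r) (C := B) (x := γ τ) (y := x τ)
        (fun y hy => (h.analytic_r y (hb y hy).1).differentiableAt)
        (fun y hy => (hb y hy).2) (Metric.mem_closedBall_self hD0)
        (mem_closedBall_iff_norm.2 (hD τ hτ))
      exact this.trans (mul_le_mul_of_nonneg_left (hD τ hτ) hB0)
    have e4 : ‖fderiv ℝ r (x τ) (X (x τ) - α • f (x τ))‖
        ≤ B * (‖X (x 0) - α • f (x 0)‖ * Real.exp (L * t)) := by
      refine (ContinuousLinearMap.le_opNorm _ _).trans ?_
      refine mul_le_mul (hρ τ hτ.1 _ ((hD τ hτ).trans hDρ)).2 ((hX τ hτ).trans ?_)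
        (norm_nonneg _) hB0
      gcongr
      exact hτ.2
    rw [norm_mul, e1, one_mul]
    refine (norm_add_le _ _).trans (add_le_add ?_ e4)
    rw [norm_mul]
    exact mul_le_mul e2 e3 (norm_nonneg _) (by positivity)
  have := norm_image_sub_le_of_norm_deriv_le_segment' hd hbd t ⟨ht, le_rfl⟩
  simpa using this

end TransportData
end OrbitEstimate

section HalfLineEstimate
variable {E : Type*} [NormedAddCommGroup E] [NormedSpace ℝ E] [FiniteDimensional ℝ E]
  {f X : E → E} {β : E → ℝ} {Z r : E → ℂ} {O : Set E} {ν : ℝ}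
  {p : E} {lam : ℝ} {ξ η : E →L[ℝ] ℝ} {e₁ e₂ : E}

theorem tendsto_affine_mul_exp_neg (a b : ℝ) {c : ℝ} (hc : 0 < c) :
    Tendsto (fun t : ℝ => (a * t + b) * Real.exp (-c * t)) atTop (𝓝 0) := by
  have h1 : Tendsto (fun t : ℝ => t * Real.exp (-c * t)) atTop (𝓝 0) := by
    have := tendsto_rpow_mul_exp_neg_mul_atTop_nhds_zero 1 c hc
    simpa using this
  have h2 : Tendsto (fun t : ℝ => Real.exp (-c * t)) atTop (𝓝 0) := by
    have := tendsto_rpow_mul_exp_neg_mul_atTop_nhds_zero 0 c hc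
    simpa using this
  have := (h1.const_mul a).add (h2.const_mul b)
  simp only [mul_zero, add_zero] at this
  refine this.congr fun t => by ring

namespace TransportData

/-- Near a saddle, `Z - α r` is controlled by `β`, `α`, `X - α f` and a flat remainder. -/
theorem local_estimate (h : TransportData f O ν Z r β X)
    (hs : SaddlePoint f p lam ξ η e₁ e₂)
    (hO : IsOpen O) (hp : p ∈ O) (hν : ν ≠ 0) (hr0 : r p = 0) (K : ℕ) :
    ∃ B' ≥ 0, ∀ δ > 0, ∃ C₂ ≥ 0, ∀ᶠ x in 𝓝 p, ∀ α : ℝ, ‖Z x - α * r x‖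
      ≤ δ * (|β x| + |α|) + B' * ‖X x - α • f x‖ + C₂ * ‖x - p‖ ^ K := by
  have : CompleteSpace E := FiniteDimensional.complete ℝ E
  obtain ⟨l, hl⟩ := hs.exists_flattening (V := ℂ) (N := fun _ => 0) analyticAt_const
    (SaddlePoint.transportOps_zero_base hs.apply_eq_zero) K
  have hOp : ∀ᶠ x in 𝓝 p, x ∈ O := hO.mem_nhds hp
  have hZa := h.analytic_Z p hp
  have hra := h.analytic_r p hp
  obtain ⟨u, C', hu, hu0, hev⟩ := exists_approx_transport hs.analyticAt hs.apply_eq_zero hν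
    (h.analytic_β p hp) (h.analytic_X p hp) (hOp.mono h.eq_β) (hOp.mono h.eq_X) l hZa hra hr0
    (hOp.mono h.eq_Z)
  obtain ⟨C₃, hC₃⟩ := (hl Z hZa).isBigO.bound
  have hB : ∀ᶠ x in 𝓝 p, ‖fderiv ℝ u x‖ ≤ ‖fderiv ℝ u p‖ + 1 :=
    hu.fderiv.continuousAt.norm.eventually_le_const (by linarith)
  refine ⟨‖fderiv ℝ u p‖ + 1, by positivity, fun δ hδ => ⟨‖C'‖ * |C₃|, by positivity, ?_⟩⟩
  set B' := ‖fderiv ℝ u p‖ + 1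
  have hB'0 : 0 ≤ B' := by positivity
  set δ' := δ / (1 + B')
  have hδ' : 0 < δ' := by positivity
  have hδe : δ' * (1 + B') = δ := div_mul_cancel₀ _ (by positivity)
  have e1 : ∀ᶠ x in 𝓝 p, ‖u x‖ ≤ δ' :=
    hu.continuousAt.norm.eventually_le_const (by simpa [hu0] using hδ')
  have e2 : ∀ᶠ x in 𝓝 p, ‖r x‖ ≤ δ' :=
    hra.continuousAt.norm.eventually_le_const (by simpa [hr0] using hδ')
  have e3 : ∀ᶠ x in 𝓝 p, ‖f x‖ ≤ δ' :=
    hs.analyticAt.continuousAt.norm.eventually_le_const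
      (by simpa [hs.apply_eq_zero] using hδ')
  filter_upwards [hev, hC₃, hB, e1, e2, e3] with x hx hx3 hxB h1 h2 h3 α
  have hX : fderiv ℝ u x (X x) = α * fderiv ℝ u x (f x) + fderiv ℝ u x (X x - α • f x) := by
    rw [map_sub, map_smul, Complex.real_smul]; ring
  rw [hx, hX]
  have i1 : ‖(β x : ℂ) * u x‖ ≤ |β x| * δ' := by
    rw [norm_mul, Complex.norm_real, Real.norm_eq_abs]; gcongr
  have i2 : ‖(α : ℂ) * fderiv ℝ u x (f x)‖ ≤ |α| * (B' * δ') := by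
    rw [norm_mul, Complex.norm_real, Real.norm_eq_abs]
    gcongr
    exact (ContinuousLinearMap.le_opNorm _ _).trans (by gcongr)
  have i3 : ‖fderiv ℝ u x (X x - α • f x)‖ ≤ B' * ‖X x - α • f x‖ :=
    (ContinuousLinearMap.le_opNorm _ _).trans (by gcongr)
  have i4 : ‖C' * transportOps f (fun _ => 0) l Z x‖ ≤ ‖C'‖ * |C₃| * ‖x - p‖ ^ K := by
    rw [norm_mul, mul_assoc]
    gcongr
    refine hx3.trans ?_
    rw [norm_pow, norm_norm]
    gcongr
    exact le_abs_self _
  have i5 : ‖(α : ℂ) * r x‖ ≤ |α| * δ' := by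
    rw [norm_mul, Complex.norm_real, Real.norm_eq_abs]; gcongr
  refine (norm_sub_le _ _).trans ((add_le_add ((norm_add_le _ _).trans (add_le_add
    ((norm_add_le _ _).trans (add_le_add i1 ((norm_add_le _ _).trans (add_le_add i2 i3)))) i4))
    i5).trans ?_)
  have : |β x| * δ' ≤ |β x| * δ := by
    gcongr
    rw [← hδe]; nlinarith
  rw [← hδe] at this ⊢
  nlinarith

set_option maxHeartbeats 1000000 in
theorem half_line_estimate (h : TransportData f O ν Z r β X)
    (hs : SaddlePoint f p lam ξ η e₁ e₂) (hf : ContDiff ℝ 1 f) (hO : IsOpen O) (hp : p ∈ O)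
    {γ : ℝ → E} (hγ : ∀ t, HasDerivAt γ (f (γ t)) t) (hlim : Tendsto γ atTop (𝓝 p))
    (hγO : ∀ t, γ t ∈ O) (hν : ν ≠ 0) (hr0 : r p = 0) :
    ∃ C₀ > 0, ∀ C ≥ C₀, ∀ P : ℝ, ∀ δ > 0, ∀ᶠ t in atTop, ∀ (x₀ : E) (α : ℝ),
      ‖x₀ - γ 0‖ ≤ Real.exp (-C * t) →
      ‖Z x₀ - α * r x₀ + (β x₀ - Complex.I * ν * α) *
          ∫ s in Set.Ioi (0 : ℝ), Complex.exp (Complex.I * ν * s) * r (γ s)‖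
        ≤ δ * (|β x₀| + |α|) + Real.exp (C / 2 * t) * ‖X x₀ - α • f x₀‖ + Real.exp (-P * t) := by
  have : CompleteSpace E := FiniteDimensional.complete ℝ E
  have hγc : Continuous γ := continuous_iff_continuousAt.2 fun t => (hγ t).continuousAt
  obtain ⟨L, hL0, hL⟩ := exists_nearby_orbit hf hγ hlim
  obtain ⟨C₁, hC₁, μ, hμ, hexp⟩ := hs.exists_exp_bound hγ hlim
  obtain ⟨ρ, hρ0, B, hB0, hρ⟩ := exists_tube_fderiv_bound hγc hlim hO hp (fun t _ => hγO t)
    h.analytic_r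
  have hintegr := integrableOn_exp_mul_comp (ν := ν) hγc hμ hexp hlim
    (h.analytic_r p hp).differentiableAt hr0 (fun t _ => (h.analytic_r _ (hγO t)).continuousAt)
  refine ⟨2 * L + 2 + μ, by positivity, fun C hC P δ hδ => ?_⟩
  obtain ⟨K, hK⟩ := exists_nat_gt (P / μ)
  have hKμ : 0 < μ * K - P := by
    rw [div_lt_iff₀ hμ] at hK; linarith
  obtain ⟨B', hB'0, hB'⟩ := h.local_estimate hs hO hp hν hr0 K
  obtain ⟨C₂, hC₂0, hC₂⟩ := hB' (δ / 3) (by positivity)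
  obtain ⟨ρ₁, hρ₁, hloc⟩ := Metric.eventually_nhds_iff.1 hC₂
  set I := ∫ s in Set.Ioi (0 : ℝ), Complex.exp (Complex.I * ν * s) * r (γ s)
  set m : ℝ := 1 + |ν|
  have hm : 0 < m := by positivity
  have hCL : 0 < C - L := by linarith
  have t1 : ∀ᶠ t : ℝ in atTop, (1 + C₁) * Real.exp (-μ * t) < ρ₁ := by
    have := tendsto_affine_mul_exp_neg 0 (1 + C₁) hμ
    simp only [zero_mul, zero_add] at this
    exact this.eventually_lt_const hρ₁
  have t2 : ∀ᶠ t : ℝ in atTop, Real.exp (-(C - L) * t) ≤ min ρ 1 := by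
    have := tendsto_affine_mul_exp_neg 0 1 hCL
    simp only [zero_mul, zero_add, one_mul] at this
    exact this.eventually_le_const (lt_min hρ0 one_pos)
  have t3 : ∀ᶠ t : ℝ in atTop, (m * B * t + 0) * Real.exp (-(C - L) * t) ≤ δ / 3 :=
    (tendsto_affine_mul_exp_neg _ _ hCL).eventually_le_const (by positivity)
  have t4 : ∀ᶠ t : ℝ in atTop, m * ‖(∫ s in (0 : ℝ)..t, Complex.exp (Complex.I * ν * s) * r (γ s))
      - I‖ ≤ δ / 3 := by
    have :=
      ((intervalIntegral_tendsto_integral_Ioi 0 hintegr tendsto_id).sub_const I).norm.const_mul m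
    simp only [I, sub_self, norm_zero, mul_zero, id] at this
    exact this.eventually_le_const (by positivity)
  have t5 : ∀ᶠ t : ℝ in atTop, (B * t + B') * Real.exp (-1 * t) ≤ 1 :=
    (tendsto_affine_mul_exp_neg _ _ one_pos).eventually_le_const one_pos
  have t6 : ∀ᶠ t : ℝ in atTop, C₂ * (1 + C₁) ^ K * Real.exp (-(μ * K - P) * t) ≤ 1 := by
    have := tendsto_affine_mul_exp_neg 0 (C₂ * (1 + C₁) ^ K) hKμ
    simp only [zero_mul, zero_add] at this
    exact this.eventually_le_const one_pos
  filter_upwards [t1, t2, t3, t4, t5, t6, eventually_ge_atTop 0] with t t1 t2 t3 t4 t5 t6 ht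
    x₀ α hx₀
  have hD : ‖x₀ - γ 0‖ * Real.exp (L * t) ≤ Real.exp (-(C - L) * t) := by
    calc _ ≤ Real.exp (-C * t) * Real.exp (L * t) := by gcongr
      _ = _ := by rw [← Real.exp_add]; ring_nf
  obtain ⟨x, hx0, hx, hxγ, hxL⟩ := hL t ht x₀ (hD.trans (t2.trans (min_le_right _ _)))
  have hxD : ∀ τ ∈ Set.Icc 0 t, ‖x τ - γ τ‖ ≤ Real.exp (-(C - L) * t) := fun τ hτ =>
    (hxγ τ hτ).trans (le_trans (by gcongr; exact hτ.2) hD)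
  have hDρ := t2.trans (min_le_left ρ 1)
  have key := h.orbit_estimate (α := α) ht (hf.differentiable one_ne_zero) hγc hγO hB0 hL0.le hρ
    hx hxD hDρ hxL
  have hxO : ∀ τ ∈ Set.Icc 0 t, x τ ∈ O := fun τ hτ =>
    (hρ τ hτ.1 _ ((hxD τ hτ).trans hDρ)).1
  have hβt := h.β_orbit hx hxO t ⟨ht, le_rfl⟩
  have hXt := h.X_orbit (α := α) (hf.differentiable one_ne_zero) hx hxO hxL t ⟨ht, le_rfl⟩
  have hxp : ‖x t - p‖ ≤ (1 + C₁) * Real.exp (-μ * t) := by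
    have e1 := hxD t ⟨ht, le_rfl⟩
    have e2 := hexp t ht
    have e3 : Real.exp (-(C - L) * t) ≤ Real.exp (-μ * t) := by
      gcongr; nlinarith
    have := norm_sub_le_norm_sub_add_norm_sub (x t) (γ t) p
    linarith
  have hQ := hloc (y := x t) (by rw [dist_eq_norm]; exact hxp.trans_lt t1) α
  rw [hβt] at hQ
  rw [hx0] at key hQ hXt
  set S := ∫ s in (0 : ℝ)..t, Complex.exp (Complex.I * ν * s) * r (γ s)
  set κ : ℂ := β x₀ - Complex.I * ν * α
  set V := ‖X x₀ - α • f x₀‖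
  have hκ : ‖κ‖ ≤ m * (|β x₀| + |α|) := by
    have : ‖κ‖ ≤ |β x₀| + |ν| * |α| := (norm_sub_le _ _).trans (le_of_eq (by simp))
    have h1 := abs_nonneg ν
    have h2 := abs_nonneg (β x₀)
    have h3 := abs_nonneg α
    simp only [m]
    nlinarith
  have hβα : |β x₀| + |ν| * |α| ≤ m * (|β x₀| + |α|) := by
    have h1 := abs_nonneg ν
    have h2 := abs_nonneg (β x₀)
    have h3 := abs_nonneg α
    simp only [m]
    nlinarith
  have hE : ‖Complex.exp (Complex.I * ν * t) * (Z (x t) - α * r (x t))‖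
      = ‖Z (x t) - α * r (x t)‖ := by
    rw [norm_mul, Complex.norm_exp]; simp
  have hsplit : Z x₀ - α * r x₀ + κ * I
      = -(Complex.exp (Complex.I * ν * t) * (Z (x t) - α * r (x t)) - κ * S - (Z x₀ - α * r x₀))
        + Complex.exp (Complex.I * ν * t) * (Z (x t) - α * r (x t)) - κ * (S - I) := by ring
  have hκI : ‖κ * (S - I)‖ ≤ δ / 3 * (|β x₀| + |α|) := by
    rw [norm_mul]
    calc _ ≤ m * (|β x₀| + |α|) * ‖S - I‖ := by gcongr
      _ = m * ‖S - I‖ * (|β x₀| + |α|) := by ring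
      _ ≤ _ := by gcongr
  have hflat : C₂ * ‖x t - p‖ ^ K ≤ Real.exp (-P * t) := by
    calc _ ≤ C₂ * ((1 + C₁) * Real.exp (-μ * t)) ^ K := by gcongr
      _ = C₂ * (1 + C₁) ^ K * Real.exp (-(μ * K - P) * t) * Real.exp (-P * t) := by
        rw [mul_pow, ← Real.exp_nat_mul, mul_assoc (C₂ * _), ← Real.exp_add]; ring_nf
      _ ≤ 1 * Real.exp (-P * t) := by gcongr
      _ = _ := one_mul _
  have hV : (B * t + B') * Real.exp (L * t) * V ≤ Real.exp (C / 2 * t) * V := by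
    gcongr
    calc _ = (B * t + B') * Real.exp (-1 * t) * Real.exp ((L + 1) * t) := by
          rw [mul_assoc, ← Real.exp_add]; ring_nf
      _ ≤ 1 * Real.exp (C / 2 * t) := by
          gcongr; nlinarith
      _ = _ := one_mul _
  have hmid : (|β x₀| + |ν| * |α|) * (B * Real.exp (-(C - L) * t)) * t
      ≤ δ / 3 * (|β x₀| + |α|) := by
    calc _ ≤ m * (|β x₀| + |α|) * (B * Real.exp (-(C - L) * t)) * t := by gcongr
      _ = (m * B * t + 0) * Real.exp (-(C - L) * t) * (|β x₀| + |α|) := by ring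
      _ ≤ _ := by gcongr
  have hXt' : B' * ‖X (x t) - α • f (x t)‖ ≤ B' * (V * Real.exp (L * t)) := by gcongr
  rw [hsplit]
  refine (norm_sub_le _ _).trans ((add_le_add (norm_add_le _ _) hκI).trans ?_)
  rw [norm_neg, hE]
  linarith

end TransportData
end HalfLineEstimate

section Matching
variable {E : Type*} [NormedAddCommGroup E] [NormedSpace ℝ E] [FiniteDimensional ℝ E]
  {f X : E → E} {β : E → ℝ} {Z r : E → ℂ} {O : Set E} {ν : ℝ}
  {p p' : E} {lam lam' : ℝ} {ξ η ξ' η' : E →L[ℝ] ℝ} {e₁ e₂ e₁' e₂' : E} {γ : ℝ → E}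

theorem SaddlePoint.neg (hs : SaddlePoint f p lam ξ η e₁ e₂) :
    SaddlePoint (fun x => -f x) p lam η ξ e₂ e₁ where
  analyticAt := hs.analyticAt.fun_neg
  apply_eq_zero := by rw [hs.apply_eq_zero, neg_zero]
  pos := hs.pos
  decomp v := by rw [add_comm]; exact hs.decomp v
  left v := by rw [fderiv_fun_neg, neg_apply, map_neg, hs.right]; ring
  right v := by rw [fderiv_fun_neg, neg_apply, map_neg, hs.left]; ring

namespace TransportData

theorem neg (h : TransportData f O ν Z r β X) :
    TransportData (fun x => -f x) O (-ν) (fun x => -Z x) r β X where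
  analytic_Z x hx := (h.analytic_Z x hx).fun_neg
  analytic_r := h.analytic_r
  analytic_β := h.analytic_β
  analytic_X := h.analytic_X
  eq_Z x hx := by
    rw [fderiv_fun_neg, neg_apply, map_neg, neg_neg, ← h.eq_Z x hx]
    push_cast; ring
  eq_β x hx := by rw [map_neg, h.eq_β x hx, neg_zero]
  eq_X x hx := by rw [fderiv_fun_neg, neg_apply, map_neg, h.eq_X x hx]

theorem full_line_estimate (h : TransportData f O ν Z r β X)
    (hs : SaddlePoint f p lam ξ η e₁ e₂) (hs' : SaddlePoint f p' lam' ξ' η' e₁' e₂')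
    (hf : ContDiff ℝ 1 f) (hO : IsOpen O) (hp : p ∈ O) (hp' : p' ∈ O)
    (hγ : ∀ t, HasDerivAt γ (f (γ t)) t) (hlim : Tendsto γ atTop (𝓝 p))
    (hlim' : Tendsto γ atBot (𝓝 p'))
    (hγO : ∀ t, γ t ∈ O) (hν : ν ≠ 0) (hr0 : r p = 0) (hr0' : r p' = 0) :
    ∃ C > 0, ∀ P : ℝ, ∀ δ > 0, ∀ᶠ t in atTop, ∀ (x₀ : E) (α : ℝ),
      ‖x₀ - γ 0‖ ≤ Real.exp (-C * t) →
      ‖(β x₀ - Complex.I * ν * α) * ∫ s : ℝ, Complex.exp (Complex.I * ν * s) * r (γ s)‖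
        ≤ δ * (|β x₀| + |α|) + 2 * Real.exp (C / 2 * t) * ‖X x₀ - α • f x₀‖
          + 2 * Real.exp (-P * t) := by
  have hγ' : ∀ t, HasDerivAt (fun t => γ (-t)) (-f (γ (-t))) t := fun t => by
    have := (hγ (-t)).scomp t (hasDerivAt_neg t)
    rw [neg_one_smul] at this
    exact this
  have hl' : Tendsto (fun t => γ (-t)) atTop (𝓝 p') := hlim'.comp tendsto_neg_atTop_atBot
  have hγc : Continuous γ := continuous_iff_continuousAt.2 fun t => (hγ t).continuousAt
  have hsplit : ∫ s : ℝ, Complex.exp (Complex.I * ν * s) * r (γ s)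
      = (∫ s in Set.Ioi (0 : ℝ), Complex.exp (Complex.I * ν * s) * r (γ s))
        + ∫ s in Set.Ioi (0 : ℝ), Complex.exp (Complex.I * (-ν : ℝ) * s) * r (γ (-s)) := by
    obtain ⟨C₁, -, μ, hμ, hexp⟩ := hs.exists_exp_bound hγ hlim
    obtain ⟨C₁', -, μ', hμ', hexp'⟩ := hs'.neg.exists_exp_bound hγ' hl'
    have i1 := integrableOn_exp_mul_comp (ν := ν) hγc hμ hexp hlim
      (h.analytic_r p hp).differentiableAt hr0
      (fun t _ => (h.analytic_r _ (hγO t)).continuousAt)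
    have i2 := integrableOn_exp_mul_comp (ν := -ν) (γ := fun t => γ (-t))
      (hγc.comp continuous_neg) hμ' hexp' hl'
      (h.analytic_r p' hp').differentiableAt hr0'
      (fun t _ => (h.analytic_r _ (hγO (-t))).continuousAt)
    have hcongr : (fun s : ℝ => Complex.exp (Complex.I * (-ν : ℝ) * s) * r (γ (-s)))
        = fun s : ℝ => (fun s : ℝ => Complex.exp (Complex.I * ν * s) * r (γ s)) (-s) := by
      funext s; simp
    rw [hcongr] at i2 ⊢
    have i3 : IntegrableOn (fun s : ℝ => Complex.exp (Complex.I * ν * s) * r (γ s))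
        (Set.Iic 0) := by
      rw [integrableOn_Iic_iff_integrableOn_Iio]
      refine ((Measure.measurePreserving_neg (volume : Measure ℝ)).integrableOn_comp_preimage
        (Homeomorph.neg ℝ).measurableEmbedding).1 ?_
      rw [Set.neg_preimage, Set.neg_Iio, neg_zero]
      exact i2
    rw [integral_comp_neg_Ioi (0 : ℝ) (fun s : ℝ => Complex.exp (Complex.I * ν * s) * r (γ s)),
      neg_zero, add_comm, intervalIntegral.integral_Iic_add_Ioi i3 i1]
  obtain ⟨C₀, hC₀, h₀⟩ := h.half_line_estimate hs hf hO hp hγ hlim hγO hν hr0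
  obtain ⟨C₀', hC₀', h₀'⟩ := h.neg.half_line_estimate hs'.neg hf.neg hO hp' hγ' hl'
    (fun t => hγO (-t)) (neg_ne_zero.2 hν) hr0'
  refine ⟨max C₀ C₀', lt_max_of_lt_left hC₀, fun P δ hδ => ?_⟩
  filter_upwards [h₀ _ (le_max_left _ _) P (δ / 2) (by positivity),
    h₀' _ (le_max_right _ _) P (δ / 2) (by positivity)] with t ht ht' x₀ α hx₀
  have a1 := ht x₀ α hx₀
  have a2 := ht' x₀ (-α) (by simpa using hx₀)
  rw [hsplit]
  set I₁ := ∫ s in Set.Ioi (0 : ℝ), Complex.exp (Complex.I * ν * s) * r (γ s)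
  set I₂ := ∫ s in Set.Ioi (0 : ℝ), Complex.exp (Complex.I * (-ν : ℝ) * s) * r (γ (-s))
  rw [abs_neg, smul_neg, neg_smul, neg_neg] at a2
  have e : (β x₀ - Complex.I * ν * α) * (I₁ + I₂)
      = (Z x₀ - α * r x₀ + (β x₀ - Complex.I * ν * α) * I₁)
        + (-Z x₀ - ((-α : ℝ) : ℂ) * r x₀
          + (β x₀ - Complex.I * ((-ν : ℝ) : ℂ) * ((-α : ℝ) : ℂ)) * I₂) := by
    push_cast; ring
  rw [e]
  refine (norm_add_le _ _).trans ((add_le_add a1 a2).trans (le_of_eq ?_))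
  ring

/-- If the Fourier integral of `r` along the connecting orbit does not vanish, then `β` and the
tangential component of `X` vanish along any curve transversal to the orbit on which
the normal component of `X` is a primitive of a multiple of `β`. -/
theorem eventually_eq_zero_of_integral_ne_zero (h : TransportData f O ν Z r β X)
    (hs : SaddlePoint f p lam ξ η e₁ e₂) (hs' : SaddlePoint f p' lam' ξ' η' e₁' e₂')
    (hf : ContDiff ℝ 1 f) (hO : IsOpen O) (hp : p ∈ O) (hp' : p' ∈ O)
    (hγ : ∀ t, HasDerivAt γ (f (γ t)) t) (hlim : Tendsto γ atTop (𝓝 p))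
    (hlim' : Tendsto γ atBot (𝓝 p'))
    (hγO : ∀ t, γ t ∈ O) (hν : ν ≠ 0) (hr0 : r p = 0) (hr0' : r p' = 0)
    (hM : ∫ s : ℝ, Complex.exp (Complex.I * ν * s) * r (γ s) ≠ 0)
    {c : ℝ → E} (hc : AnalyticAt ℝ c 0) (hc0 : c 0 = γ 0) {α ψ : ℝ → ℝ}
    (hα : AnalyticAt ℝ α 0) {K : ℝ}
    (hV : ∀ᶠ s in 𝓝 0, ‖X (c s) - α s • f (c s)‖ ≤ K * |ψ s|) (hψ0 : ψ 0 = 0)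
    (hψ : ∀ᶠ s in 𝓝 0, DifferentiableAt ℝ ψ s)
    (hψ' : ∀ᶠ s in 𝓝 0, |deriv ψ s| ≤ K * |β (c s)|) :
    ∀ᶠ s in 𝓝 0, β (c s) = 0 ∧ α s = 0 := by
  set M := ∫ s : ℝ, Complex.exp (Complex.I * ν * s) * r (γ s)
  set κ : ℝ → ℂ := fun s => β (c s) - Complex.I * ν * α s
  have hκre : ∀ s, (κ s).re = β (c s) := fun s => by simp [κ]
  have hκim : ∀ s, (κ s).im = -(ν * α s) := fun s => by simp [κ]
  have hβκ : ∀ s, |β (c s)| ≤ ‖κ s‖ := fun s => by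
    rw [← hκre]; exact Complex.abs_re_le_norm _
  have hακ : ∀ s, |α s| ≤ |ν|⁻¹ * ‖κ s‖ := fun s => by
    rw [inv_mul_eq_div, le_div_iff₀ (abs_pos.2 hν), mul_comm, ← abs_mul, ← abs_neg, ← hκim]
    exact Complex.abs_im_le_norm _
  have hκa : AnalyticAt ℝ κ 0 := by
    have h1 : AnalyticAt ℝ (fun s => β (c s)) 0 :=
      (hc0 ▸ h.analytic_β _ (hγO 0) : AnalyticAt ℝ β (c 0)).comp hc
    exact (Complex.ofRealCLM.analyticAt _ |>.comp h1).fun_sub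
      (analyticAt_const.fun_mul (Complex.ofRealCLM.analyticAt _ |>.comp hα))
  by_cases hz : ∀ᶠ s in 𝓝 0, κ s = 0
  · filter_upwards [hz] with s hs0
    have h1 := hβκ s
    have h2 := hακ s
    rw [hs0, norm_zero] at h1 h2
    rw [mul_zero] at h2
    exact ⟨abs_nonpos_iff.1 h1, abs_nonpos_iff.1 h2⟩
  exfalso
  obtain ⟨n, k, hk, hk0, hkn⟩ := hκa.exists_eventuallyEq_pow_smul_nonzero_iff.2 hz
  simp only [sub_zero] at hkn
  have hkpos : 0 < ‖k 0‖ := norm_pos_iff.2 hk0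
  have hlow : ∀ᶠ s in 𝓝 0, ‖k 0‖ / 2 * |s| ^ n ≤ ‖κ s‖ := by
    filter_upwards [hkn, hk.continuousAt.norm.eventually_const_le (half_lt_self hkpos)] with s h1 h2
    rw [h1, norm_smul, norm_pow, Real.norm_eq_abs, mul_comm]
    gcongr
  have hup : ∀ᶠ s in 𝓝 0, ‖κ s‖ ≤ (2 * ‖k 0‖) * |s| ^ n := by
    filter_upwards [hkn, hk.continuousAt.norm.eventually_le_const
      (show ‖k 0‖ < 2 * ‖k 0‖ by linarith)] with s h1 h2
    rw [h1, norm_smul, norm_pow, Real.norm_eq_abs, mul_comm]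
    gcongr
  have hψb : ∀ᶠ s in 𝓝 0, |ψ s| ≤ |K| * (2 * ‖k 0‖) * |s| ^ (n + 1) := by
    obtain ⟨ρ, hρ, hb⟩ := Metric.eventually_nhds_iff.1 ((hup.and hψ).and hψ')
    refine Metric.eventually_nhds_iff.2 ⟨ρ, hρ, fun s hs => ?_⟩
    rw [dist_zero_right] at hs
    have hmem : ∀ y ∈ Metric.closedBall (0 : ℝ) |s|, dist y 0 < ρ := fun y hy =>
      lt_of_le_of_lt hy hs
    have := (convex_closedBall (0 : ℝ) |s|).norm_image_sub_le_of_norm_deriv_le (𝕜 := ℝ) (f := ψ)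
      (C := |K| * (2 * ‖k 0‖) * |s| ^ n) (x := 0) (y := s)
      (fun y hy => (hb (hmem y hy)).1.2) (fun y hy => ?_) (by simp) (by simp)
    · rw [hψ0, sub_zero, sub_zero, Real.norm_eq_abs, Real.norm_eq_abs] at this
      rw [pow_succ]; linarith
    · obtain ⟨⟨b1, -⟩, b3⟩ := hb (hmem y hy)
      rw [Real.norm_eq_abs]
      have hy' : |y| ≤ |s| := by simpa using hy
      calc _ ≤ K * |β (c y)| := b3
        _ ≤ |K| * ((2 * ‖k 0‖) * |s| ^ n) := by
          gcongr
          · exact le_abs_self _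
          · exact (hβκ y).trans (b1.trans (by gcongr))
        _ = _ := by ring
  obtain ⟨C, hC, hest⟩ := h.full_line_estimate hs hs' hf hO hp hp' hγ hlim hlim' hγO hν hr0 hr0'
  have hMpos : 0 < ‖M‖ := norm_pos_iff.2 hM
  set m : ℝ := 1 + |ν|⁻¹
  have hm : 0 < m := by positivity
  obtain ⟨K₁, hK₁, hcb⟩ : ∃ K₁ > 0, ∀ᶠ s in 𝓝 0, ‖c s - γ 0‖ ≤ K₁ * |s| := by
    obtain ⟨K₁, hK₁, hb⟩ := hc.differentiableAt.isBigO_sub.exists_pos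
    refine ⟨K₁, hK₁, hb.bound.mono fun s hs => ?_⟩
    simpa [hc0] using hs
  have htend : Tendsto (fun t : ℝ => K₁⁻¹ * Real.exp (-C * t)) atTop (𝓝 0) := by
    have := tendsto_affine_mul_exp_neg 0 K₁⁻¹ hC
    simpa using this
  set A₁ : ℝ := ‖M‖ / 2 * (‖k 0‖ / 2) * K₁⁻¹ ^ n
  set A₂ : ℝ := 2 * (|K| * (|K| * (2 * ‖k 0‖))) * K₁⁻¹ ^ (n + 1) + 2
  have hA₁ : 0 < A₁ := by positivity
  have hsmall : ∀ᶠ t : ℝ in atTop, A₂ * Real.exp (-(C / 2) * t) < A₁ := by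
    have := tendsto_affine_mul_exp_neg 0 A₂ (half_pos hC)
    simp only [zero_mul, zero_add] at this
    exact this.eventually_lt_const hA₁
  have hδ : 0 < ‖M‖ / (2 * m) := by positivity
  obtain ⟨t, t1, t2, t3, t4, t5, t6, t7⟩ := ((hest ((n + 1) * C) _ hδ).and
    ((htend.eventually hlow).and ((htend.eventually hψb).and ((htend.eventually hcb).and
    ((htend.eventually hV).and (hsmall.and (eventually_ge_atTop 0))))))).exists
  set s := K₁⁻¹ * Real.exp (-C * t)
  have hs0 : 0 < s := by positivity
  rw [abs_of_pos hs0] at t2 t3 t4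
  have hcs : ‖c s - γ 0‖ ≤ Real.exp (-C * t) := t4.trans (le_of_eq (by simp only [s]; field_simp))
  have main := t1 (c s) (α s) hcs
  rw [norm_mul] at main
  have hb1 : ‖M‖ / (2 * m) * (|β (c s)| + |α s|) ≤ ‖κ s‖ * ‖M‖ / 2 := by
    have h1 : |β (c s)| + |α s| ≤ m * ‖κ s‖ := by
      have := hβκ s; have := hακ s; simp only [m]; linarith
    calc _ ≤ ‖M‖ / (2 * m) * (m * ‖κ s‖) := by gcongr
      _ = _ := by field_simp
  set q := Real.exp (-C * t)
  have hq : 0 < q := by positivity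
  set w := Real.exp (-(C / 2) * t)
  have hw : 0 < w := by positivity
  have hwq : Real.exp (C / 2 * t) * q = w := by
    simp only [q, w]; rw [← Real.exp_add]; ring_nf
  have hq1 : q ≤ w := by
    simp only [q, w]; gcongr; nlinarith
  have hP : Real.exp (-((n + 1) * C) * t) = q ^ n * q := by
    simp only [q]; rw [← Real.exp_nat_mul, ← Real.exp_add]; ring_nf
  have hVs : ‖X (c s) - α s • f (c s)‖ ≤ |K| * (|K| * (2 * ‖k 0‖) * s ^ (n + 1)) := by
    refine t5.trans ?_
    gcongr
    exact le_abs_self _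
  have hκM : ‖κ s‖ * ‖M‖ / 2 ≥ A₁ * q ^ n := by
    have : ‖k 0‖ / 2 * s ^ n * ‖M‖ / 2 ≤ ‖κ s‖ * ‖M‖ / 2 := by gcongr
    refine le_trans (le_of_eq ?_) this
    simp only [A₁, s, mul_pow]; ring
  have hfin : A₁ * q ^ n ≤ A₂ * w * q ^ n := by
    rw [hP] at main
    have h1 : 2 * Real.exp (C / 2 * t) * ‖X (c s) - α s • f (c s)‖
        ≤ 2 * Real.exp (C / 2 * t) * (|K| * (|K| * (2 * ‖k 0‖) * s ^ (n + 1))) := by gcongr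
    have h2 : 2 * Real.exp (C / 2 * t) * (|K| * (|K| * (2 * ‖k 0‖) * s ^ (n + 1)))
        = 2 * (|K| * (|K| * (2 * ‖k 0‖))) * K₁⁻¹ ^ (n + 1) * w * q ^ n := by
      rw [← hwq]; simp only [s, mul_pow, pow_succ]; ring
    have h3 : 2 * (q ^ n * q) ≤ 2 * w * q ^ n := by
      have : q ^ n * q ≤ q ^ n * w := by gcongr
      linarith
    have h4 : ‖κ s‖ * ‖M‖ ≤ ‖κ s‖ * ‖M‖ / 2
        + 2 * (|K| * (|K| * (2 * ‖k 0‖))) * K₁⁻¹ ^ (n + 1) * w * q ^ n + 2 * w * q ^ n := by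
      linarith
    simp only [A₂]
    linarith
  have := le_of_mul_le_mul_right hfin (by positivity)
  linarith

end TransportData
end Matching

section Planar
variable {H : ℝ × ℝ → ℝ}

theorem fderiv_apply_eq_D1_D2 (H : ℝ × ℝ → ℝ) (x v : ℝ × ℝ) :
    fderiv ℝ H x v = D1 H x * v.1 + D2 H x * v.2 := by
  have : v = v.1 • ((1 : ℝ), (0 : ℝ)) + v.2 • ((0 : ℝ), (1 : ℝ)) := by ext <;> simp
  conv_lhs => rw [this]
  rw [map_add, map_smul, map_smul, D1, D2, smul_eq_mul, smul_eq_mul]; ring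

theorem fderiv_apply_JDH (H : ℝ × ℝ → ℝ) (x : ℝ × ℝ) : fderiv ℝ H x (JDH H x) = 0 := by
  rw [fderiv_apply_eq_D1_D2, JDH]; ring

theorem JDH_ne_zero_iff {x : ℝ × ℝ} : JDH H x ≠ 0 ↔ D1 H x ^ 2 + D2 H x ^ 2 ≠ 0 := by
  rw [not_iff_not]
  constructor
  · intro h
    have h1 := congrArg Prod.fst h
    have h2 := congrArg Prod.snd h
    simp only [JDH, Prod.fst_zero, Prod.snd_zero, neg_eq_zero] at h1 h2
    rw [h1, h2]; ring
  · intro h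
    have h1 : D1 H x = 0 := by nlinarith [sq_nonneg (D1 H x), sq_nonneg (D2 H x)]
    have h2 : D2 H x = 0 := by nlinarith [sq_nonneg (D1 H x), sq_nonneg (D2 H x)]
    simp [JDH, h1, h2]

/-- Decomposition of a planar vector along `JDH` and the gradient. -/
theorem eq_smul_JDH_add_smul {x : ℝ × ℝ} (hx : JDH H x ≠ 0) (v : ℝ × ℝ) :
    v = ((v.1 * D2 H x - v.2 * D1 H x) / (D1 H x ^ 2 + D2 H x ^ 2)) • JDH H x
      + (fderiv ℝ H x v / (D1 H x ^ 2 + D2 H x ^ 2)) • (D1 H x, D2 H x) := by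
  have := JDH_ne_zero_iff.1 hx
  rw [fderiv_apply_eq_D1_D2]
  ext <;> simp only [JDH, Prod.fst_add, Prod.snd_add, Prod.smul_fst, Prod.smul_snd, smul_eq_mul]
    <;> field_simp <;> ring

theorem analyticAt_D1 {x : ℝ × ℝ} (hH : AnalyticAt ℝ H x) : AnalyticAt ℝ (D1 H) x :=
  hH.fderiv.clm_apply_fun analyticAt_const

theorem analyticAt_D2 {x : ℝ × ℝ} (hH : AnalyticAt ℝ H x) : AnalyticAt ℝ (D2 H) x :=
  hH.fderiv.clm_apply_fun analyticAt_const

theorem analyticAt_JDH {x : ℝ × ℝ} (hH : AnalyticAt ℝ H x) : AnalyticAt ℝ (JDH H) x :=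
  (analyticAt_D2 hH).prod (analyticAt_D1 hH).fun_neg

/-- A first integral of a planar Hamiltonian field is locally a function of the Hamiltonian. -/
theorem exists_eventually_eq_comp {b : ℝ × ℝ → ℝ} {x₀ : ℝ × ℝ} (hH : AnalyticAt ℝ H x₀)
    (hb : AnalyticAt ℝ b x₀) (h0 : JDH H x₀ ≠ 0)
    (hbf : ∀ᶠ x in 𝓝 x₀, fderiv ℝ b x (JDH H x) = 0) :
    ∃ φ : ℝ → ℝ, AnalyticAt ℝ φ (H x₀) ∧ ∀ᶠ x in 𝓝 x₀, b x = φ (H x) := by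
  have hd := JDH_ne_zero_iff.1 h0
  set ℓ : ℝ × ℝ →L[ℝ] ℝ := D2 H x₀ • ContinuousLinearMap.fst ℝ ℝ ℝ
    - D1 H x₀ • ContinuousLinearMap.snd ℝ ℝ ℝ
  set Ψ : ℝ × ℝ → ℝ × ℝ := fun x => (H x, ℓ x)
  have hΨ : AnalyticAt ℝ Ψ x₀ := hH.prod (ℓ.analyticAt _)
  have hΨd : ∀ x, DifferentiableAt ℝ H x → HasFDerivAt Ψ ((fderiv ℝ H x).prod ℓ) x := fun x hx =>
    hx.hasFDerivAt.prodMk ℓ.hasFDerivAt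
  have hinj : Function.Injective ((fderiv ℝ H x₀).prod ℓ : ℝ × ℝ →ₗ[ℝ] ℝ × ℝ) := by
    rw [← LinearMap.ker_eq_bot, LinearMap.ker_eq_bot']
    intro v hv
    have h1 : fderiv ℝ H x₀ v = 0 := congrArg Prod.fst hv
    have h2 : ℓ v = 0 := congrArg Prod.snd hv
    have h3 : v.1 * D2 H x₀ - v.2 * D1 H x₀ = 0 := by
      rw [← h2]; simp [ℓ]; ring
    rw [eq_smul_JDH_add_smul h0 v, h1, h3]; simp
  set i : (ℝ × ℝ) ≃L[ℝ] ℝ × ℝ := (LinearEquiv.ofInjectiveEndo _ hinj).toContinuousLinearEquiv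
  have hi : (i : ℝ × ℝ →L[ℝ] ℝ × ℝ) = fderiv ℝ Ψ x₀ := by
    rw [(hΨd x₀ hH.differentiableAt).fderiv]; rfl
  have hstrict : HasStrictFDerivAt Ψ (i : ℝ × ℝ →L[ℝ] ℝ × ℝ) x₀ := by
    rw [hi]; exact hΨ.hasStrictFDerivAt
  set R := hstrict.toOpenPartialHomeomorph Ψ
  have hx₀R : x₀ ∈ R.source := hstrict.mem_toOpenPartialHomeomorph_source
  have hRΨ : ∀ x, R x = Ψ x := fun x => rfl
  have hΘa : AnalyticAt ℝ R.symm (Ψ x₀) := R.analyticAt_symm' hx₀R hΨ hi.symm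
  have hΘ0 : R.symm (Ψ x₀) = x₀ := R.left_inv hx₀R
  have hΘt : Tendsto R.symm (𝓝 (Ψ x₀)) (𝓝 x₀) := by
    have := hΘa.continuousAt.tendsto; rwa [hΘ0] at this
  have hev : ∀ᶠ y in 𝓝 (Ψ x₀), (∀ᶠ y' in 𝓝 y, Ψ (R.symm y') = y') ∧ AnalyticAt ℝ R.symm y ∧
      AnalyticAt ℝ b (R.symm y) ∧ AnalyticAt ℝ H (R.symm y) ∧
      fderiv ℝ b (R.symm y) (JDH H (R.symm y)) = 0 ∧ JDH H (R.symm y) ≠ 0 := by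
    filter_upwards [R.open_target.eventually_mem (R.map_source hx₀R), hΘa.eventually_analyticAt,
      hΘt.eventually hb.eventually_analyticAt, hΘt.eventually hH.eventually_analyticAt,
      hΘt.eventually hbf,
      hΘt.eventually ((analyticAt_JDH hH).continuousAt.eventually_ne h0)] with y h1 h2 h3 h4 h5 h6
    refine ⟨?_, h2, h3, h4, h5, h6⟩
    filter_upwards [R.open_target.eventually_mem h1] with y' hy'
    exact R.right_inv hy'
  obtain ⟨ρ, hρ, hball⟩ := Metric.eventually_nhds_iff.1 hev
  refine ⟨fun c => b (R.symm (c, ℓ x₀)), ?_, ?_⟩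
  · have h1 : AnalyticAt ℝ (fun c : ℝ => (c, ℓ x₀)) (H x₀) := analyticAt_id.prod analyticAt_const
    have h2 : AnalyticAt ℝ (fun c : ℝ => R.symm (c, ℓ x₀)) (H x₀) :=
      AnalyticAt.comp (g := R.symm) hΘa h1
    refine AnalyticAt.comp (g := b) ?_ h2
    have : R.symm (H x₀, ℓ x₀) = x₀ := hΘ0
    rwa [this]
  · have hlt : ∀ᶠ x in 𝓝 x₀, dist (Ψ x) (Ψ x₀) < ρ :=
      hΨ.continuousAt.eventually (Metric.ball_mem_nhds _ hρ)
    filter_upwards [hlt, R.open_source.eventually_mem hx₀R] with x hx hxR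
    have hx1 : dist (H x) (H x₀) < ρ := (le_max_left _ _).trans_lt hx
    have hx2 : dist (ℓ x) (ℓ x₀) < ρ := (le_max_right _ _).trans_lt hx
    have hder : ∀ m ∈ Metric.ball (ℓ x₀) ρ, HasDerivAt (fun m => b (R.symm (H x, m))) 0 m := by
      intro m hm
      obtain ⟨g1, g2, g3, g4, g5, g6⟩ := hball (y := (H x, m)) (max_lt hx1 hm)
      set w := fderiv ℝ R.symm (H x, m) (0, 1)
      have hline : HasDerivAt (fun m : ℝ => (H x, m)) ((0 : ℝ), (1 : ℝ)) m :=
        (hasDerivAt_const m (H x)).prodMk (hasDerivAt_id m)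
      have h1 : HasDerivAt (fun m => R.symm (H x, m)) w m :=
        g2.differentiableAt.hasFDerivAt.comp_hasDerivAt m hline
      have h2 := g3.differentiableAt.hasFDerivAt.comp_hasDerivAt m h1
      have h3 : HasDerivAt (fun m => H (R.symm (H x, m))) (fderiv ℝ H (R.symm (H x, m)) w) m :=
        g4.differentiableAt.hasFDerivAt.comp_hasDerivAt m h1
      have h4 : HasDerivAt (fun m => H (R.symm (H x, m))) 0 m := by
        refine (hasDerivAt_const m (H x)).congr_of_eventuallyEq ?_
        filter_upwards [hline.continuousAt.eventually g1] with m' hm'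
        exact congrArg Prod.fst hm'
      have h5 : fderiv ℝ H (R.symm (H x, m)) w = 0 := h3.unique h4
      rw [eq_smul_JDH_add_smul g6 w, h5, zero_div, zero_smul, add_zero, map_smul, g5,
        smul_zero] at h2
      exact h2
    have := (convex_ball (ℓ x₀) ρ).norm_image_sub_le_of_norm_hasDerivWithin_le (𝕜 := ℝ)
      (f := fun m => b (R.symm (H x, m))) (C := 0) (f' := fun _ => 0)
      (fun m hm => (hder m hm).hasDerivWithinAt) (fun _ _ => by simp)
      (Metric.mem_ball_self hρ) (Metric.mem_ball.2 hx2)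
    rw [zero_mul] at this
    have h6 := sub_eq_zero.1 (norm_le_zero_iff.1 this)
    rw [← h6]
    exact (congrArg b (R.left_inv hxR)).symm

end Planar

/-- An orbit `γ` of the planar Hamiltonian field `JDH H` connecting the saddle `p'` to the
saddle `p`. -/
structure SaddleConnection (H : ℝ × ℝ → ℝ) (γ : ℝ → ℝ × ℝ) (p p' : ℝ × ℝ) : Prop where
  analytic : AnalyticOnNhd ℝ H Set.univ
  saddle : ∃ lam ξ η e₁ e₂, SaddlePoint (JDH H) p lam ξ η e₁ e₂
  saddle' : ∃ lam ξ η e₁ e₂, SaddlePoint (JDH H) p' lam ξ η e₁ e₂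
  orbit : ∀ t, HasDerivAt γ (JDH H (γ t)) t
  lim : Tendsto γ atTop (𝓝 p)
  lim' : Tendsto γ atBot (𝓝 p')
  ne : JDH H (γ 0) ≠ 0

/-- An open preconnected neighbourhood of the closure of a connecting orbit. -/
structure ConnectionNhd (γ : ℝ → ℝ × ℝ) (p p' : ℝ × ℝ) (O : Set (ℝ × ℝ)) : Prop where
  isOpen : IsOpen O
  preconnected : IsPreconnected O
  mem : p ∈ O
  mem' : p' ∈ O
  orbit_mem : ∀ t, γ t ∈ O

namespace SaddleConnection
variable {H : ℝ × ℝ → ℝ} {γ : ℝ → ℝ × ℝ} {p p' : ℝ × ℝ} {O : Set (ℝ × ℝ)}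

theorem exists_connectionNhd (hc : SaddleConnection H γ p p') (hO : IsOpen O) (hp : p ∈ O)
    (hp' : p' ∈ O) (hγO : ∀ t, γ t ∈ O) : ∃ O' ⊆ O, ConnectionNhd γ p p' O' := by
  have hγc : Continuous γ := continuous_iff_continuousAt.2 fun t => (hc.orbit t).continuousAt
  have hpre : IsPreconnected (Set.range γ ∪ {p, p'}) := by
    refine (isPreconnected_range hγc).subset_closure Set.subset_union_left ?_
    refine Set.union_subset subset_closure ?_
    rintro x (rfl | rfl)
    · exact mem_closure_of_tendsto hc.lim (Eventually.of_forall fun t => ⟨t, rfl⟩)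
    · exact mem_closure_of_tendsto hc.lim' (Eventually.of_forall fun t => ⟨t, rfl⟩)
  have hsub : Set.range γ ∪ {p, p'} ⊆ O := by
    rintro x (⟨t, rfl⟩ | rfl | rfl)
    exacts [hγO t, hp, hp']
  have h0 : γ 0 ∈ Set.range γ ∪ {p, p'} := Or.inl ⟨0, rfl⟩
  have hcc := hpre.subset_connectedComponentIn h0 hsub
  exact ⟨connectedComponentIn O (γ 0), connectedComponentIn_subset _ _,
    hO.connectedComponentIn, isPreconnected_connectedComponentIn, hcc (Or.inr (Or.inl rfl)),
    hcc (Or.inr (Or.inr rfl)), fun t => hcc (Or.inl ⟨t, rfl⟩)⟩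

theorem energy_orbit (hc : SaddleConnection H γ p p') (t : ℝ) : H (γ t) = H (γ 0) := by
  refine is_const_of_deriv_eq_zero (f := fun t => H (γ t)) (fun t => ?_) (fun t => ?_) t 0 <;>
  have := (hc.analytic (γ t) trivial).differentiableAt.hasFDerivAt.comp_hasDerivAt t (hc.orbit t)
  · exact this.differentiableAt
  · have h2 := this.deriv
    rw [fderiv_apply_JDH] at h2
    exact h2

theorem energy_limit (hc : SaddleConnection H γ p p') : H p = H (γ 0) := by
  have := (hc.analytic p trivial).continuousAt.tendsto.comp hc.lim
  exact tendsto_nhds_unique this (tendsto_const_nhds.congr fun t => (hc.energy_orbit t).symm)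

theorem energy_limit' (hc : SaddleConnection H γ p p') : H p' = H (γ 0) := by
  have := (hc.analytic p' trivial).continuousAt.tendsto.comp hc.lim'
  exact tendsto_nhds_unique this (tendsto_const_nhds.congr fun t => (hc.energy_orbit t).symm)

theorem apply_eq_zero (hc : SaddleConnection H γ p p') : JDH H p = 0 := by
  obtain ⟨_, _, _, _, _, h⟩ := hc.saddle
  exact h.apply_eq_zero

theorem apply_eq_zero' (hc : SaddleConnection H γ p p') : JDH H p' = 0 := by
  obtain ⟨_, _, _, _, _, h⟩ := hc.saddle'
  exact h.apply_eq_zero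

theorem fderiv_eq_zero_of_JDH {x : ℝ × ℝ} (h : JDH H x = 0) (v : ℝ × ℝ) :
    fderiv ℝ H x v = 0 := by
  have h1 := congrArg Prod.fst h
  have h2 := congrArg Prod.snd h
  simp only [JDH, Prod.fst_zero, Prod.snd_zero, neg_eq_zero] at h1 h2
  rw [fderiv_apply_eq_D1_D2, h1, h2]; ring

/-- A first integral near the connection is a function of the Hamiltonian. -/
theorem exists_eq_comp (hc : SaddleConnection H γ p p') (hO : ConnectionNhd γ p p' O)
    {b : ℝ × ℝ → ℝ} (hb : AnalyticOnNhd ℝ b O)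
    (hbf : ∀ x ∈ O, fderiv ℝ b x (JDH H x) = 0) :
    ∃ φ : ℝ → ℝ, ∃ O' ⊆ O, ConnectionNhd γ p p' O' ∧
      (∀ x ∈ O', AnalyticAt ℝ φ (H x)) ∧ ∀ x ∈ O', b x = φ (H x) := by
  have h0 := hO.orbit_mem 0
  obtain ⟨φ, hφ, hbφ⟩ := exists_eventually_eq_comp (hc.analytic _ trivial) (hb _ h0) hc.ne
    (Filter.mem_of_superset (hO.isOpen.mem_nhds h0) hbf)
  set S : Set ℝ := {c | AnalyticAt ℝ φ c}
  have hS : IsOpen S := isOpen_analyticAt ℝ φ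
  have hHc : Continuous H := continuous_iff_continuousAt.2 fun x =>
    (hc.analytic x trivial).continuousAt
  have hmem : ∀ x, H x = H (γ 0) → x ∈ H ⁻¹' S := fun x hx => by
    rw [Set.mem_preimage, hx]; exact hφ
  obtain ⟨O', hO'sub, hO'⟩ := hc.exists_connectionNhd (hO.isOpen.inter (hS.preimage hHc))
    ⟨hO.mem, hmem _ hc.energy_limit⟩ ⟨hO.mem', hmem _ hc.energy_limit'⟩
    (fun t => ⟨hO.orbit_mem t, hmem _ (hc.energy_orbit t)⟩)
  refine ⟨φ, O', fun x hx => (hO'sub hx).1, hO', fun x hx => (hO'sub hx).2, ?_⟩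
  refine AnalyticOnNhd.eqOn_of_preconnected_of_eventuallyEq
    (fun x hx => hb x (hO'sub hx).1) (fun x hx => ?_) hO'.preconnected (hO'.orbit_mem 0) hbφ
  exact AnalyticAt.comp (g := φ) (hO'sub hx).2 (hc.analytic x trivial)

/-- The obstruction to solving the transport equation near a connection whose Fourier integral
does not vanish. -/
theorem eventually_eq_zero (hc : SaddleConnection H γ p p') (hO : ConnectionNhd γ p p' O)
    {ν : ℝ} {Z r : ℝ × ℝ → ℂ} {β : ℝ × ℝ → ℝ} {X : ℝ × ℝ → ℝ × ℝ}
    (h : TransportData (JDH H) O ν Z r β X) (hν : ν ≠ 0) (hr0 : r p = 0) (hr0' : r p' = 0)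
    (hM : ∫ s : ℝ, Complex.exp (Complex.I * ν * s) * r (γ s) ≠ 0)
    {β₀ χ : ℝ → ℝ} (hχ : AnalyticAt ℝ χ (H (γ 0)))
    (hχ0 : χ (H (γ 0)) = 0) (hβ : ∀ᶠ x in 𝓝 (γ 0), β x = β₀ (H x))
    (hX : ∀ᶠ x in 𝓝 (γ 0), fderiv ℝ H x (X x) = χ (H x))
    (hχβ : ∀ᶠ e in 𝓝 (H (γ 0)), |deriv χ e| ≤ |β₀ e|) :
    (∀ᶠ e in 𝓝 (H (γ 0)), β₀ e = 0) ∧ ∀ᶠ x in 𝓝 (γ 0), X x = 0 := by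
  obtain ⟨lam, ξ, η, e₁, e₂, hs⟩ := hc.saddle
  obtain ⟨lam', ξ', η', e₁', e₂', hs'⟩ := hc.saddle'
  have hHa : AnalyticAt ℝ H (γ 0) := hc.analytic _ trivial
  have hfa : ∀ x, AnalyticAt ℝ (JDH H) x := fun x => analyticAt_JDH (hc.analytic x trivial)
  have hf : ContDiff ℝ 1 (JDH H) := contDiff_iff_contDiffAt.2 fun x => (hfa x).contDiffAt
  set n : ℝ × ℝ := (D1 H (γ 0), D2 H (γ 0))
  set c : ℝ → ℝ × ℝ := fun s => γ 0 + s • n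
  have hc0 : c 0 = γ 0 := by simp [c]
  have hca : AnalyticAt ℝ c 0 :=
    analyticAt_const.fun_add ((analyticAt_id (𝕜 := ℝ) (E := ℝ)).fun_smul analyticAt_const)
  have hct : Tendsto c (𝓝 0) (𝓝 (γ 0)) := hc0 ▸ hca.continuousAt.tendsto
  have hcd : HasDerivAt c n 0 := by
    have := ((hasDerivAt_id (0 : ℝ)).smul_const n).const_add (γ 0)
    simpa [c] using this
  have hDn : fderiv ℝ H (γ 0) n ≠ 0 := by
    rw [fderiv_apply_eq_D1_D2]
    have := JDH_ne_zero_iff.1 hc.ne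
    simpa [n, sq] using this
  have hha : AnalyticAt ℝ (fun s => H (c s)) 0 :=
    AnalyticAt.comp (g := H) (hc0.symm ▸ hHa) hca
  have hhd : deriv (fun s => H (c s)) 0 ≠ 0 := by
    have h1 : HasFDerivAt H (fderiv ℝ H (γ 0)) (c 0) := hc0.symm ▸ hHa.differentiableAt.hasFDerivAt
    have := h1.comp_hasDerivAt 0 hcd
    exact this.deriv ▸ hDn
  have hmap : map (fun s => H (c s)) (𝓝 0) = 𝓝 (H (γ 0)) := by
    have := hha.hasStrictDerivAt.map_nhds_eq hhd
    rwa [hc0] at this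
  have htrans : ∀ {P : ℝ → Prop}, (∀ᶠ s in 𝓝 0, P (H (c s))) → ∀ᶠ e in 𝓝 (H (γ 0)), P e := by
    intro P hP
    rw [← hmap]; exact hP
  have htrans' : ∀ {P : ℝ → Prop}, (∀ᶠ e in 𝓝 (H (γ 0)), P e) → ∀ᶠ s in 𝓝 0, P (H (c s)) := by
    intro P hP
    rw [← hmap] at hP; exact hP
  set α : ℝ × ℝ → ℝ := fun x =>
    ((X x).1 * D2 H x - (X x).2 * D1 H x) / (D1 H x ^ 2 + D2 H x ^ 2)
  have hXa : AnalyticAt ℝ X (γ 0) := h.analytic_X _ (hO.orbit_mem 0)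
  have hα : AnalyticAt ℝ α (γ 0) := by
    have d1 := analyticAt_D1 hHa
    have d2 := analyticAt_D2 hHa
    have x1 : AnalyticAt ℝ (fun x => (X x).1) (γ 0) := analyticAt_fst.comp hXa
    have x2 : AnalyticAt ℝ (fun x => (X x).2) (γ 0) := analyticAt_snd.comp hXa
    exact ((x1.fun_mul d2).fun_sub (x2.fun_mul d1)).fun_div ((d1.fun_pow 2).fun_add (d2.fun_pow 2))
      (JDH_ne_zero_iff.1 hc.ne)
  have hne : ∀ᶠ x in 𝓝 (γ 0), JDH H x ≠ 0 := (hfa _).continuousAt.eventually_ne hc.ne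
  have hdec : ∀ᶠ x in 𝓝 (γ 0), X x - α x • JDH H x
      = (χ (H x) / (D1 H x ^ 2 + D2 H x ^ 2)) • (D1 H x, D2 H x) := by
    filter_upwards [hX, hne] with x h1 h2
    rw [← h1, sub_eq_iff_eq_add']
    exact eq_smul_JDH_add_smul h2 (X x)
  set q : ℝ × ℝ → ℝ := fun x => ‖(D1 H x ^ 2 + D2 H x ^ 2)⁻¹ • (D1 H x, D2 H x)‖
  have hq : ∀ᶠ x in 𝓝 (γ 0), q x ≤ q (γ 0) + 1 := by
    have d1 := (analyticAt_D1 hHa).continuousAt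
    have d2 := (analyticAt_D2 hHa).continuousAt
    have : ContinuousAt q (γ 0) := ContinuousAt.norm
      ((((d1.pow 2).add (d2.pow 2)).inv₀ (JDH_ne_zero_iff.1 hc.ne)).smul (d1.prodMk d2))
    exact this.eventually_le_const (by linarith)
  have hdh : ∀ᶠ s in 𝓝 0, |deriv (fun s => H (c s)) s| ≤ |deriv (fun s => H (c s)) 0| + 1 :=
    hha.deriv.continuousAt.abs.eventually_le_const (by linarith)
  set K : ℝ := max (q (γ 0) + 1) (|deriv (fun s => H (c s)) 0| + 1)
  set ψ : ℝ → ℝ := fun s => χ (H (c s))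
  have hψa : AnalyticAt ℝ ψ 0 := AnalyticAt.comp (g := χ) (by simpa [hc0] using hχ) hha
  have key := h.eventually_eq_zero_of_integral_ne_zero (ψ := ψ) (α := fun s => α (c s)) (K := K)
    hs hs' hf hO.isOpen hO.mem hO.mem' hc.orbit hc.lim hc.lim' hO.orbit_mem hν hr0 hr0' hM hca hc0
    (AnalyticAt.comp (g := α) (hc0.symm ▸ hα) hca) ?_ (by simpa [ψ, hc0] using hχ0)
    (hψa.eventually_analyticAt.mono fun s hs => hs.differentiableAt) ?_
  rotate_left
  · filter_upwards [hct.eventually hdec, hct.eventually hq] with s h1 h2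
    rw [h1, div_eq_mul_inv, mul_smul, norm_smul, Real.norm_eq_abs, mul_comm]
    gcongr
    exact h2.trans (le_max_left _ _)
  · filter_upwards [hha.eventually_analyticAt, htrans' hχ.eventually_analyticAt, htrans' hχβ, hdh,
      hct.eventually hβ] with s h1 h2 h3 h4 h5
    have := h2.differentiableAt.hasDerivAt.comp s h1.differentiableAt.hasDerivAt
    have h6 : deriv ψ s = deriv χ (H (c s)) * deriv (fun s => H (c s)) s := this.deriv
    rw [h6, abs_mul, mul_comm, h5]
    gcongr
    exact h4.trans (le_max_right _ _)
  have hβ₀ : ∀ᶠ e in 𝓝 (H (γ 0)), β₀ e = 0 := by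
    refine htrans ?_
    filter_upwards [key, hct.eventually hβ] with s h1 h2
    rw [← h2]; exact h1.1
  refine ⟨hβ₀, ?_⟩
  have hχz : ∀ᶠ e in 𝓝 (H (γ 0)), χ e = 0 := by
    obtain ⟨ρ, hρ, hb⟩ := Metric.eventually_nhds_iff.1
      ((hβ₀.and hχβ).and hχ.eventually_analyticAt)
    refine Metric.eventually_nhds_iff.2 ⟨ρ, hρ, fun e he => ?_⟩
    have := (convex_ball (H (γ 0)) ρ).norm_image_sub_le_of_norm_deriv_le (𝕜 := ℝ) (f := χ)
      (C := 0) (fun y hy => (hb hy).2.differentiableAt)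
      (fun y hy => by
        have h1 := (hb hy).1.2
        rw [(hb hy).1.1, abs_zero] at h1
        exact h1) (Metric.mem_ball_self hρ) (Metric.mem_ball.2 he)
    rw [zero_mul, hχ0, sub_zero] at this
    exact norm_le_zero_iff.1 this
  have hXα : ∀ᶠ x in 𝓝 (γ 0), X x = α x • JDH H x := by
    filter_upwards [hdec, hHa.continuousAt.eventually hχz] with x h1 h2
    rw [h2, zero_div, zero_smul] at h1
    exact sub_eq_zero.1 h1
  have hαf : ∀ᶠ x in 𝓝 (γ 0), fderiv ℝ α x (JDH H x) = 0 := by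
    filter_upwards [hXα.eventually_nhds, hα.eventually_analyticAt, hne,
      hO.isOpen.mem_nhds (hO.orbit_mem 0)] with x h1 h2 h3 h4
    have h5 := h.eq_X x h4
    have h6 : X =ᶠ[𝓝 x] fun x => α x • JDH H x := h1
    rw [h6.self_of_nhds, h6.fderiv_eq,
      (h2.differentiableAt.hasFDerivAt.fun_smul (hfa x).differentiableAt.hasFDerivAt).fderiv] at h5
    simp only [add_apply, smul_apply, ContinuousLinearMap.smulRight_apply, map_smul,
      add_eq_left] at h5
    exact (smul_eq_zero.1 h5).resolve_right h3
  obtain ⟨φ, -, hφ⟩ := exists_eventually_eq_comp hHa hα hc.ne hαf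
  have hφz : ∀ᶠ e in 𝓝 (H (γ 0)), φ e = 0 := by
    refine htrans ?_
    filter_upwards [key, hct.eventually hφ] with s h1 h2
    rw [← h2]; exact h1.2
  filter_upwards [hXα, hφ, hHa.continuousAt.eventually hφz] with x h1 h2 h3
  rw [h1, h2, h3, zero_smul]

end SaddleConnection

section DirectionalDerivative

variable {E : Type*} [NormedAddCommGroup E] [NormedSpace ℝ E]
  {V : Type*} [NormedAddCommGroup V] [NormedSpace ℝ V] [CompleteSpace V]

/-- The derivative of a function in a fixed direction. -/
noncomputable def dirDeriv (v : E) (Z : E → V) : E → V := fun x => fderiv ℝ Z x v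

theorem dirDeriv_congr {v : E} {Z W : E → V} {x : E} (h : Z =ᶠ[𝓝 x] W) :
    dirDeriv v Z =ᶠ[𝓝 x] dirDeriv v W := by
  filter_upwards [h.fderiv (𝕜 := ℝ)] with y hy
  simp [dirDeriv, hy]

theorem dirDeriv_iterate_congr {v : E} {Z W : E → V} {x : E} (h : Z =ᶠ[𝓝 x] W) (m : ℕ) :
    (dirDeriv v)^[m] Z =ᶠ[𝓝 x] (dirDeriv v)^[m] W := by
  induction m generalizing Z W with
  | zero => exact h
  | succ m ih => exact ih (dirDeriv_congr h)

theorem AnalyticAt.dirDeriv {Z : E → V} {x : E} (h : AnalyticAt ℝ Z x) (v : E) :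
    AnalyticAt ℝ (dirDeriv v Z) x :=
  h.fderiv.clm_apply_fun analyticAt_const

theorem AnalyticAt.dirDeriv_iterate {Z : E → V} {x : E} (h : AnalyticAt ℝ Z x) (v : E) (m : ℕ) :
    AnalyticAt ℝ ((_root_.dirDeriv v)^[m] Z) x := by
  induction m generalizing Z with
  | zero => exact h
  | succ m ih => exact ih (h.dirDeriv v)

theorem dirDeriv_add {v : E} {Z W : E → V} {x : E} (hZ : AnalyticAt ℝ Z x)
    (hW : AnalyticAt ℝ W x) :
    dirDeriv v (fun y => Z y + W y) x = dirDeriv v Z x + dirDeriv v W x := by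
  simp [dirDeriv, fderiv_fun_add hZ.differentiableAt hW.differentiableAt]

theorem dirDeriv_comm {Z : E → V} {x : E} (h : AnalyticAt ℝ Z x) (v w : E) :
    dirDeriv v (dirDeriv w Z) x = dirDeriv w (dirDeriv v Z) x := by
  have key : ∀ v w : E, dirDeriv v (dirDeriv w Z) x = fderiv ℝ (fderiv ℝ Z) x v w := fun v w => by
    change fderiv ℝ (fun y => fderiv ℝ Z y w) x v = _
    rw [fderiv_clm_apply h.fderiv.differentiableAt (differentiableAt_const w)]
    simp
  rw [key, key, fderiv_fderiv_symm h]

theorem iteratedDeriv_line {Z : E → V} {x : E} {v : E} {s : ℝ} (h : AnalyticAt ℝ Z (x + s • v))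
    (m : ℕ) : iteratedDeriv m (fun s : ℝ => Z (x + s • v)) s = (dirDeriv v)^[m] Z (x + s • v) := by
  have hd : ∀ s : ℝ, HasDerivAt (fun s : ℝ => x + s • v) v s := fun s => by
    simpa using ((hasDerivAt_id s).smul_const v).const_add x
  induction m generalizing Z with
  | zero => simp
  | succ m ih =>
    rw [iteratedDeriv_succ', Function.iterate_succ_apply, ← ih (h.dirDeriv v)]
    refine Filter.EventuallyEq.iteratedDeriv_eq m ?_
    have := (hd s).continuousAt.eventually h.eventually_analyticAt
    filter_upwards [this] with r hr
    exact (hr.differentiableAt.hasFDerivAt.comp_hasDerivAt r (hd r)).deriv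

/-- An analytic function all of whose iterated directional derivatives vanish at a point
vanishes near that point. -/
theorem eventually_eq_zero_of_dirDeriv_iterate {Z : E → V} {x : E} (h : AnalyticAt ℝ Z x)
    (h0 : ∀ v m, (dirDeriv v)^[m] Z x = 0) : ∀ᶠ y in 𝓝 x, Z y = 0 := by
  obtain ⟨r, hr, hball⟩ := Metric.eventually_nhds_iff_ball.1 h.eventually_analyticAt
  refine Metric.eventually_nhds_iff_ball.2 ⟨r, hr, fun y hy => ?_⟩
  set v := y - x with hv
  have hvr : ‖v‖ < r := by simpa [hv, dist_eq_norm] using hy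
  let S : Set ℝ := (fun s : ℝ => x + s • v) ⁻¹' Metric.ball x r
  have hS : Convex ℝ S := by
    have : S = (AffineMap.lineMap x y : ℝ →ᵃ[ℝ] E) ⁻¹' Metric.ball x r := by
      ext s; simp [S, AffineMap.lineMap_apply, hv, add_comm]
    rw [this]
    exact (convex_ball x r).affine_preimage _
  have hlin : ∀ s : ℝ, AnalyticAt ℝ (fun s : ℝ => x + s • v) s := fun s => by fun_prop
  have han : AnalyticOnNhd ℝ (fun s : ℝ => Z (x + s • v)) S := fun s hs =>
    AnalyticAt.comp (g := Z) (hball _ hs) (hlin s)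
  have h0S : (0 : ℝ) ∈ S := by simp [S, hr]
  have h1S : (1 : ℝ) ∈ S := by simpa [S, hv] using hy
  have hev : (fun s : ℝ => Z (x + s • v)) =ᶠ[𝓝 0] 0 := by
    have hm : ∀ m, iteratedDeriv m (fun s : ℝ => Z (x + s • v)) 0 = 0 := fun m => by
      rw [iteratedDeriv_line (by simpa using h)]
      simpa using h0 v m
    have : analyticOrderAt (fun s : ℝ => Z (x + s • v)) 0 = ⊤ := by
      refine ENat.eq_top_iff_forall_ge.2 fun n => ?_
      exact (natCast_le_analyticOrderAt_iff_iteratedDeriv_eq_zero (han 0 h0S)).2 fun i _ => hm i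
    exact analyticOrderAt_eq_top.1 this
  have := han.eqOn_zero_of_preconnected_of_eventuallyEq_zero hS.isPreconnected h0S hev h1S
  simpa [hv] using this

theorem VanishesToOrder.dirDeriv {ξ η : E →L[ℝ] ℝ} {p : E} {k : ℕ} {Z : E → V}
    (h : VanishesToOrder ξ η p (k + 1) Z) (v : E) :
    VanishesToOrder ξ η p k (dirDeriv v Z) := by
  induction k generalizing Z with
  | zero => exact h.analyticAt.dirDeriv v
  | succ k ih =>
    obtain ⟨Z₁, Z₂, h₁, h₂, h⟩ := h
    have hc : ∀ (c : ℝ) {W : E → V}, VanishesToOrder ξ η p (k + 1) W →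
        VanishesToOrder ξ η p (k + 1) (fun x => c • W x) := fun c W hW =>
      smul (φ := fun _ => c) (j := 0) analyticAt_const hW
    refine ((((hc (ξ v) h₁).add (ih h₁).coord_left).add (hc (η v) h₂)).add
      (ih h₂).coord_right).congr ?_
    filter_upwards [dirDeriv_congr (v := v) h, h₁.analyticAt.eventually_analyticAt,
      h₂.analyticAt.eventually_analyticAt] with x hx hx₁ hx₂
    have d := (((hasFDerivAt_coord ξ p x).fun_smul hx₁.differentiableAt.hasFDerivAt).fun_add
      ((hasFDerivAt_coord η p x).fun_smul hx₂.differentiableAt.hasFDerivAt)).fderiv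
    rw [hx]
    simp only [_root_.dirDeriv, d]
    simp
    module

theorem VanishesToOrder.dirDeriv_iterate_eq_zero {ξ η : E →L[ℝ] ℝ} {p : E} {m : ℕ} {Z : E → V}
    (h : VanishesToOrder ξ η p (m + 1) Z) (v : E) : (_root_.dirDeriv v)^[m] Z p = 0 := by
  induction m generalizing Z with
  | zero =>
    obtain ⟨Z₁, Z₂, -, -, h⟩ := h
    simpa using h.eq_of_nhds
  | succ m ih => exact ih (h.dirDeriv v)

end DirectionalDerivative

section TimeOperators

variable {E : Type*} [NormedAddCommGroup E] [NormedSpace ℝ E]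
  {V : Type*} [NormedAddCommGroup V] [NormedSpace ℝ V] [CompleteSpace V]

/-- The operator `-∂_τ - c` on functions of `(x, τ)`. -/
noncomputable def timeOp (c : ℝ) (Y : E × ℝ → V) : E × ℝ → V :=
  fun z => -dirDeriv (0, 1) Y z - c • Y z

/-- Composition of the operators `-∂_τ - c` over a list. -/
noncomputable def timeOps : List ℝ → (E × ℝ → V) → (E × ℝ → V)
  | [], Y => Y
  | c :: l, Y => timeOps l (timeOp c Y)

theorem AnalyticAt.timeOp {Y : E × ℝ → V} {z : E × ℝ} (h : AnalyticAt ℝ Y z) (c : ℝ) :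
    AnalyticAt ℝ (timeOp c Y) z :=
  (h.dirDeriv _).neg.sub (h.const_smul)

theorem dirDeriv_timeOp {Y : E × ℝ → V} {z : E × ℝ} (h : AnalyticAt ℝ Y z) (v : E × ℝ) (c : ℝ) :
    dirDeriv v (timeOp c Y) z = timeOp c (dirDeriv v Y) z := by
  have h1 := (h.dirDeriv (0, 1)).differentiableAt.hasFDerivAt
  have := (h1.fun_neg.fun_sub (h.differentiableAt.hasFDerivAt.fun_const_smul c)).fderiv
  have h2 : dirDeriv v (timeOp c Y) z = -dirDeriv v (dirDeriv (0, 1) Y) z - c • dirDeriv v Y z := by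
    change fderiv ℝ (fun z => -dirDeriv (0, 1) Y z - c • Y z) z v = _
    rw [this]
    simp [dirDeriv]
  rw [h2, dirDeriv_comm h]
  rfl

theorem timeOps_congr {l : List ℝ} {Y W : E × ℝ → V} {z : E × ℝ} (h : Y =ᶠ[𝓝 z] W) :
    timeOps l Y z = timeOps l W z := by
  induction l generalizing Y W with
  | nil => exact h.eq_of_nhds
  | cons c l ih =>
    refine ih ?_
    filter_upwards [h, dirDeriv_congr (v := ((0, 1) : E × ℝ)) h] with y h1 h2
    simp [timeOp, h1, h2]

theorem dirDeriv_timeOps {l : List ℝ} {Y : E × ℝ → V} {z : E × ℝ} (h : AnalyticAt ℝ Y z)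
    (v : E × ℝ) : dirDeriv v (timeOps l Y) z = timeOps l (dirDeriv v Y) z := by
  induction l generalizing Y with
  | nil => rfl
  | cons c l ih =>
    refine (ih (h.timeOp c)).trans (timeOps_congr ?_)
    filter_upwards [h.eventually_analyticAt] with y hy using dirDeriv_timeOp hy v c

theorem dirDeriv_iterate_timeOps {l : List ℝ} {Y : E × ℝ → V} {z : E × ℝ} (h : AnalyticAt ℝ Y z)
    (v : E × ℝ) (m : ℕ) :
    (dirDeriv v)^[m] (timeOps l Y) z = timeOps l ((dirDeriv v)^[m] Y) z := by
  induction m generalizing Y with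
  | zero => rfl
  | succ m ih =>
    have : dirDeriv v (timeOps l Y) =ᶠ[𝓝 z] timeOps l (dirDeriv v Y) := by
      filter_upwards [h.eventually_analyticAt] with y hy using dirDeriv_timeOps hy v
    exact ((dirDeriv_iterate_congr this m).eq_of_nhds).trans (ih (h.dirDeriv v))

theorem hasDerivAt_time {Y : E × ℝ → V} {x : E} {τ : ℝ} (h : AnalyticAt ℝ Y (x, τ)) :
    HasDerivAt (fun τ => Y (x, τ)) (dirDeriv (0, 1) Y (x, τ)) τ :=
  h.differentiableAt.hasFDerivAt.comp_hasDerivAt τ ((hasDerivAt_const τ x).prodMk (hasDerivAt_id τ))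

theorem dirDeriv_slice {Y : E × ℝ → V} {x : E} {τ : ℝ} (h : AnalyticAt ℝ Y (x, τ)) (v : E) :
    dirDeriv v (fun x => Y (x, τ)) x = dirDeriv (v, 0) Y (x, τ) := by
  have hg : HasFDerivAt (fun x : E => (x, τ)) ((ContinuousLinearMap.id ℝ E).prod 0) x :=
    (hasFDerivAt_id x).prodMk (hasFDerivAt_const τ x)
  have := (HasFDerivAt.comp (g := Y) x h.differentiableAt.hasFDerivAt hg).fderiv
  change fderiv ℝ (Y ∘ fun x => (x, τ)) x v = _
  rw [this]
  rfl

theorem eventually_analyticAt_slice {Y : E × ℝ → V} {x : E} {τ : ℝ} (h : AnalyticAt ℝ Y (x, τ)) :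
    ∀ᶠ y in 𝓝 x, AnalyticAt ℝ Y (y, τ) :=
  (Continuous.prodMk_left τ).continuousAt.eventually h.eventually_analyticAt

theorem dirDeriv_iterate_slice {Y : E × ℝ → V} {x : E} {τ : ℝ} (h : AnalyticAt ℝ Y (x, τ)) (v : E)
    (m : ℕ) :
    (dirDeriv v)^[m] (fun x => Y (x, τ)) x = (dirDeriv (v, 0))^[m] Y (x, τ) := by
  induction m generalizing Y with
  | zero => rfl
  | succ m ih =>
    refine Eq.trans (dirDeriv_iterate_congr ?_ m).eq_of_nhds (ih (h.dirDeriv (v, 0)))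
    filter_upwards [eventually_analyticAt_slice h] with y hy using dirDeriv_slice hy v

/-- A periodic solution of `(-∂_τ - c₁) ⋯ (-∂_τ - c_k) w = 0` with real `c_i` is constant. -/
theorem dirDeriv_eq_zero_of_timeOps_eq_zero {x : E} {T : ℝ} (hT : 0 < T) {l : List ℝ}
    {Y : E × ℝ → V} (hY : ∀ τ, AnalyticAt ℝ Y (x, τ)) (hper : ∀ τ, Y (x, τ + T) = Y (x, τ))
    (h : ∀ τ, timeOps l Y (x, τ) = 0) (τ : ℝ) : dirDeriv (0, 1) Y (x, τ) = 0 := by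
  have hperd : ∀ {Y : E × ℝ → V}, (∀ τ, AnalyticAt ℝ Y (x, τ)) →
      (∀ τ, Y (x, τ + T) = Y (x, τ)) →
      ∀ τ, dirDeriv (0, 1) Y (x, τ + T) = dirDeriv (0, 1) Y (x, τ) := fun hY hper τ => by
    have h1 := (hasDerivAt_time (hY (τ + T))).comp_add_const τ T
    exact (h1.congr_of_eventuallyEq (Eventually.of_forall fun t => (hper t).symm)).unique
      (hasDerivAt_time (hY τ))
  induction l generalizing Y τ with
  | nil =>
    exact (hasDerivAt_time (hY τ)).unique
      ((hasDerivAt_const τ (0 : V)).congr_of_eventuallyEq (Eventually.of_forall h))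
  | cons c l ih =>
    have hP := hperd hY hper
    have h1 : ∀ τ, dirDeriv (0, 1) (timeOp c Y) (x, τ) = 0 :=
      fun τ => ih (fun τ => (hY τ).timeOp c)
        (fun τ => by simp only [timeOp, hP, hper]) h τ
    set u : ℝ → V := fun τ => dirDeriv (0, 1) Y (x, τ) with hu
    have hu' : ∀ τ, HasDerivAt u (-(c • u τ)) τ := fun τ => by
      have h2 := hasDerivAt_time ((hY τ).dirDeriv (0, 1))
      have h3 := h1 τ
      rw [dirDeriv_timeOp (hY τ)] at h3
      simp only [timeOp] at h3
      have : dirDeriv (0, 1) (dirDeriv (0, 1) Y) (x, τ) = -(c • u τ) := by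
        rw [sub_eq_zero] at h3
        rw [← h3, neg_neg]
      rwa [this] at h2
    rcases eq_or_ne c 0 with rfl | hc
    · have hconst : ∀ t, u t = u τ := fun t =>
        is_const_of_deriv_eq_zero (fun t => (hu' t).differentiableAt)
          (fun t => by simp [(hu' t).deriv]) t τ
      have hw : ∀ t, HasDerivAt (fun t => Y (x, t) - t • u τ) 0 t := fun t => by
        have := (hasDerivAt_time (hY t)).sub ((hasDerivAt_id t).smul_const (u τ))
        have e : dirDeriv (0, 1) Y (x, t) - (1 : ℝ) • u τ = 0 := by
          have := hconst t
          simp only [hu] at this ⊢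
          rw [this]; simp
        rwa [e] at this
      have := is_const_of_deriv_eq_zero (fun t => (hw t).differentiableAt)
        (fun t => (hw t).deriv) (0 + T) 0
      rw [hper] at this
      have h4 : T • u τ = 0 := by simpa using this
      exact (smul_eq_zero.1 h4).resolve_left hT.ne'
    · have hw : ∀ t, HasDerivAt (fun t => Real.exp (c * t) • u t) 0 t := fun t => by
        have := ((Real.hasDerivAt_exp (c * t)).comp t ((hasDerivAt_id t).const_mul c)).smul (hu' t)
        simp only [Function.comp_def, mul_one] at this
        have e : Real.exp (c * t) • -(c • u t) + (Real.exp (c * t) * c) • u t = 0 := by module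
        rwa [e] at this
      have := is_const_of_deriv_eq_zero (fun t => (hw t).differentiableAt)
        (fun t => (hw t).deriv) (τ + T) τ
      have hPu : u (τ + T) = u τ := hP τ
      simp only [hPu] at this
      have h4 : (Real.exp (c * (τ + T)) - Real.exp (c * τ)) • u τ = 0 := by
        rw [sub_smul, this, sub_self]
      refine (smul_eq_zero.1 h4).resolve_left fun h5 => ?_
      have h6 := Real.exp_injective (sub_eq_zero.1 h5)
      have : c * T = 0 := by linarith
      rcases mul_eq_zero.1 this with h | h
      exacts [hc h, hT.ne' h]

/-- A solution of a linear transport equation near a saddle which is periodic in time does not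
depend on time. -/
theorem SaddlePoint.dirDeriv_time_eq_zero {f : E → E} {N : E → V →L[ℝ] V} {p : E} {lam : ℝ}
    {ξ η : E →L[ℝ] ℝ} {e₁ e₂ : E} (hs : SaddlePoint f p lam ξ η e₁ e₂) (hN : AnalyticAt ℝ N p)
    (h0 : ∃ l : List ℝ, ∀ Z : E → V, AnalyticAt ℝ Z p → transportOps f N l Z p = 0)
    {O : Set E} (hO : IsOpen O) (hOc : IsPreconnected O) (hp : p ∈ O) {T : ℝ} (hT : 0 < T)
    {Y : E × ℝ → V} (hY : ∀ x ∈ O, ∀ τ, AnalyticAt ℝ Y (x, τ))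
    (hper : ∀ x ∈ O, ∀ τ, Y (x, τ + T) = Y (x, τ))
    (heq : ∀ x ∈ O, ∀ τ, fderiv ℝ Y (x, τ) (f x, 1) + N x (Y (x, τ)) = 0) :
    ∀ x ∈ O, ∀ τ, dirDeriv (0, 1) Y (x, τ) = 0 := by
  have hslice : ∀ (l : List ℝ) {Y : E × ℝ → V}, (∀ x ∈ O, ∀ τ, AnalyticAt ℝ Y (x, τ)) →
      (∀ x ∈ O, ∀ τ, fderiv ℝ Y (x, τ) (f x, 1) + N x (Y (x, τ)) = 0) →
      ∀ x ∈ O, ∀ τ, transportOps f N l (fun x => Y (x, τ)) x = timeOps l Y (x, τ) := by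
    intro l
    induction l with
    | nil => intros; rfl
    | cons c l ih =>
      intro Y hY heq x hx τ
      have hstep : ∀ x ∈ O, transportOp f N c (fun x => Y (x, τ)) x = timeOp c Y (x, τ) := by
        intro x hx
        have h1 := heq x hx τ
        have h2 : fderiv ℝ (fun x => Y (x, τ)) x (f x) = fderiv ℝ Y (x, τ) (f x, 0) :=
          dirDeriv_slice (hY x hx τ) (f x)
        have h3 : fderiv ℝ Y (x, τ) (f x, 1) = fderiv ℝ Y (x, τ) (f x, 0)
            + fderiv ℝ Y (x, τ) (0, 1) := by
          rw [← map_add]; simp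
        rw [h3] at h1
        simp only [transportOp, timeOp, dirDeriv, h2]
        rw [add_right_comm, add_eq_zero_iff_eq_neg] at h1
        rw [h1]
      have hcongr : transportOp f N c (fun x => Y (x, τ)) =ᶠ[𝓝 x] fun x => timeOp c Y (x, τ) := by
        filter_upwards [hO.mem_nhds hx] with y hy using hstep y hy
      refine (transportOps_congr hcongr).eq_of_nhds.trans
        (ih (fun x hx τ => (hY x hx τ).timeOp c) (fun x hx τ => ?_) x hx τ)
      change dirDeriv (f x, 1) (timeOp c Y) (x, τ) + _ = 0
      rw [dirDeriv_timeOp (hY x hx τ)]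
      have h4 : dirDeriv (0, 1) (dirDeriv (f x, 1) Y) (x, τ)
          = -N x (dirDeriv (0, 1) Y (x, τ)) := by
        refine (hasDerivAt_time ((hY x hx τ).dirDeriv (f x, 1))).unique ?_
        refine (((N x).hasFDerivAt.comp_hasDerivAt τ
          (hasDerivAt_time (hY x hx τ))).fun_neg).congr_of_eventuallyEq
          (Eventually.of_forall fun t => ?_)
        exact eq_neg_of_add_eq_zero_left (heq x hx t)
      have h5 : dirDeriv (f x, 1) Y (x, τ) = -N x (Y (x, τ)) :=
        eq_neg_of_add_eq_zero_left (heq x hx τ)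
      simp only [timeOp, h4, h5, map_sub, map_neg, map_smul]
      module
  have hzero : ∀ v m τ, (dirDeriv v)^[m] (fun x => dirDeriv (0, 1) Y (x, τ)) p = 0 := by
    intro v m τ
    obtain ⟨l, hl⟩ := hs.exists_flattening hN h0 (m + 1)
    have han : ∀ τ, AnalyticAt ℝ ((dirDeriv ((v, 0) : E × ℝ))^[m] Y) (p, τ) := fun τ =>
      (hY p hp τ).dirDeriv_iterate _ m
    have hcomm : ∀ (m : ℕ) {Y : E × ℝ → V} {z : E × ℝ}, AnalyticAt ℝ Y z →
        (dirDeriv ((v, 0) : E × ℝ))^[m] (dirDeriv (0, 1) Y) z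
          = dirDeriv (0, 1) ((dirDeriv ((v, 0) : E × ℝ))^[m] Y) z := by
      intro m
      induction m with
      | zero => intros; rfl
      | succ m ih =>
        intro Y z hz
        refine Eq.trans (dirDeriv_iterate_congr ?_ m).eq_of_nhds (ih (hz.dirDeriv (v, 0)))
        filter_upwards [hz.eventually_analyticAt] with y hy using dirDeriv_comm hy _ _
    rw [dirDeriv_iterate_slice ((hY p hp τ).dirDeriv _), hcomm m (hY p hp τ)]
    refine dirDeriv_eq_zero_of_timeOps_eq_zero hT (l := l) han (fun τ => ?_) (fun τ => ?_) τ
    · rw [← dirDeriv_iterate_slice (hY p hp _), ← dirDeriv_iterate_slice (hY p hp _)]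
      refine (dirDeriv_iterate_congr ?_ m).eq_of_nhds
      filter_upwards [hO.mem_nhds hp] with y hy using hper y hy τ
    · rw [← dirDeriv_iterate_timeOps (hY p hp τ)]
      have hal : AnalyticAt ℝ (timeOps l Y) (p, τ) := by
        have : ∀ (l : List ℝ) {Y : E × ℝ → V} {z : E × ℝ}, AnalyticAt ℝ Y z →
            AnalyticAt ℝ (timeOps l Y) z := by
          intro l
          induction l with
          | nil => intro Y z h; exact h
          | cons c l ih => intro Y z h; exact ih (h.timeOp c)
        exact this l (hY p hp τ)
      rw [← dirDeriv_iterate_slice hal]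
      have hv := hl (fun x => Y (x, τ)) (AnalyticAt.comp (g := Y) (hY p hp τ) (by fun_prop))
      refine Eq.trans (dirDeriv_iterate_congr ?_ m).eq_of_nhds (hv.dirDeriv_iterate_eq_zero v)
      filter_upwards [hO.mem_nhds hp] with y hy using (hslice l hY heq y hy τ).symm
  intro x hx τ
  have han : AnalyticOnNhd ℝ (fun x => dirDeriv (0, 1) Y (x, τ)) O := fun x hx =>
    AnalyticAt.comp (g := dirDeriv (0, 1) Y) ((hY x hx τ).dirDeriv _) (by fun_prop)
  exact han.eqOn_zero_of_preconnected_of_eventuallyEq_zero hOc hp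
    (eventually_eq_zero_of_dirDeriv_iterate (han p hp) fun v m => hzero v m τ) hx

end TimeOperators

section Projection

variable {E : Type*} [NormedAddCommGroup E] [NormedSpace ℝ E]

theorem fderiv_dirDeriv_time {V : Type*} [NormedAddCommGroup V] [NormedSpace ℝ V]
    [CompleteSpace V] {Y : E × ℝ → V} {x : E} {τ : ℝ} {w : E × ℝ} {R : ℝ → V} {R' : V}
    (hY : AnalyticAt ℝ Y (x, τ)) (h : ∀ t, fderiv ℝ Y (x, t) w = R t) (hR : HasDerivAt R R' τ) :
    fderiv ℝ (dirDeriv (0, 1) Y) (x, τ) w = R' := by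
  change dirDeriv w (dirDeriv (0, 1) Y) (x, τ) = R'
  rw [dirDeriv_comm hY]
  exact (hasDerivAt_time (hY.dirDeriv w)).unique
    (hR.congr_of_eventuallyEq (Eventually.of_forall h))

theorem dirDeriv_time_periodic {V : Type*} [NormedAddCommGroup V] [NormedSpace ℝ V]
    [CompleteSpace V] {Y : E × ℝ → V} {x : E} {T : ℝ} (hY : ∀ τ, AnalyticAt ℝ Y (x, τ))
    (hper : ∀ τ, Y (x, τ + T) = Y (x, τ)) (τ : ℝ) :
    dirDeriv (0, 1) Y (x, τ + T) = dirDeriv (0, 1) Y (x, τ) := by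
  have h1 := (hasDerivAt_time (hY (τ + T))).comp_add_const τ T
  exact (h1.congr_of_eventuallyEq (Eventually.of_forall fun t => (hper t).symm)).unique
    (hasDerivAt_time (hY τ))

theorem hasDerivAt_cexp_mul (μ τ : ℝ) (c : ℂ) :
    HasDerivAt (fun t : ℝ => Complex.exp (Complex.I * μ * t) * c)
      (Complex.I * μ * (Complex.exp (Complex.I * μ * τ) * c)) τ := by
  have h1 : HasDerivAt (fun t : ℝ => Complex.I * μ * (t : ℂ)) (Complex.I * μ) τ := by
    simpa using (Complex.ofRealCLM.hasDerivAt (x := τ)).const_mul (Complex.I * μ)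
  have := (h1.cexp).mul_const c
  rwa [mul_comm (Complex.exp _) (Complex.I * μ), mul_assoc] at this

/-- If the transport equation with a quasi-periodic right-hand side has a solution periodic in
time, then each nonzero Fourier mode of the right-hand side can be solved for separately. -/
theorem SaddlePoint.exists_fourier_mode {f : E → E} {p : E} {lam : ℝ}
    {ξ η : E →L[ℝ] ℝ} {e₁ e₂ : E} (hs : SaddlePoint f p lam ξ η e₁ e₂)
    {O : Set E} (hO : IsOpen O) (hOc : IsPreconnected O) (hp : p ∈ O) {T : ℝ} (hT : 0 < T)
    {ν : ℝ} (hν : ν ≠ 0) {S : Finset ℝ} (hνS : ν ∉ S) {ρ : ℝ → E → ℂ}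
    {Z : E × ℝ → ℂ} (hZ : ∀ x ∈ O, ∀ τ, AnalyticAt ℝ Z (x, τ))
    (hper : ∀ x ∈ O, ∀ τ, Z (x, τ + T) = Z (x, τ))
    (heq : ∀ x ∈ O, ∀ τ : ℝ, fderiv ℝ Z (x, τ) (f x, 1)
      = Complex.exp (Complex.I * ν * τ) * ρ ν x
        + ∑ μ ∈ S, Complex.exp (Complex.I * μ * τ) * ρ μ x) :
    ∃ Z₀ : E → ℂ, AnalyticOnNhd ℝ Z₀ O ∧
      ∀ x ∈ O, fderiv ℝ Z₀ x (f x) + Complex.I * ν * Z₀ x = ρ ν x := by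
  classical
  have hshift : ∀ {Z : E × ℝ → ℂ}, (∀ x ∈ O, ∀ τ, AnalyticAt ℝ Z (x, τ)) → ∀ (μ : ℝ),
      ∀ x ∈ O, ∀ τ : ℝ, ∀ w : E × ℝ,
      fderiv ℝ (fun z => dirDeriv (0, 1) Z z - Complex.I * μ * Z z) (x, τ) w
        = fderiv ℝ (dirDeriv (0, 1) Z) (x, τ) w - Complex.I * μ * fderiv ℝ Z (x, τ) w := by
    intro Z hZ μ x hx τ w
    have := (((hZ x hx τ).dirDeriv (0, 1)).differentiableAt.hasFDerivAt.fun_sub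
      ((hZ x hx τ).differentiableAt.hasFDerivAt.const_mul (Complex.I * μ))).fderiv
    rw [this]
    simp
  have hshiftan : ∀ {Z : E × ℝ → ℂ}, (∀ x ∈ O, ∀ τ, AnalyticAt ℝ Z (x, τ)) → ∀ (μ : ℝ),
      ∀ x ∈ O, ∀ τ, AnalyticAt ℝ (fun z => dirDeriv (0, 1) Z z - Complex.I * μ * Z z) (x, τ) :=
    fun hZ μ x hx τ => ((hZ x hx τ).dirDeriv (0, 1)).sub (analyticAt_const.mul (hZ x hx τ))
  induction S using Finset.induction_on generalizing Z ρ with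
  | empty =>
    simp only [Finset.sum_empty, add_zero] at heq
    have hD : ∀ x ∈ O, ∀ τ : ℝ, fderiv ℝ (dirDeriv (0, 1) Z) (x, τ) (f x, 1)
        = Complex.I * ν * (Complex.exp (Complex.I * ν * τ) * ρ ν x) := fun x hx τ =>
      fderiv_dirDeriv_time (hZ x hx τ) (heq x hx) (hasDerivAt_cexp_mul ν τ _)
    have hindep := hs.dirDeriv_time_eq_zero (N := fun _ => (0 : ℂ →L[ℝ] ℂ)) analyticAt_const
      (SaddlePoint.transportOps_zero_base hs.apply_eq_zero) hO hOc hp hT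
      (hshiftan hZ ν)
      (fun x hx τ => by
        rw [dirDeriv_time_periodic (hZ x hx) (hper x hx), hper x hx])
      (fun x hx τ => by
        rw [hshift hZ ν x hx, hD x hx, heq x hx]
        simp)
    refine ⟨fun x => (Complex.I * ν)⁻¹ * dirDeriv (0, 1) Z (x, 0), fun x hx => ?_, fun x hx => ?_⟩
    · exact analyticAt_const.mul (AnalyticAt.comp (g := dirDeriv (0, 1) Z)
        ((hZ x hx 0).dirDeriv _) (by fun_prop))
    · have han := (hZ x hx 0).dirDeriv (0, 1)
      have h1 : fderiv ℝ (fun x => dirDeriv (0, 1) Z (x, 0)) x (f x)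
          = fderiv ℝ (dirDeriv (0, 1) Z) (x, 0) (f x, 0) := dirDeriv_slice han (f x)
      have hdiff : DifferentiableAt ℝ (fun x => dirDeriv (0, 1) Z (x, 0)) x :=
        (AnalyticAt.comp (g := dirDeriv (0, 1) Z) han
          (f := fun x : E => (x, (0 : ℝ))) (by fun_prop)).differentiableAt
      have h2 := hD x hx 0
      have h3 : fderiv ℝ (dirDeriv (0, 1) Z) (x, 0) (f x, 1)
          = fderiv ℝ (dirDeriv (0, 1) Z) (x, 0) (f x, 0)
            + fderiv ℝ (dirDeriv (0, 1) Z) (x, 0) (0, 1) := by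
        rw [← map_add]; simp
      have h4 := hindep x hx 0
      change fderiv ℝ _ (x, 0) (0, 1) = 0 at h4
      rw [hshift hZ ν x hx, sub_eq_zero] at h4
      change _ = _ * dirDeriv (0, 1) Z (x, 0) at h4
      rw [h3, h4] at h2
      rw [fderiv_const_mul hdiff]
      simp only [smul_apply, smul_eq_mul, h1]
      have hν' : Complex.I * (ν : ℂ) ≠ 0 := mul_ne_zero Complex.I_ne_zero (by exact_mod_cast hν)
      simp only [Complex.ofReal_zero, mul_zero, Complex.exp_zero, one_mul] at h2
      rw [mul_left_comm, ← mul_add, inv_mul_eq_iff_eq_mul₀ hν', h2]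
  | insert μ S hμS ih =>
    have hμν : ν ≠ μ := fun h => hνS (h ▸ Finset.mem_insert_self _ _)
    have hνS' : ν ∉ S := fun h => hνS (Finset.mem_insert_of_mem h)
    obtain ⟨Z₁, hZ₁, h₁⟩ := ih hνS' (ρ := fun κ x => Complex.I * (κ - μ) * ρ κ x) (hshiftan hZ μ)
      (fun x hx τ => by
        rw [dirDeriv_time_periodic (hZ x hx) (hper x hx), hper x hx])
      (fun x hx τ => by
        have hR := (hasDerivAt_cexp_mul ν τ (ρ ν x)).fun_add
          (HasDerivAt.fun_sum fun κ (_ : κ ∈ insert μ S) => hasDerivAt_cexp_mul κ τ (ρ κ x))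
        rw [hshift hZ μ x hx, fderiv_dirDeriv_time (hZ x hx τ) (heq x hx) hR, heq x hx,
          Finset.sum_insert hμS, Finset.sum_insert hμS, mul_add, mul_add, Finset.mul_sum]
        have : ∑ κ ∈ S, Complex.exp (Complex.I * κ * τ) * (Complex.I * (κ - μ) * ρ κ x)
            = ∑ κ ∈ S, Complex.I * κ * (Complex.exp (Complex.I * κ * τ) * ρ κ x)
              - ∑ κ ∈ S, Complex.I * μ * (Complex.exp (Complex.I * κ * τ) * ρ κ x) := by
          rw [← Finset.sum_sub_distrib]
          exact Finset.sum_congr rfl fun κ _ => by ring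
        rw [this]
        ring)
    have hc : Complex.I * ((ν : ℂ) - μ) ≠ 0 :=
      mul_ne_zero Complex.I_ne_zero (sub_ne_zero.2 (by exact_mod_cast hμν))
    refine ⟨fun x => (Complex.I * (ν - μ))⁻¹ * Z₁ x, fun x hx => analyticAt_const.mul (hZ₁ x hx),
      fun x hx => ?_⟩
    rw [fderiv_const_mul (hZ₁ x hx).differentiableAt]
    have := h₁ x hx
    simp only [smul_apply, smul_eq_mul]
    rw [mul_left_comm, ← mul_add, inv_mul_eq_iff_eq_mul₀ hc, this]

end Projection

section TaylorCoefficients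

variable {E : Type*} [NormedAddCommGroup E] [NormedSpace ℝ E]
  {V : Type*} [NormedAddCommGroup V] [NormedSpace ℝ V] [CompleteSpace V]

theorem dirDeriv_iterate_comm {Z : E → V} {z : E} (h : AnalyticAt ℝ Z z) (v w : E) (m : ℕ) :
    (dirDeriv v)^[m] (dirDeriv w Z) z = dirDeriv w ((dirDeriv v)^[m] Z) z := by
  induction m generalizing Z with
  | zero => rfl
  | succ m ih =>
    refine Eq.trans (dirDeriv_iterate_congr ?_ m).eq_of_nhds (ih (h.dirDeriv v))
    filter_upwards [h.eventually_analyticAt] with y hy using dirDeriv_comm hy _ _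

theorem dirDeriv_iterate_add {Z W : E → V} {z : E} (hZ : AnalyticAt ℝ Z z)
    (hW : AnalyticAt ℝ W z) (v : E) (m : ℕ) :
    (dirDeriv v)^[m] (fun y => Z y + W y) z = (dirDeriv v)^[m] Z z + (dirDeriv v)^[m] W z := by
  induction m generalizing Z W with
  | zero => rfl
  | succ m ih =>
    refine Eq.trans (dirDeriv_iterate_congr ?_ m).eq_of_nhds (ih (hZ.dirDeriv v) (hW.dirDeriv v))
    filter_upwards [hZ.eventually_analyticAt, hW.eventually_analyticAt] with y h1 h2
    exact dirDeriv_add h1 h2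

theorem dirDeriv_iterate_clm {Z : E → V} {z : E} (h : AnalyticAt ℝ Z z) (L : V →L[ℝ] V)
    (v : E) (m : ℕ) :
    (dirDeriv v)^[m] (fun y => L (Z y)) z = L ((dirDeriv v)^[m] Z z) := by
  induction m generalizing Z with
  | zero => rfl
  | succ m ih =>
    refine Eq.trans (dirDeriv_iterate_congr ?_ m).eq_of_nhds (ih (h.dirDeriv v))
    filter_upwards [h.eventually_analyticAt] with y hy
    change fderiv ℝ (L ∘ Z) y v = L (fderiv ℝ Z y v)
    rw [(L.hasFDerivAt.comp y hy.differentiableAt.hasFDerivAt).fderiv]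
    rfl

/-- Leibniz rule for the Taylor coefficients of `A + s B`. -/
theorem iteratedDeriv_add_smul_eq_zero {A B : ℝ → V} (hA : AnalyticAt ℝ A 0)
    (hB : AnalyticAt ℝ B 0) (h : ∀ᶠ s in 𝓝 (0 : ℝ), A s + s • B s = 0) (k : ℕ) :
    iteratedDeriv (k + 1) A 0 + ((k : ℝ) + 1) • iteratedDeriv k B 0 = 0 := by
  have hd : ∀ {A : ℝ → V} {s : ℝ}, AnalyticAt ℝ A s → ∀ k,
      HasDerivAt (iteratedDeriv k A) (iteratedDeriv (k + 1) A s) s := fun hA k => by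
    rw [iteratedDeriv_succ]
    exact (hA.iterated_deriv k |>.congr (by simp [iteratedDeriv_eq_iterate])
      ).differentiableAt.hasDerivAt
  have key : ∀ k : ℕ, ∀ᶠ s in 𝓝 (0 : ℝ), iteratedDeriv (k + 1) A s
      + s • iteratedDeriv (k + 1) B s + ((k : ℝ) + 1) • iteratedDeriv k B s = 0 := by
    intro k
    induction k with
    | zero =>
      filter_upwards [h.eventually_nhds, hA.eventually_analyticAt, hB.eventually_analyticAt]
        with s hs hAs hBs
      have h1 := (hd hAs 0).fun_add ((hasDerivAt_id s).fun_smul (hd hBs 0))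
      have h2 := h1.unique ((hasDerivAt_const s (0 : V)).congr_of_eventuallyEq
        (by simpa [EventuallyEq] using hs))
      simpa [add_assoc] using h2
    | succ k ih =>
      filter_upwards [ih.eventually_nhds, hA.eventually_analyticAt, hB.eventually_analyticAt]
        with s hs hAs hBs
      have h1 := ((hd hAs (k + 1)).fun_add ((hasDerivAt_id s).fun_smul (hd hBs (k + 1)))).fun_add
        ((hd hBs k).fun_const_smul ((k : ℝ) + 1))
      have h2 := h1.unique ((hasDerivAt_const s (0 : V)).congr_of_eventuallyEq
        (by simpa [EventuallyEq] using hs))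
      simp only [id, one_smul] at h2
      rw [← h2]
      push_cast
      module
  simpa using (key k).self_of_nhds

/-- The `k`-th derivative in the second variable, restricted to the value zero of it. -/
noncomputable def taylorCoeff (F : E × ℝ × ℝ → V) (k : ℕ) : E × ℝ → V :=
  fun z => (dirDeriv ((0, 1, 0) : E × ℝ × ℝ))^[k] F (z.1, 0, z.2)

theorem analyticAt_taylorCoeff {F : E × ℝ × ℝ → V} {x : E} {τ : ℝ}
    (h : AnalyticAt ℝ F (x, 0, τ)) (k : ℕ) : AnalyticAt ℝ (taylorCoeff F k) (x, τ) :=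
  AnalyticAt.comp (g := (dirDeriv ((0, 1, 0) : E × ℝ × ℝ))^[k] F)
    (f := fun z : E × ℝ => (z.1, 0, z.2)) (h.dirDeriv_iterate _ k)
    (analyticAt_fst.prod (analyticAt_const.prod analyticAt_snd))

theorem fderiv_taylorCoeff {F : E × ℝ × ℝ → V} {x : E} {τ : ℝ}
    (h : AnalyticAt ℝ F (x, 0, τ)) (k : ℕ) (v : E) (t : ℝ) :
    fderiv ℝ (taylorCoeff F k) (x, τ) (v, t)
      = dirDeriv (v, 0, t) ((dirDeriv ((0, 1, 0) : E × ℝ × ℝ))^[k] F) (x, 0, τ) := by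
  have hg : HasFDerivAt (fun z : E × ℝ => (z.1, (0 : ℝ), z.2))
      ((ContinuousLinearMap.fst ℝ E ℝ).prod
        ((0 : E × ℝ →L[ℝ] ℝ).prod (ContinuousLinearMap.snd ℝ E ℝ))) (x, τ) :=
    hasFDerivAt_fst.prodMk ((hasFDerivAt_const _ _).prodMk hasFDerivAt_snd)
  have := (HasFDerivAt.comp (g := (dirDeriv ((0, 1, 0) : E × ℝ × ℝ))^[k] F) (x, τ)
    (h.dirDeriv_iterate _ k).differentiableAt.hasFDerivAt hg).fderiv
  change fderiv ℝ (_ ∘ fun z : E × ℝ => (z.1, (0 : ℝ), z.2)) (x, τ) (v, t) = _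
  rw [this]
  rfl

theorem line_eq (x : E) (s τ : ℝ) :
    (x, (0 : ℝ), τ) + s • ((0, 1, 0) : E × ℝ × ℝ) = (x, s, τ) := by simp

theorem iteratedDeriv_param {F : E × ℝ × ℝ → V} {x : E} {s τ : ℝ}
    (h : AnalyticAt ℝ F (x, s, τ)) (k : ℕ) :
    iteratedDeriv k (fun s => F (x, s, τ)) s
      = (dirDeriv ((0, 1, 0) : E × ℝ × ℝ))^[k] F (x, s, τ) := by
  have := iteratedDeriv_line (x := (x, (0 : ℝ), τ)) (v := ((0, 1, 0) : E × ℝ × ℝ)) (s := s)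
    (Z := F) (by rwa [line_eq]) k
  simpa only [line_eq] using this

theorem taylorCoeff_periodic {F : E × ℝ × ℝ → V} {x : E} {τ T : ℝ}
    (h : ∀ τ, AnalyticAt ℝ F (x, 0, τ)) (hper : ∀ᶠ s in 𝓝 (0 : ℝ), F (x, s, τ + T) = F (x, s, τ))
    (k : ℕ) : taylorCoeff F k (x, τ + T) = taylorCoeff F k (x, τ) := by
  simp only [taylorCoeff]
  rw [← iteratedDeriv_param (h _), ← iteratedDeriv_param (h _)]
  exact Filter.EventuallyEq.iteratedDeriv_eq k hper

theorem eq_zero_of_taylorCoeff_eq_zero {F : E × ℝ × ℝ → V} {x : E} {τ : ℝ} {J : Set ℝ}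
    (hJ : IsPreconnected J) (hJ0 : 0 ∈ J) (h : ∀ s ∈ J, AnalyticAt ℝ F (x, s, τ))
    (h0 : ∀ k, taylorCoeff F k (x, τ) = 0) : ∀ s ∈ J, F (x, s, τ) = 0 := by
  have han : AnalyticOnNhd ℝ (fun s => F (x, s, τ)) J := fun s hs =>
    AnalyticAt.comp (g := F) (f := fun s : ℝ => (x, s, τ)) (h s hs) (by fun_prop)
  have hev : (fun s => F (x, s, τ)) =ᶠ[𝓝 0] 0 := by
    have : analyticOrderAt (fun s : ℝ => F (x, s, τ)) 0 = ⊤ := by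
      refine ENat.eq_top_iff_forall_ge.2 fun n => ?_
      exact (natCast_le_analyticOrderAt_iff_iteratedDeriv_eq_zero (han 0 hJ0)).2 fun i _ => by
        rw [iteratedDeriv_param (h 0 hJ0)]; exact h0 i
    exact analyticOrderAt_eq_top.1 this
  exact fun s hs => han.eqOn_zero_of_preconnected_of_eventuallyEq_zero hJ hJ0 hev hs

theorem taylorCoeff_dirDeriv {F : E × ℝ × ℝ → V} {x : E} {τ : ℝ}
    (h : AnalyticAt ℝ F (x, 0, τ)) (k : ℕ) (v : E) :
    taylorCoeff (dirDeriv (v, 0, 0) F) k (x, τ) = fderiv ℝ (taylorCoeff F k) (x, τ) (v, 0) := by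
  rw [fderiv_taylorCoeff h]
  exact dirDeriv_iterate_comm h _ _ k

/-- The hierarchy satisfied by the Taylor coefficients in `s` of a solution of a transport
equation along `(f₀ + s g, 0, 1)`. -/
theorem taylorCoeff_transport {F : E × ℝ × ℝ → V} {x : E} {τ : ℝ} {v w : E}
    {L M : V →L[ℝ] V} (h : AnalyticAt ℝ F (x, 0, τ))
    (heq : ∀ᶠ s in 𝓝 (0 : ℝ), fderiv ℝ F (x, s, τ) (v + s • w, 0, 1)
      + (L (F (x, s, τ)) + s • M (F (x, s, τ))) = 0) :
    fderiv ℝ (taylorCoeff F 0) (x, τ) (v, 1) + L (taylorCoeff F 0 (x, τ)) = 0 ∧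
    ∀ k : ℕ, fderiv ℝ (taylorCoeff F (k + 1)) (x, τ) (v, 1) + L (taylorCoeff F (k + 1) (x, τ))
      + ((k : ℝ) + 1) • (fderiv ℝ (taylorCoeff F k) (x, τ) (w, 0)
        + M (taylorCoeff F k (x, τ))) = 0 := by
  refine ⟨?_, fun k => ?_⟩
  · rw [fderiv_taylorCoeff h]
    have := heq.self_of_nhds
    simpa [dirDeriv, taylorCoeff] using this
  · let A : E × ℝ × ℝ → V := fun z => dirDeriv (v, 0, 1) F z + L (F z)
    let B : E × ℝ × ℝ → V := fun z => dirDeriv (w, 0, 0) F z + M (F z)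
    have hL : ∀ L : V →L[ℝ] V, AnalyticAt ℝ (fun z => L (F z)) (x, 0, τ) := fun L =>
      (L.analyticAt _).comp h
    have hA : AnalyticAt ℝ A (x, 0, τ) := (h.dirDeriv _).add (hL L)
    have hB : AnalyticAt ℝ B (x, 0, τ) := (h.dirDeriv _).add (hL M)
    have hline : AnalyticAt ℝ (fun s : ℝ => (x, s, τ)) 0 := by fun_prop
    have := iteratedDeriv_add_smul_eq_zero (A := fun s => A (x, s, τ)) (B := fun s => B (x, s, τ))
      (AnalyticAt.comp (g := A) hA hline) (AnalyticAt.comp (g := B) hB hline)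
      (by
        filter_upwards [heq] with s hs
        rw [← hs]
        have : (v + s • w, (0 : ℝ), (1 : ℝ)) = (v, 0, 1) + s • (w, (0 : ℝ), (0 : ℝ)) := by simp
        rw [this, map_add, map_smul]
        simp only [A, B, dirDeriv]
        module) k
    rw [iteratedDeriv_param hA, iteratedDeriv_param hB, dirDeriv_iterate_add (h.dirDeriv _) (hL L),
      dirDeriv_iterate_add (h.dirDeriv _) (hL M), dirDeriv_iterate_comm h, dirDeriv_iterate_comm h,
      dirDeriv_iterate_clm h, dirDeriv_iterate_clm h] at this
    rw [fderiv_taylorCoeff h, fderiv_taylorCoeff h]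
    exact this

end TaylorCoefficients

/-- A time-dependent planar perturbation `g(x, τ)` for which `DH · g` is a finite sum of Fourier
modes, one of which has a nonvanishing Melnikov integral along the connection. -/
structure MelnikovForcing (H : ℝ × ℝ → ℝ) (γ : ℝ → ℝ × ℝ) (p p' : ℝ × ℝ)
    (g : (ℝ × ℝ) × ℝ → ℝ × ℝ) : Prop where
  analytic : ∀ (τ : ℝ) (x : ℝ × ℝ), AnalyticAt ℝ (fun y => g (y, τ)) x
  modes : ∃ (ν : ℝ) (S : Finset ℝ) (ρ : ℝ → ℝ × ℝ → ℂ), ν ≠ 0 ∧ ν ∉ S ∧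
    (∀ μ x, AnalyticAt ℝ (ρ μ) x) ∧ ρ ν p = 0 ∧ ρ ν p' = 0 ∧
    (∀ (x : ℝ × ℝ) (τ : ℝ), ((fderiv ℝ H x (g (x, τ)) : ℝ) : ℂ)
      = Complex.exp (Complex.I * ν * τ) * ρ ν x
        + ∑ μ ∈ S, Complex.exp (Complex.I * μ * τ) * ρ μ x) ∧
    ∫ s : ℝ, Complex.exp (Complex.I * ν * s) * ρ ν (γ s) ≠ 0

namespace SaddleConnection
variable {H : ℝ × ℝ → ℝ} {γ : ℝ → ℝ × ℝ} {p p' : ℝ × ℝ} {O : Set (ℝ × ℝ)}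
  {g : (ℝ × ℝ) × ℝ → ℝ × ℝ}

theorem fderiv_ofReal_comp {E : Type*} [NormedAddCommGroup E] [NormedSpace ℝ E] {h : E → ℝ}
    {x : E} (hh : DifferentiableAt ℝ h x) (v : E) :
    fderiv ℝ (fun y => ((h y : ℝ) : ℂ)) x v = ((fderiv ℝ h x v : ℝ) : ℂ) := by
  have := (Complex.ofRealCLM.hasFDerivAt.comp x hh.hasFDerivAt).fderiv
  change fderiv ℝ (Complex.ofRealCLM ∘ h) x v = _
  rw [this]
  rfl

/-- The obstruction to a time-periodic solution of the transport equation forced by `g`. -/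
theorem eventually_eq_zero_of_forcing (hc : SaddleConnection H γ p p')
    (hO : ConnectionNhd γ p p' O) (hg : MelnikovForcing H γ p p' g) {T : ℝ} (hT : 0 < T)
    {Z : (ℝ × ℝ) × ℝ → ℝ} {β : ℝ × ℝ → ℝ} {X : ℝ × ℝ → ℝ × ℝ}
    (hZ : ∀ x ∈ O, ∀ τ, AnalyticAt ℝ Z (x, τ)) (hper : ∀ x ∈ O, ∀ τ, Z (x, τ + T) = Z (x, τ))
    (hβa : AnalyticOnNhd ℝ β O) (hXa : AnalyticOnNhd ℝ X O)
    (heq : ∀ x ∈ O, ∀ τ : ℝ, fderiv ℝ Z (x, τ) (JDH H x, 1) = β x * fderiv ℝ H x (g (x, τ))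
      + fderiv ℝ (fun y => fderiv ℝ H y (g (y, τ))) x (X x))
    (hβf : ∀ x ∈ O, fderiv ℝ β x (JDH H x) = 0)
    (hXf : ∀ x ∈ O, fderiv ℝ X x (JDH H x) = fderiv ℝ (JDH H) x (X x))
    {β₀ χ : ℝ → ℝ} (hχ : AnalyticAt ℝ χ (H (γ 0)))
    (hχ0 : χ (H (γ 0)) = 0) (hβ : ∀ᶠ x in 𝓝 (γ 0), β x = β₀ (H x))
    (hX : ∀ᶠ x in 𝓝 (γ 0), fderiv ℝ H x (X x) = χ (H x))
    (hχβ : ∀ᶠ e in 𝓝 (H (γ 0)), |deriv χ e| ≤ |β₀ e|) :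
    (∀ᶠ e in 𝓝 (H (γ 0)), β₀ e = 0) ∧ ∀ᶠ x in 𝓝 (γ 0), X x = 0 := by
  obtain ⟨ν, S, ρ, hν, hνS, hρ, hρp, hρp', hsum, hM⟩ := hg.modes
  obtain ⟨lam, ξ, η, e₁, e₂, hs⟩ := hc.saddle
  obtain ⟨Z₀, hZ₀, hZ₀eq⟩ := hs.exists_fourier_mode hO.isOpen hO.preconnected hO.mem hT hν hνS
    (ρ := fun μ x => β x * ρ μ x + fderiv ℝ (ρ μ) x (X x)) (Z := fun z => (Z z : ℂ))
    (fun x hx τ => AnalyticAt.comp (g := Complex.ofRealCLM)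
      (Complex.ofRealCLM.analyticAt _) (hZ x hx τ))
    (fun x hx τ => by rw [hper x hx])
    (fun x hx τ => by
      rw [fderiv_ofReal_comp (hZ x hx τ).differentiableAt, heq x hx]
      have hd : DifferentiableAt ℝ (fun y => fderiv ℝ H y (g (y, τ))) x :=
        ((hc.analytic x trivial).fderiv.clm_apply_fun (hg.analytic τ x)).differentiableAt
      push_cast
      rw [← fderiv_ofReal_comp hd, hsum]
      simp only [hsum]
      have hm : ∀ μ : ℝ, HasFDerivAt (fun y => Complex.exp (Complex.I * μ * τ) * ρ μ y)
          (Complex.exp (Complex.I * μ * τ) • fderiv ℝ (ρ μ) x) x := fun μ =>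
        (hρ μ x).differentiableAt.hasFDerivAt.const_mul _
      rw [((hm ν).fun_add (HasFDerivAt.fun_sum fun μ (_ : μ ∈ S) => hm μ)).fderiv]
      simp only [add_apply, smul_apply, sum_apply, smul_eq_mul, mul_add,
        Finset.mul_sum, Finset.sum_add_distrib]
      have : ∀ μ : ℝ, (β x : ℂ) * (Complex.exp (Complex.I * μ * τ) * ρ μ x)
          = Complex.exp (Complex.I * μ * τ) * (β x * ρ μ x) := fun μ => by ring
      simp only [this]
      ring)
  exact hc.eventually_eq_zero hO (r := ρ ν) ⟨hZ₀, fun x _ => hρ ν x, hβa, hXa, hZ₀eq, hβf, hXf⟩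
    hν hρp hρp' hM hχ hχ0 hβ hX hχβ

theorem slice_eq {V : Type*} [NormedAddCommGroup V] [NormedSpace ℝ V] [CompleteSpace V]
    {Y : (ℝ × ℝ) × ℝ → V} {x : ℝ × ℝ} (hY : ∀ τ, AnalyticAt ℝ Y (x, τ))
    (h : ∀ τ, dirDeriv (0, 1) Y (x, τ) = 0) (τ : ℝ) : Y (x, τ) = Y (x, 0) :=
  is_const_of_deriv_eq_zero (f := fun τ => Y (x, τ))
    (fun t => (hasDerivAt_time (hY t)).differentiableAt)
    (fun t => (hasDerivAt_time (hY t)).deriv.trans (h t)) τ 0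

theorem fderiv_slice_eq {V : Type*} [NormedAddCommGroup V] [NormedSpace ℝ V] [CompleteSpace V]
    {Y : (ℝ × ℝ) × ℝ → V} (hO : IsOpen O) (hY : ∀ x ∈ O, ∀ τ, AnalyticAt ℝ Y (x, τ))
    (h : ∀ x ∈ O, ∀ τ, dirDeriv (0, 1) Y (x, τ) = 0) {x : ℝ × ℝ} (hx : x ∈ O) (τ : ℝ)
    (v : ℝ × ℝ) : fderiv ℝ Y (x, τ) (v, 0) = fderiv ℝ (fun y => Y (y, 0)) x v := by
  have h1 : dirDeriv v (fun y => Y (y, τ)) x = dirDeriv (v, 0) Y (x, τ) :=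
    dirDeriv_slice (hY x hx τ) v
  have h2 : (fun y => Y (y, τ)) =ᶠ[𝓝 x] fun y => Y (y, 0) := by
    filter_upwards [hO.mem_nhds hx] with y hy using slice_eq (hY y hy) (h y hy) τ
  exact h1.symm.trans (dirDeriv_congr h2).eq_of_nhds

/-- Along a perturbation with nonvanishing Melnikov integral, a time-periodic first integral does
not depend on the position. -/
theorem dirDeriv_space_eq_zero (hc : SaddleConnection H γ p p')
    (hO : ConnectionNhd γ p p' O) (hg : MelnikovForcing H γ p p' g) {T : ℝ} (hT : 0 < T)
    {σ : ℝ} (hσ : 0 < σ) {F : (ℝ × ℝ) × ℝ × ℝ → ℝ}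
    (hF : ∀ x ∈ O, ∀ s ∈ Set.Ioo (-σ) σ, ∀ τ, AnalyticAt ℝ F (x, s, τ))
    (hper : ∀ x ∈ O, ∀ s ∈ Set.Ioo (-σ) σ, ∀ τ, F (x, s, τ + T) = F (x, s, τ))
    (heq : ∀ x ∈ O, ∀ s ∈ Set.Ioo (-σ) σ, ∀ τ,
      fderiv ℝ F (x, s, τ) (JDH H x + s • g (x, τ), 0, 1) = 0) :
    ∀ x ∈ O, ∀ s ∈ Set.Ioo (-σ) σ, ∀ τ v, fderiv ℝ F (x, s, τ) (v, 0, 0) = 0 := by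
  obtain ⟨lam, ξ, η, e₁, e₂, hs⟩ := hc.saddle
  have h0σ : (0 : ℝ) ∈ Set.Ioo (-σ) σ := by simp [hσ]
  have hσn : Set.Ioo (-σ) σ ∈ 𝓝 (0 : ℝ) := Ioo_mem_nhds (by linarith) hσ
  have hF0 : ∀ x ∈ O, ∀ τ, AnalyticAt ℝ F (x, 0, τ) := fun x hx τ => hF x hx 0 h0σ τ
  have hG : ∀ k, ∀ x ∈ O, ∀ τ, AnalyticAt ℝ (taylorCoeff F k) (x, τ) := fun k x hx τ =>
    analyticAt_taylorCoeff (hF0 x hx τ) k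
  have hGper : ∀ k, ∀ x ∈ O, ∀ τ, taylorCoeff F k (x, τ + T) = taylorCoeff F k (x, τ) :=
    fun k x hx τ => taylorCoeff_periodic (hF0 x hx)
      (Filter.mem_of_superset hσn fun s hs => hper x hx s hs τ) k
  have hT' : ∀ x ∈ O, ∀ τ, _ := fun x hx τ =>
    taylorCoeff_transport (L := 0) (M := 0) (w := g (x, τ)) (v := JDH H x) (hF0 x hx τ)
      (Filter.mem_of_superset hσn fun s hs => by simpa using heq x hx s hs τ)
  have key : ∀ k, (∀ x ∈ O, ∀ τ, fderiv ℝ (taylorCoeff F k) (x, τ) (JDH H x, 1) = 0) →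
      ∀ x ∈ O, ∀ τ v, fderiv ℝ (taylorCoeff F k) (x, τ) (v, 0) = 0 := by
    intro k hk
    have hind := hs.dirDeriv_time_eq_zero (N := fun _ => (0 : ℝ →L[ℝ] ℝ)) analyticAt_const
      (SaddlePoint.transportOps_zero_base hs.apply_eq_zero) hO.isOpen hO.preconnected hO.mem hT
      (hG k) (hGper k) (fun x hx τ => by simp [hk x hx τ])
    have hsl := fun x hx τ => fderiv_slice_eq (x := x) hO.isOpen (hG k) hind hx τ
    set b : ℝ × ℝ → ℝ := fun y => taylorCoeff F k (y, 0) with hb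
    have hba : AnalyticOnNhd ℝ b O := fun x hx =>
      AnalyticAt.comp (g := taylorCoeff F k) (hG k x hx 0) (by fun_prop)
    have hbf : ∀ x ∈ O, fderiv ℝ b x (JDH H x) = 0 := fun x hx => by
      have e := hk x hx 0
      have : ((JDH H x, 1) : (ℝ × ℝ) × ℝ) = (JDH H x, 0) + (0, 1) := by simp
      rw [this, map_add, hsl x hx 0] at e
      have e' : fderiv ℝ (taylorCoeff F k) (x, 0) (0, 1) = 0 := hind x hx 0
      rwa [e', add_zero] at e
    obtain ⟨φ, O', hO'O, hO', hφ, hbφ⟩ := hc.exists_eq_comp hO hba hbf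
    have hbd : ∀ x ∈ O', ∀ v, fderiv ℝ b x v = deriv φ (H x) * fderiv ℝ H x v := fun x hx v => by
      have h1 : b =ᶠ[𝓝 x] φ ∘ H := by
        filter_upwards [hO'.isOpen.mem_nhds hx] with y hy using hbφ y hy
      rw [h1.fderiv_eq, ((hφ x hx).differentiableAt.hasDerivAt.comp_hasFDerivAt x
        (hc.analytic x trivial).differentiableAt.hasFDerivAt).fderiv]
      simp
    have hforce := hc.eventually_eq_zero_of_forcing hO' hg hT
      (Z := fun z => -((k : ℝ) + 1)⁻¹ * taylorCoeff F (k + 1) z) (β := fun x => deriv φ (H x))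
      (X := fun _ => 0) (χ := fun _ => 0) (β₀ := deriv φ)
      (fun x hx τ => analyticAt_const.mul (hG (k + 1) x (hO'O hx) τ))
      (fun x hx τ => by rw [hGper (k + 1) x (hO'O hx)])
      (fun x hx => AnalyticAt.comp (g := deriv φ) (hφ x hx).deriv (hc.analytic x trivial))
      (fun x _ => analyticAt_const)
      (fun x hx τ => by
        rw [fderiv_const_mul (hG (k + 1) x (hO'O hx) τ).differentiableAt]
        have h2 := (hT' x (hO'O hx) τ).2 k
        simp only [zero_apply, add_zero, hsl x (hO'O hx) τ, hbd x hx] at h2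
        have h3 := eq_neg_of_add_eq_zero_left h2
        have hk1 : (k : ℝ) + 1 ≠ 0 := by positivity
        simp only [smul_apply, smul_eq_mul, h3, map_zero, add_zero]
        field_simp)
      (fun x hx => by
        have h4 := ((hφ x hx).deriv.differentiableAt.hasDerivAt.comp_hasFDerivAt x
          (hc.analytic x trivial).differentiableAt.hasFDerivAt).fderiv
        change fderiv ℝ (deriv φ ∘ H) x _ = 0
        rw [h4]
        simp [fderiv_apply_JDH])
      (fun x _ => by simp)
      analyticAt_const rfl (Eventually.of_forall fun _ => rfl)
      (Eventually.of_forall fun x => by simp) (Eventually.of_forall fun e => by simp)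
    have h0 := hO.orbit_mem 0
    have hbz : ∀ x ∈ O, ∀ v, fderiv ℝ b x v = 0 := by
      intro x hx v
      have han : AnalyticOnNhd ℝ (fun x => fderiv ℝ b x v) O := fun x hx =>
        (hba x hx).fderiv.clm_apply_fun analyticAt_const
      refine han.eqOn_zero_of_preconnected_of_eventuallyEq_zero hO.preconnected h0 ?_ hx
      filter_upwards [hO'.isOpen.mem_nhds (hO'.orbit_mem 0),
        (hc.analytic (γ 0) trivial).continuousAt.eventually hforce.1] with y hy hy'
      simp [hbd y hy, hy']
    intro x hx τ v
    rw [hsl x hx τ, hbz x hx]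
  have hall : ∀ k, ∀ x ∈ O, ∀ τ v, fderiv ℝ (taylorCoeff F k) (x, τ) (v, 0) = 0 := by
    intro k
    induction k with
    | zero => exact key 0 fun x hx τ => by simpa using (hT' x hx τ).1
    | succ k ih =>
      refine key (k + 1) fun x hx τ => ?_
      have := (hT' x hx τ).2 k
      simpa [ih x hx τ] using this
  intro x hx s hs τ v
  refine eq_zero_of_taylorCoeff_eq_zero (F := dirDeriv (v, 0, 0) F)
    (convex_Ioo (-σ) σ).isPreconnected h0σ
    (fun s hs => (hF x hx s hs τ).dirDeriv _) (fun k => ?_) s hs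
  rw [taylorCoeff_dirDeriv (hF0 x hx τ)]
  exact hall k x hx τ v

end SaddleConnection

namespace SaddleConnection
variable {H : ℝ × ℝ → ℝ} {γ : ℝ → ℝ × ℝ} {p p' : ℝ × ℝ} {O : Set (ℝ × ℝ)}
  {g : (ℝ × ℝ) × ℝ → ℝ × ℝ}

/-- Along a perturbation with nonvanishing Melnikov integral, a time-periodic infinitesimal
symmetry tangent to the position space vanishes. -/
theorem symmetry_eq_zero (hc : SaddleConnection H γ p p')
    (hO : ConnectionNhd γ p p' O) (hg : MelnikovForcing H γ p p' g) {T : ℝ} (hT : 0 < T)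
    {σ : ℝ} (hσ : 0 < σ) {X : (ℝ × ℝ) × ℝ × ℝ → ℝ × ℝ}
    (hX : ∀ x ∈ O, ∀ s ∈ Set.Ioo (-σ) σ, ∀ τ, AnalyticAt ℝ X (x, s, τ))
    (hper : ∀ x ∈ O, ∀ s ∈ Set.Ioo (-σ) σ, ∀ τ, X (x, s, τ + T) = X (x, s, τ))
    (heq : ∀ x ∈ O, ∀ s ∈ Set.Ioo (-σ) σ, ∀ τ,
      fderiv ℝ X (x, s, τ) (JDH H x + s • g (x, τ), 0, 1)
        = fderiv ℝ (JDH H) x (X (x, s, τ)) + s • fderiv ℝ (fun y => g (y, τ)) x (X (x, s, τ))) :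
    ∀ x ∈ O, ∀ s ∈ Set.Ioo (-σ) σ, ∀ τ, X (x, s, τ) = 0 := by
  obtain ⟨lam, ξ, η, e₁, e₂, hs⟩ := hc.saddle
  have h0σ : (0 : ℝ) ∈ Set.Ioo (-σ) σ := by simp [hσ]
  have hσn : Set.Ioo (-σ) σ ∈ 𝓝 (0 : ℝ) := Ioo_mem_nhds (by linarith) hσ
  have hX0 : ∀ x ∈ O, ∀ τ, AnalyticAt ℝ X (x, 0, τ) := fun x hx τ => hX x hx 0 h0σ τ
  have hG : ∀ k, ∀ x ∈ O, ∀ τ, AnalyticAt ℝ (taylorCoeff X k) (x, τ) := fun k x hx τ =>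
    analyticAt_taylorCoeff (hX0 x hx τ) k
  have hGper : ∀ k, ∀ x ∈ O, ∀ τ, taylorCoeff X k (x, τ + T) = taylorCoeff X k (x, τ) :=
    fun k x hx τ => taylorCoeff_periodic (hX0 x hx)
      (Filter.mem_of_superset hσn fun s hs => hper x hx s hs τ) k
  have hT' : ∀ x ∈ O, ∀ τ, _ := fun x hx τ =>
    taylorCoeff_transport (L := -fderiv ℝ (JDH H) x) (M := -fderiv ℝ (fun y => g (y, τ)) x)
      (w := g (x, τ)) (v := JDH H x) (hX0 x hx τ)
      (Filter.mem_of_superset hσn fun s hs => by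
        have := heq x hx s hs τ
        simp only [Set.mem_ofPred_eq, this, neg_apply]
        module)
  have hHa : ∀ x, AnalyticAt ℝ H x := fun x => hc.analytic x trivial
  have hJ : ∀ x, AnalyticAt ℝ (JDH H) x := fun x => analyticAt_JDH (hHa x)
  have hDJ : ∀ x v, fderiv ℝ (fun y => fderiv ℝ H y (JDH H y)) x v = 0 := fun x v => by
    simp [fderiv_apply_JDH]
  have key : ∀ k, (∀ x ∈ O, ∀ τ, fderiv ℝ (taylorCoeff X k) (x, τ) (JDH H x, 1)
      = fderiv ℝ (JDH H) x (taylorCoeff X k (x, τ))) →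
      ∀ x ∈ O, ∀ τ, taylorCoeff X k (x, τ) = 0 := by
    intro k hk
    have hind := hs.dirDeriv_time_eq_zero (N := fun x => -fderiv ℝ (JDH H) x) (hJ p).fderiv.neg
      (SaddlePoint.transportOps_neg_fderiv_base hs) hO.isOpen hO.preconnected hO.mem hT
      (hG k) (hGper k) (fun x hx τ => by simp [hk x hx τ])
    have hsl := fun x hx τ => fderiv_slice_eq (x := x) hO.isOpen (hG k) hind hx τ
    have hsl0 := fun x hx τ => slice_eq (x := x) (hG k x hx) (hind x hx) τ
    set W : ℝ × ℝ → ℝ × ℝ := fun y => taylorCoeff X k (y, 0) with hW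
    have hWa : AnalyticOnNhd ℝ W O := fun x hx =>
      AnalyticAt.comp (g := taylorCoeff X k) (hG k x hx 0) (by fun_prop)
    have hWf : ∀ x ∈ O, fderiv ℝ W x (JDH H x) = fderiv ℝ (JDH H) x (W x) := fun x hx => by
      have e := hk x hx 0
      have : ((JDH H x, 1) : (ℝ × ℝ) × ℝ) = (JDH H x, 0) + (0, 1) := by simp
      rw [this, map_add, hsl x hx 0] at e
      have e' : fderiv ℝ (taylorCoeff X k) (x, 0) (0, 1) = 0 := hind x hx 0
      rwa [e', add_zero] at e
    set b : ℝ × ℝ → ℝ := fun y => fderiv ℝ H y (W y) with hb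
    have hba : AnalyticOnNhd ℝ b O := fun x hx => (hHa x).fderiv.clm_apply_fun (hWa x hx)
    have hbf : ∀ x ∈ O, fderiv ℝ b x (JDH H x) = 0 := fun x hx => by
      rw [hb, fderiv_fderiv_apply_comm (hHa x) (hWa x hx).differentiableAt
        (hJ x).differentiableAt (hWf x hx), hDJ]
    obtain ⟨φ, O', hO'O, hO', hφ, hbφ⟩ := hc.exists_eq_comp hO hba hbf
    have hbd : ∀ x ∈ O', ∀ v, fderiv ℝ b x v = deriv φ (H x) * fderiv ℝ H x v := fun x hx v => by
      have h1 : b =ᶠ[𝓝 x] φ ∘ H := by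
        filter_upwards [hO'.isOpen.mem_nhds hx] with y hy using hbφ y hy
      rw [h1.fderiv_eq, ((hφ x hx).differentiableAt.hasDerivAt.comp_hasFDerivAt x
        (hHa x).differentiableAt.hasFDerivAt).fderiv]
      simp
    have hφ0 : φ (H (γ 0)) = 0 := by
      rw [← hc.energy_limit, ← hbφ p hO'.mem, hb]
      exact SaddleConnection.fderiv_eq_zero_of_JDH hc.apply_eq_zero _
    have hφa : AnalyticAt ℝ φ (H (γ 0)) := hφ _ (hO'.orbit_mem 0)
    have hforce := hc.eventually_eq_zero_of_forcing hO' hg hT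
      (Z := fun z => -((k : ℝ) + 1)⁻¹ * fderiv ℝ H z.1 (taylorCoeff X (k + 1) z))
      (β := fun x => deriv φ (H x)) (X := fun x => -W x) (χ := fun e => -φ e) (β₀ := deriv φ)
      (fun x hx τ => analyticAt_const.mul (AnalyticAt.clm_apply_fun
        (AnalyticAt.comp (g := fderiv ℝ H) (f := Prod.fst) (hHa x).fderiv analyticAt_fst)
        (hG (k + 1) x (hO'O hx) τ)))
      (fun x hx τ => by rw [hGper (k + 1) x (hO'O hx)])
      (fun x hx => AnalyticAt.comp (g := deriv φ) (hφ x hx).deriv (hHa x))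
      (fun x hx => (hWa x (hO'O hx)).neg)
      (fun x hx τ => by
        have hxO := hO'O hx
        have hGd := (hG (k + 1) x hxO τ).differentiableAt.hasFDerivAt
        have hHd : HasFDerivAt (fun z : (ℝ × ℝ) × ℝ => fderiv ℝ H z.1)
            ((fderiv ℝ (fderiv ℝ H) x).comp (ContinuousLinearMap.fst ℝ (ℝ × ℝ) ℝ)) (x, τ) :=
          HasFDerivAt.comp (g := fderiv ℝ H) (x, τ) (hHa x).fderiv.differentiableAt.hasFDerivAt
            hasFDerivAt_fst
        rw [((hHd.clm_apply hGd).const_mul _).fderiv]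
        have h2 := (hT' x hxO τ).2 k
        have h5 : fderiv ℝ (fderiv ℝ H) x (JDH H x) (taylorCoeff X (k + 1) (x, τ))
            + fderiv ℝ H x (fderiv ℝ (JDH H) x (taylorCoeff X (k + 1) (x, τ))) = 0 := by
          rw [fderiv_fderiv_symm (hHa x), ← fderiv_fderiv_apply (hHa x) (hJ x).differentiableAt,
            hDJ]
        have h6 := hbd x hx (g (x, τ))
        rw [hb, fderiv_fderiv_apply (hHa x) (hWa x hxO).differentiableAt] at h6
        have h7 := fderiv_fderiv_apply (hHa x) (hg.analytic τ x).differentiableAt (W x)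
        rw [fderiv_fderiv_symm (hHa x)] at h7
        rw [map_neg, h7, ← h6]
        simp only [neg_apply, hsl x hxO τ, hsl0 x hxO τ] at h2
        have h3 := eq_neg_of_add_eq_zero_left h2
        rw [← sub_eq_add_neg, sub_eq_iff_eq_add] at h3
        have hk1 : (k : ℝ) + 1 ≠ 0 := by positivity
        simp only [smul_apply, add_apply, ContinuousLinearMap.comp_apply,
          ContinuousLinearMap.flip_apply, ContinuousLinearMap.coe_fst', h3, smul_eq_mul, map_add,
          map_neg, map_smul]
        field_simp
        linear_combination -h5)
      (fun x hx => by
        have h4 := ((hφ x hx).deriv.differentiableAt.hasDerivAt.comp_hasFDerivAt x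
          (hHa x).differentiableAt.hasFDerivAt).fderiv
        change fderiv ℝ (deriv φ ∘ H) x _ = 0
        rw [h4]
        simp [fderiv_apply_JDH])
      (fun x hx => by
        rw [fderiv_fun_neg, neg_apply, hWf x (hO'O hx), map_neg])
      hφa.neg (by simp [hφ0]) (Eventually.of_forall fun _ => rfl)
      (by
        filter_upwards [hO'.isOpen.mem_nhds (hO'.orbit_mem 0)] with y hy
        rw [map_neg, ← hbφ y hy])
      (Eventually.of_forall fun e => by rw [deriv.fun_neg, abs_neg])
    have hW0 : ∀ x ∈ O, W x = 0 := fun x hx => by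
      refine hWa.eqOn_zero_of_preconnected_of_eventuallyEq_zero hO.preconnected
        (hO.orbit_mem 0) ?_ hx
      filter_upwards [hforce.2] with y hy using neg_eq_zero.1 hy
    intro x hx τ
    rw [hsl0 x hx τ, ← hW0 x hx]
  have hall : ∀ k, ∀ x ∈ O, ∀ τ, taylorCoeff X k (x, τ) = 0 := by
    intro k
    induction k with
    | zero =>
      refine key 0 fun x hx τ => ?_
      have := (hT' x hx τ).1
      rwa [neg_apply, ← sub_eq_add_neg, sub_eq_zero] at this
    | succ k ih =>
      refine key (k + 1) fun x hx τ => ?_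
      have := (hT' x hx τ).2 k
      have hz : taylorCoeff X k =ᶠ[𝓝 (x, τ)] fun _ => 0 := by
        filter_upwards [(hO.isOpen.prod isOpen_univ).mem_nhds
          (Set.mk_mem_prod hx (Set.mem_univ τ))] with z hz using ih z.1 hz.1 z.2
      rw [hz.fderiv_eq, ih x hx τ] at this
      simpa [← sub_eq_add_neg, sub_eq_zero] using this
  exact fun x hx s hs τ => eq_zero_of_taylorCoeff_eq_zero (convex_Ioo (-σ) σ).isPreconnected h0σ
    (fun s hs => hX x hx s hs τ) (fun k => hall k x hx τ) s hs

end SaddleConnection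

theorem exists_saddlePoint {f : ℝ × ℝ → ℝ × ℝ} {p v w : ℝ × ℝ} {lam : ℝ}
    (hf : AnalyticAt ℝ f p) (h0 : f p = 0) (hlam : 0 < lam) (hv : v ≠ 0) (hw : w ≠ 0)
    (hev : fderiv ℝ f p v = lam • v) (hew : fderiv ℝ f p w = -lam • w) :
    ∃ ξ η, SaddlePoint f p lam ξ η v w := by
  have hind : ∀ c d : ℝ, c • v + d • w = 0 → c = 0 ∧ d = 0 := by
    intro c d h
    have h' : c • v - d • w = 0 := by
      have := congrArg (fderiv ℝ f p) h
      rw [map_add, map_smul, map_smul, hev, hew, map_zero] at this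
      have h2 : lam • (c • v - d • w) = 0 := by rw [← this]; module
      exact (smul_eq_zero.1 h2).resolve_left hlam.ne'
    constructor
    · have : (2 * c) • v = 0 := by
        calc (2 * c) • v = (c • v + d • w) + (c • v - d • w) := by module
          _ = 0 := by rw [h, h', add_zero]
      simpa [hv] using this
    · have : (2 * d) • w = 0 := by
        calc (2 * d) • w = (c • v + d • w) - (c • v - d • w) := by module
          _ = 0 := by rw [h, h', sub_zero]
      simpa [hw] using this
  have hΔ : v.1 * w.2 - v.2 * w.1 ≠ 0 := by
    intro h
    have h₁ := hind w.1 (-v.1) (Prod.ext (by simp; ring) (by simp; linarith))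
    have h₂ := hind w.2 (-v.2) (Prod.ext (by simp; linarith) (by simp; ring))
    exact hw (Prod.ext h₁.1 h₂.1)
  set Δ := v.1 * w.2 - v.2 * w.1 with hΔd
  let fst := ContinuousLinearMap.fst ℝ ℝ ℝ
  let snd := ContinuousLinearMap.snd ℝ ℝ ℝ
  let ξ : ℝ × ℝ →L[ℝ] ℝ := Δ⁻¹ • (w.2 • fst - w.1 • snd)
  let η : ℝ × ℝ →L[ℝ] ℝ := Δ⁻¹ • (v.1 • snd - v.2 • fst)
  have hξ : ∀ x : ℝ × ℝ, ξ x = Δ⁻¹ * (w.2 * x.1 - w.1 * x.2) := fun x => rfl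
  have hη : ∀ x : ℝ × ℝ, η x = Δ⁻¹ * (v.1 * x.2 - v.2 * x.1) := fun x => rfl
  have hdec : ∀ x, x = ξ x • v + η x • w := by
    intro x
    rw [hξ, hη]
    refine Prod.ext ?_ ?_
    · simp only [Prod.fst_add, Prod.smul_fst, smul_eq_mul]
      field_simp
      rw [hΔd]; ring
    · simp only [Prod.snd_add, Prod.smul_snd, smul_eq_mul]
      field_simp
      rw [hΔd]; ring
  have hfd : ∀ x, fderiv ℝ f p x = (lam * ξ x) • v + (-lam * η x) • w := by
    intro x
    conv_lhs => rw [hdec x]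
    rw [map_add, map_smul, map_smul, hev, hew]
    module
  have huniq : ∀ x, ∀ c d : ℝ, x = c • v + d • w → ξ x = c ∧ η x = d := by
    intro x c d h
    have h1 := hind (ξ x - c) (η x - d) (by
      have := (hdec x).symm.trans h
      rw [← sub_eq_zero] at this
      rw [← this]; module)
    exact ⟨sub_eq_zero.1 h1.1, sub_eq_zero.1 h1.2⟩
  exact ⟨ξ, η, hf, h0, hlam, hdec, fun x => (huniq _ _ _ (hfd x)).1,
    fun x => (huniq _ _ _ (hfd x)).2⟩

section ExpFlow
variable {Y : Type*} [NormedAddCommGroup Y] [NormedSpace ℝ Y] [CompleteSpace Y]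

/-- The flow of the linear vector field `B`. -/
noncomputable def linFlow (B : Y →L[ℝ] Y) (τ : ℝ) : Y →L[ℝ] Y := NormedSpace.exp (τ • B)

theorem linFlow_zero (B : Y →L[ℝ] Y) : linFlow B 0 = 1 := by
  simp [linFlow]

theorem hasDerivAt_linFlow (B : Y →L[ℝ] Y) (τ : ℝ) :
    HasDerivAt (linFlow B) (B * linFlow B τ) τ :=
  hasDerivAt_exp_smul_const' B τ

theorem analyticAt_linFlow (B : Y →L[ℝ] Y) (τ : ℝ) : AnalyticAt ℝ (linFlow B) τ := by
  have h := NormedSpace.exp_analytic (𝕂 := ℝ) (𝔸 := Y →L[ℝ] Y) (τ • B)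
  exact AnalyticAt.comp (f := fun τ : ℝ => τ • B) h (by fun_prop)

theorem linFlow_add (B : Y →L[ℝ] Y) (σ τ : ℝ) :
    linFlow B (σ + τ) = linFlow B σ * linFlow B τ := by
  let _ : NormedAlgebra ℚ (Y →L[ℝ] Y) := NormedAlgebra.restrictScalars ℚ ℝ _
  rw [linFlow, add_smul]
  exact NormedSpace.exp_add_of_commute (((Commute.refl B).smul_left σ).smul_right τ)

theorem linFlow_neg_apply (B : Y →L[ℝ] Y) (τ : ℝ) (y : Y) :
    linFlow B (-τ) (linFlow B τ y) = y := by
  have := linFlow_add B (-τ) τ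
  rw [neg_add_cancel, linFlow_zero] at this
  exact (DFunLike.congr_fun this y).symm

theorem linFlow_apply_neg (B : Y →L[ℝ] Y) (τ : ℝ) (y : Y) :
    linFlow B τ (linFlow B (-τ) y) = y := by
  simpa using linFlow_neg_apply B (-τ) y

theorem hasDerivAt_linFlow_apply (B : Y →L[ℝ] Y) (τ : ℝ) (y : Y) :
    HasDerivAt (fun τ => linFlow B τ y) (B (linFlow B τ y)) τ :=
  (hasDerivAt_linFlow B τ).clm_apply (hasDerivAt_const τ y) |>.congr_deriv (by simp)

/-- The linear flow commutes with its generator. -/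
theorem linFlow_apply_comm (B : Y →L[ℝ] Y) (τ : ℝ) (y : Y) :
    linFlow B τ (B y) = B (linFlow B τ y) := by
  have h := (hasDerivAt_exp_smul_const (𝕂 := ℝ) B τ).unique (hasDerivAt_exp_smul_const' B τ)
  exact DFunLike.congr_fun h y

/-- Uniqueness of solutions of the linear system generated by `B`. -/
theorem eq_linFlow_apply (B : Y →L[ℝ] Y) {r : ℝ → Y} (hr : ∀ τ, HasDerivAt r (B (r τ)) τ)
    (τ : ℝ) : r τ = linFlow B τ (r 0) := by
  have hd : ∀ τ, HasDerivAt (fun τ => linFlow B (-τ) (r τ)) 0 τ := by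
    intro τ
    have h1 : HasDerivAt (fun τ => linFlow B (-τ)) _ τ :=
      (hasDerivAt_linFlow B (-τ)).scomp τ (hasDerivAt_neg τ)
    refine (h1.clm_apply (hr τ)).congr_deriv ?_
    have : linFlow B (-τ) (B (r τ)) = B (linFlow B (-τ) (r τ)) := linFlow_apply_comm B _ _
    rw [this]
    simp
  have hc := is_const_of_deriv_eq_zero (fun τ => (hd τ).differentiableAt)
    (fun τ => (hd τ).deriv) τ 0
  simp only [neg_zero, linFlow_zero] at hc
  have := congrArg (linFlow B τ) hc
  rw [linFlow_apply_neg] at this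
  exact this

theorem linFlow_periodic {B : Y →L[ℝ] Y} {T : ℝ} (hT : linFlow B T = 1) (τ : ℝ) :
    linFlow B (τ + T) = linFlow B τ := by
  rw [linFlow_add, hT, mul_one]

theorem exists_norm_linFlow_le {B : Y →L[ℝ] Y} {T : ℝ} (hT0 : 0 < T) (hT : linFlow B T = 1) :
    ∃ C > 0, ∀ τ, ‖linFlow B τ‖ ≤ C := by
  have hcont : Continuous (linFlow B) :=
    continuous_iff_continuousAt.2 fun τ => (hasDerivAt_linFlow B τ).continuousAt
  obtain ⟨C, hC⟩ := (isCompact_Icc (a := (0 : ℝ)) (b := T)).exists_bound_of_continuousOn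
    hcont.continuousOn
  refine ⟨max C 1, by positivity, fun τ => ?_⟩
  have hp : Function.Periodic (linFlow B) T := linFlow_periodic hT
  obtain ⟨σ, hσ, he⟩ := hp.exists_mem_Ico₀ hT0 τ
  rw [he]
  exact (hC σ ⟨hσ.1, hσ.2.le⟩).trans (le_max_left _ _)

end ExpFlow

section Dependence
variable {V : Type*} [NormedAddCommGroup V] [NormedSpace ℝ V] [FiniteDimensional ℝ V]

/-- Linearly independent vectors in a finite-dimensional space have a dual family of functionals. -/
theorem LinearIndependent.exists_dual_functionals {n : ℕ} {v : Fin n → V}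
    (h : LinearIndependent ℝ v) :
    ∃ ℓ : Fin n → V →L[ℝ] ℝ, ∀ i j, ℓ i (v j) = if i = j then 1 else 0 := by
  obtain ⟨g, hg⟩ := LinearMap.exists_leftInverse_of_injective (Fintype.linearCombination ℝ v)
    (LinearMap.ker_eq_bot.2 
      (linearIndependent_iff_injective_fintypeLinearCombination.1 h))
  refine ⟨fun i => LinearMap.toContinuousLinearMap (LinearMap.proj i ∘ₗ g), fun i j => ?_⟩
  have := DFunLike.congr_fun hg (Pi.single j 1)
  simp only [LinearMap.comp_apply, Fintype.linearCombination_apply_single, one_smul,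
    LinearMap.id_apply] at this
  change g (v j) i = _
  rw [this, Pi.single_apply]

/-- An analytic family of vectors that is everywhere linearly dependent admits an analytic linear
relation. -/
theorem exists_analytic_relation {J : Set ℝ} (hJ : IsOpen J) (hJc : IsPreconnected J) {n : ℕ}
    {δ : Fin n → ℝ → V} (hδ : ∀ i, AnalyticOnNhd ℝ (δ i) J)
    (hdep : ∀ s ∈ J, ¬ LinearIndependent ℝ (fun i => δ i s)) (hne : J.Nonempty) :
    ∃ c : Fin n → ℝ → ℝ, (∀ i, AnalyticOnNhd ℝ (c i) J) ∧
      (∀ s ∈ J, ∑ i, c i s • δ i s = 0) ∧ ∃ i, ∃ s ∈ J, c i s ≠ 0 := by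
  induction n with
  | zero =>
    obtain ⟨s, hs⟩ := hne
    exact absurd linearIndependent_empty_type (hdep s hs)
  | succ n ih =>
    by_cases hinit : ∀ s ∈ J, ¬ LinearIndependent ℝ (fun i : Fin n => δ i.castSucc s)
    · obtain ⟨c, hc, hsum, i, s, hs, hne⟩ := ih (fun i => hδ i.castSucc) hinit
      refine ⟨Fin.snoc (α := fun _ => ℝ → ℝ) c (fun _ => 0), fun i => ?_, fun s hs => ?_,
        i.castSucc, s, hs, by simpa using hne⟩
      · refine Fin.lastCases ?_ (fun i => ?_) i
        · simpa using analyticOnNhd_const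
        · simpa using hc i
      · rw [Fin.sum_univ_castSucc]
        simpa using hsum s hs
    · push Not at hinit
      obtain ⟨s₀, hs₀, hind⟩ := hinit
      obtain ⟨ℓ, hℓ⟩ := hind.exists_dual_functionals
      let M : ℝ → Matrix (Fin n) (Fin n) ℝ := fun s => Matrix.of fun a i => ℓ a (δ i.castSucc s)
      let w : ℝ → Fin n → ℝ := fun s a => ℓ a (δ (Fin.last n) s)
      have hM₀ : M s₀ = 1 := by
        ext a i
        simp [M, hℓ, Matrix.one_apply]
      have hdet : ∀ (B : ℝ → Matrix (Fin n) (Fin n) ℝ),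
          (∀ a i, AnalyticOnNhd ℝ (fun s => B s a i) J) → AnalyticOnNhd ℝ (fun s => (B s).det) J := by
        intro B hB s hs
        simp only [Matrix.det_apply']
        refine Finset.analyticAt_fun_sum _ fun σ _ => ?_
        exact analyticAt_const.mul (Finset.analyticAt_fun_prod _ fun i _ => hB _ _ s hs)
      have hMa : ∀ a i, AnalyticOnNhd ℝ (fun s => M s a i) J := fun a i s hs =>
        AnalyticAt.comp (g := ℓ a) (f := δ i.castSucc) ((ℓ a).analyticAt _) (hδ _ s hs)
      have hwa : ∀ a, AnalyticOnNhd ℝ (fun s => w s a) J := fun a s hs =>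
        AnalyticAt.comp (g := ℓ a) (f := δ (Fin.last n)) ((ℓ a).analyticAt _) (hδ _ s hs)
      let c : Fin (n + 1) → ℝ → ℝ := Fin.snoc (α := fun _ => ℝ → ℝ)
        (fun i s => -(M s).cramer (w s) i) (fun s => (M s).det)
      have hcl : ∀ s, c (Fin.last n) s = (M s).det := fun s => by simp [c]
      have hci : ∀ i : Fin n, ∀ s, c i.castSucc s = -(M s).cramer (w s) i := fun i s => by simp [c]
      have hca : ∀ i, AnalyticOnNhd ℝ (c i) J := by
        intro i
        refine Fin.lastCases ?_ (fun i => ?_) i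
        · rw [show c (Fin.last n) = fun s => (M s).det from funext hcl]
          exact hdet M hMa
        · rw [show c i.castSucc = fun s => -((M s).updateCol i (w s)).det from
            funext fun s => by rw [hci, Matrix.cramer_apply]]
          refine AnalyticOnNhd.neg (hdet _ fun a k => ?_)
          by_cases hk : k = i
          · subst hk; simpa [Matrix.updateCol_apply] using hwa a
          · simpa [Matrix.updateCol_apply, hk] using hMa a k
      have hra : AnalyticOnNhd ℝ (fun s => ∑ i, c i s • δ i s) J := fun s hs =>
        Finset.analyticAt_fun_sum _ fun i _ => (hca i s hs).smul (hδ i s hs)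
      have hzero : ∀ s ∈ J, ∀ a, ℓ a (∑ i, c i s • δ i s) = 0 := by
        intro s hs a
        rw [map_sum, Fin.sum_univ_castSucc]
        simp only [map_smul, hcl, hci, smul_eq_mul]
        have := congrFun (Matrix.mulVec_cramer (M s) (w s)) a
        simp only [Matrix.mulVec, dotProduct, Pi.smul_apply, smul_eq_mul] at this
        have h2 : ∑ i, -(M s).cramer (w s) i * ℓ a (δ i.castSucc s)
            = -∑ i, M s a i * (M s).cramer (w s) i := by
          rw [← Finset.sum_neg_distrib]
          exact Finset.sum_congr rfl fun i _ => by simp only [M, Matrix.of_apply]; ring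
        rw [h2, this]
        simp only [w]; ring
      have hnear : ∀ᶠ s in 𝓝 s₀, ∑ i, c i s • δ i s = 0 := by
        have hd : ∀ᶠ s in 𝓝 s₀, (M s).det ≠ 0 :=
          (hdet M hMa s₀ hs₀).continuousAt.eventually_ne (by rw [hM₀]; simp)
        filter_upwards [hd, hJ.mem_nhds hs₀] with s hds hs
        have hkill : ∀ e : Fin n → ℝ, (∀ a, ℓ a (∑ i, e i • δ i.castSucc s) = 0) → e = 0 := by
          intro e he
          refine Matrix.eq_zero_of_mulVec_eq_zero hds ?_
          ext a
          have := he a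
          simp only [map_sum, map_smul, smul_eq_mul] at this
          simp only [Matrix.mulVec, dotProduct, M, Matrix.of_apply, Pi.zero_apply]
          rw [← this]
          exact Finset.sum_congr rfl fun i _ => mul_comm _ _
        have hli : LinearIndependent ℝ (fun i : Fin n => δ i.castSucc s) := by
          rw [Fintype.linearIndependent_iff]
          intro e he
          exact congrFun (hkill e fun a => by rw [he, map_zero])
        have hmem : δ (Fin.last n) s ∈
            Submodule.span ℝ (Set.range fun i : Fin n => δ i.castSucc s) := by
          by_contra hmem
          refine hdep s hs ?_
          rw [linearIndependent_finSucc']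
          exact ⟨hli, hmem⟩
        obtain ⟨e, he⟩ := (Submodule.mem_span_range_iff_exists_fun ℝ).1 hmem
        have hsum : ∑ i, c i s • δ i s
            = ∑ i : Fin n, (c i.castSucc s + c (Fin.last n) s * e i) • δ i.castSucc s := by
          rw [Fin.sum_univ_castSucc, ← he, Finset.smul_sum, ← Finset.sum_add_distrib]
          exact Finset.sum_congr rfl fun i _ => by rw [add_smul, mul_smul]
        have := hkill _ fun a => by rw [← hsum]; exact hzero s hs a
        rw [hsum]
        exact Finset.sum_eq_zero fun i _ => by rw [congrFun this i]; simp
      exact ⟨c, hca, hra.eqOn_zero_of_preconnected_of_eventuallyEq_zero hJc hs₀ hnear,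
        Fin.last n, s₀, hs₀, by rw [hcl, hM₀]; simp⟩

/-- A linearly independent family annihilated by a linearly independent family of functionals. -/
theorem card_add_card_le_of_annihilates {q m : ℕ} {d : Fin q → V} {φ : Fin m → V →L[ℝ] ℝ}
    (hd : LinearIndependent ℝ d) (hφ : LinearIndependent ℝ φ) (h : ∀ k j, φ k (d j) = 0) :
    q + m ≤ Module.finrank ℝ V := by
  set W := Submodule.span ℝ (Set.range d) with hW
  have hφ' : LinearIndependent ℝ (fun k => ((φ k : V →L[ℝ] ℝ) : V →ₗ[ℝ] ℝ)) := by
    have := hφ.map' (ContinuousLinearMap.coeLM ℝ : (V →L[ℝ] ℝ) →ₗ[ℝ] V →ₗ[ℝ] ℝ)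
      (LinearMap.ker_eq_bot.2 ContinuousLinearMap.coe_injective)
    exact this
  have h1 : Submodule.span ℝ (Set.range fun k => ((φ k : V →L[ℝ] ℝ) : V →ₗ[ℝ] ℝ))
      ≤ W.dualAnnihilator := by
    rw [Submodule.span_le]
    rintro _ ⟨k, rfl⟩
    rw [SetLike.mem_coe, Submodule.mem_dualAnnihilator]
    intro w hw
    have : W ≤ LinearMap.ker ((φ k : V →L[ℝ] ℝ) : V →ₗ[ℝ] ℝ) := by
      rw [hW, Submodule.span_le]
      rintro _ ⟨j, rfl⟩
      exact h k j
    exact this hw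
  have h2 := Submodule.finrank_mono h1
  rw [finrank_span_eq_card hφ', Fintype.card_fin] at h2
  have h3 : Module.finrank ℝ W = q := by rw [hW, finrank_span_eq_card hd, Fintype.card_fin]
  have h4 := Subspace.finrank_add_finrank_dualAnnihilator_eq W
  rw [h3] at h4
  refine le_trans (Nat.add_le_add_left h2 q) h4.le

end Dependence

section Suspension
variable {Y : Type*} [NormedAddCommGroup Y] [NormedSpace ℝ Y] [CompleteSpace Y]
  {V : Type*} [NormedAddCommGroup V] [NormedSpace ℝ V] [CompleteSpace V]

/-- The autonomous system `ẋ = JDH(x) + A(x) y`, `ẏ = B y`. -/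
noncomputable def suspendedField (H : ℝ × ℝ → ℝ) (A : ℝ × ℝ → Y →L[ℝ] ℝ × ℝ) (B : Y →L[ℝ] Y)
    (z : (ℝ × ℝ) × Y) : (ℝ × ℝ) × Y :=
  (JDH H z.1 + A z.1 z.2, B z.2)

/-- The map `(x, s, τ) ↦ (x, s e^{τB} y)` into the phase space of the autonomous system. -/
noncomputable def suspension (B : Y →L[ℝ] Y) (y : Y) (w : (ℝ × ℝ) × ℝ × ℝ) : (ℝ × ℝ) × Y :=
  (w.1, w.2.1 • linFlow B w.2.2 y)

theorem analyticAt_linFlow_comp {E : Type*} [NormedAddCommGroup E] [NormedSpace ℝ E]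
    (B : Y →L[ℝ] Y) {r : E → ℝ} {e : E} (hr : AnalyticAt ℝ r e) :
    AnalyticAt ℝ (fun e => linFlow B (r e)) e :=
  AnalyticAt.comp (g := linFlow B) (f := r) (analyticAt_linFlow B _) hr

theorem analyticAt_suspension (B : Y →L[ℝ] Y) (y : Y) (w : (ℝ × ℝ) × ℝ × ℝ) :
    AnalyticAt ℝ (suspension B y) w := by
  have h₁ : AnalyticAt ℝ (fun w : (ℝ × ℝ) × ℝ × ℝ => w.2.1) w :=
    analyticAt_fst.comp analyticAt_snd
  have h₂ : AnalyticAt ℝ (fun w : (ℝ × ℝ) × ℝ × ℝ => w.2.2) w :=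
    analyticAt_snd.comp analyticAt_snd
  exact analyticAt_fst.prod
    (h₁.smul (AnalyticAt.clm_apply_fun (analyticAt_linFlow_comp B h₂) analyticAt_const))

theorem fderiv_suspension (B : Y →L[ℝ] Y) (y : Y) (x v : ℝ × ℝ) (s τ κ : ℝ) :
    fderiv ℝ (suspension B y) (x, s, τ) (v, 0, κ) = (v, κ • B (s • linFlow B τ y)) := by
  have h₁ : HasFDerivAt (fun w : (ℝ × ℝ) × ℝ × ℝ => w.2.1) _ (x, s, τ) :=
    ((ContinuousLinearMap.fst ℝ ℝ ℝ).comp (ContinuousLinearMap.snd ℝ (ℝ × ℝ) (ℝ × ℝ))).hasFDerivAt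
  have h₂ : HasFDerivAt (fun w : (ℝ × ℝ) × ℝ × ℝ => w.2.2) _ (x, s, τ) :=
    ((ContinuousLinearMap.snd ℝ ℝ ℝ).comp (ContinuousLinearMap.snd ℝ (ℝ × ℝ) (ℝ × ℝ))).hasFDerivAt
  have h₃ := (hasDerivAt_linFlow_apply B τ y).hasFDerivAt.comp (x, s, τ) h₂
  have h : HasFDerivAt (suspension B y) _ (x, s, τ) := hasFDerivAt_fst.prodMk (h₁.smul h₃)
  rw [h.fderiv]
  refine Prod.ext rfl ?_
  simp [smul_smul, mul_comm]

variable {H : ℝ × ℝ → ℝ} {γ : ℝ → ℝ × ℝ} {p p' : ℝ × ℝ} {O : Set (ℝ × ℝ)}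
  {A : ℝ × ℝ → Y →L[ℝ] ℝ × ℝ} {B : Y →L[ℝ] Y} {y : Y}

theorem suspendedField_suspension (x : ℝ × ℝ) (s τ : ℝ) :
    suspendedField H A B (suspension B y (x, s, τ))
      = fderiv ℝ (suspension B y) (x, s, τ) (JDH H x + s • A x (linFlow B τ y), 0, 1) := by
  rw [fderiv_suspension, one_smul]
  simp [suspendedField, suspension]

theorem fderiv_comp_suspension {φ : (ℝ × ℝ) × Y → V} {w : (ℝ × ℝ) × ℝ × ℝ}
    (hφ : AnalyticAt ℝ φ (suspension B y w)) (e : (ℝ × ℝ) × ℝ × ℝ) :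
    fderiv ℝ (fun w => φ (suspension B y w)) w e
      = fderiv ℝ φ (suspension B y w) (fderiv ℝ (suspension B y) w e) := by
  have := (hφ.differentiableAt.hasFDerivAt.comp w
    (analyticAt_suspension B y w).differentiableAt.hasFDerivAt).fderiv
  change fderiv ℝ (φ ∘ suspension B y) w e = _
  rw [this]
  rfl

/-- A quantity evolving linearly along the autonomous system, with the period of the forcing, does
not depend on the position and is equivariant under the rotation of the forcing phases. -/
theorem SaddleConnection.equivariant (hc : SaddleConnection H γ p p')
    (hO : ConnectionNhd γ p p' O)
    (hg : MelnikovForcing H γ p p' (fun w => A w.1 (linFlow B w.2 y)))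
    {T : ℝ} (hT₀ : 0 < T) (hT : linFlow B T = 1) {C : V →L[ℝ] V} (hC : linFlow C T = 1)
    {φ : (ℝ × ℝ) × Y → V}
    (hφ : ∀ x ∈ O, ∀ s ∈ Set.Ioo (-2 : ℝ) 2, ∀ τ, AnalyticAt ℝ φ (suspension B y (x, s, τ)))
    (heq : ∀ x ∈ O, ∀ s ∈ Set.Ioo (-2 : ℝ) 2, ∀ τ,
      fderiv ℝ φ (suspension B y (x, s, τ)) (suspendedField H A B (suspension B y (x, s, τ)))
        = C (φ (suspension B y (x, s, τ)))) :
    (∀ x ∈ O, ∀ s ∈ Set.Ioo (-2 : ℝ) 2, ∀ τ v,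
      fderiv ℝ φ (suspension B y (x, s, τ)) (v, 0) = 0) ∧
    (∀ x ∈ O, ∀ s ∈ Set.Ioo (-2 : ℝ) 2, ∀ τ,
      φ (suspension B y (x, s, τ)) = linFlow C τ (φ (x, s • y))) := by
  set D : (ℝ × ℝ) × ℝ × ℝ → V := fun w => linFlow C (-w.2.2) (φ (suspension B y w)) with hD
  have hφc : ∀ x ∈ O, ∀ s ∈ Set.Ioo (-2 : ℝ) 2, ∀ τ,
      AnalyticAt ℝ (fun w => φ (suspension B y w)) (x, s, τ) := fun x hx s hs τ =>
    AnalyticAt.comp (g := φ) (f := suspension B y) (hφ x hx s hs τ) (analyticAt_suspension B y _)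
  have hDa : ∀ x ∈ O, ∀ s ∈ Set.Ioo (-2 : ℝ) 2, ∀ τ, AnalyticAt ℝ D (x, s, τ) :=
    fun x hx s hs τ => by
      have h₂ : AnalyticAt ℝ (fun w : (ℝ × ℝ) × ℝ × ℝ => -w.2.2) (x, s, τ) :=
        (analyticAt_snd.comp analyticAt_snd).neg
      exact AnalyticAt.clm_apply_fun (analyticAt_linFlow_comp C h₂) (hφc x hx s hs τ)
  have hDd : ∀ x ∈ O, ∀ s ∈ Set.Ioo (-2 : ℝ) 2, ∀ τ e,
      fderiv ℝ D (x, s, τ) e = linFlow C (-τ)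
        (fderiv ℝ φ (suspension B y (x, s, τ)) (fderiv ℝ (suspension B y) (x, s, τ) e))
        - e.2.2 • linFlow C (-τ) (C (φ (suspension B y (x, s, τ)))) := by
    intro x hx s hs τ e
    have h₂ : HasFDerivAt (fun w : (ℝ × ℝ) × ℝ × ℝ => -w.2.2) _ (x, s, τ) :=
      ((ContinuousLinearMap.snd ℝ ℝ ℝ).comp (ContinuousLinearMap.snd ℝ (ℝ × ℝ) (ℝ × ℝ)))
        |>.hasFDerivAt.neg
    have h₃ : HasFDerivAt (fun w : (ℝ × ℝ) × ℝ × ℝ => linFlow C (-w.2.2)) _ (x, s, τ) :=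
      HasFDerivAt.comp (g := linFlow C) (x, s, τ) (hasDerivAt_linFlow C (-τ)).hasFDerivAt h₂
    have h := h₃.clm_apply (hφc x hx s hs τ).differentiableAt.hasFDerivAt
    rw [h.fderiv, linFlow_apply_comm]
    simp [fderiv_comp_suspension (hφ x hx s hs τ), sub_eq_add_neg]
  have hDt : ∀ x ∈ O, ∀ s ∈ Set.Ioo (-2 : ℝ) 2, ∀ τ,
      fderiv ℝ D (x, s, τ) (JDH H x + s • A x (linFlow B τ y), 0, 1) = 0 := by
    intro x hx s hs τ
    rw [hDd x hx s hs τ, ← suspendedField_suspension, heq x hx s hs τ]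
    simp
  have hDs : ∀ x ∈ O, ∀ s ∈ Set.Ioo (-2 : ℝ) 2, ∀ τ v, fderiv ℝ D (x, s, τ) (v, 0, 0) = 0 := by
    intro x hx s hs τ v
    refine SeparatingDual.eq_zero_of_forall_dual_eq_zero (R := ℝ) fun ℓ => ?_
    have hℓ : ∀ x ∈ O, ∀ s ∈ Set.Ioo (-2 : ℝ) 2, ∀ τ e,
        fderiv ℝ (fun w => ℓ (D w)) (x, s, τ) e = ℓ (fderiv ℝ D (x, s, τ) e) := by
      intro x hx s hs τ e
      have := (ℓ.hasFDerivAt.comp (x, s, τ) (hDa x hx s hs τ).differentiableAt.hasFDerivAt).fderiv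
      change fderiv ℝ (ℓ ∘ D) _ e = _
      rw [this]
      rfl
    rw [← hℓ x hx s hs τ]
    refine hc.dirDeriv_space_eq_zero hO hg hT₀ two_pos (F := fun w => ℓ (D w))
      (fun x hx s hs τ => AnalyticAt.comp (g := ℓ) (f := D) (ℓ.analyticAt _) (hDa x hx s hs τ))
      (fun x hx s hs τ => ?_) (fun x hx s hs τ => ?_) x hx s hs τ v
    · have h1 : linFlow C (-(τ + T)) = linFlow C (-τ) := by
        rw [← linFlow_periodic hC (-(τ + T))]; congr 1; ring
      simp only [hD, suspension, linFlow_periodic hT, h1]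
    · rw [hℓ x hx s hs τ, hDt x hx s hs τ, map_zero]
  refine ⟨fun x hx s hs τ v => ?_, fun x hx s hs τ => ?_⟩
  · have h := hDs x hx s hs τ v
    rw [hDd x hx s hs τ, fderiv_suspension] at h
    simp only [zero_smul, sub_zero] at h
    have h' := congrArg (linFlow C τ) h
    rwa [linFlow_apply_neg, map_zero] at h'
  · have hd : ∀ τ, HasDerivAt (fun τ => D (x, s, τ)) 0 τ := by
      intro τ
      have hl : HasDerivAt (fun τ : ℝ => (x, s, τ)) ((0 : ℝ × ℝ), (0 : ℝ), (1 : ℝ)) τ :=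
        (hasDerivAt_const τ x).prodMk ((hasDerivAt_const τ s).prodMk (hasDerivAt_id τ))
      have h := (hDa x hx s hs τ).differentiableAt.hasFDerivAt.comp_hasDerivAt τ hl
      refine h.congr_deriv ?_
      have e : ((0 : ℝ × ℝ), (0 : ℝ), (1 : ℝ))
          = (JDH H x + s • A x (linFlow B τ y), 0, 1)
            - (JDH H x + s • A x (linFlow B τ y), 0, 0) := by simp
      rw [e, map_sub, hDt x hx s hs τ, hDs x hx s hs τ, sub_zero]
    have h := is_const_of_deriv_eq_zero (fun τ => (hd τ).differentiableAt)
      (fun τ => (hd τ).deriv) τ 0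
    have h' := congrArg (linFlow C τ) h
    simpa [hD, linFlow_apply_neg, linFlow_zero, suspension] using h'

end Suspension

section SuspendedSymmetries
variable {Y : Type*} [NormedAddCommGroup Y] [NormedSpace ℝ Y] [CompleteSpace Y]
variable {H : ℝ × ℝ → ℝ} {γ : ℝ → ℝ × ℝ} {p p' : ℝ × ℝ} {O : Set (ℝ × ℝ)}
  {A : ℝ × ℝ → Y →L[ℝ] ℝ × ℝ} {B : Y →L[ℝ] Y} {y : Y}

theorem fderiv_apply_const {x : ℝ × ℝ} (hA : AnalyticAt ℝ A x) (y : Y) (v : ℝ × ℝ) :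
    fderiv ℝ (fun x => A x y) x v = fderiv ℝ A x v y := by
  rw [(hA.differentiableAt.hasFDerivAt.clm_apply (hasFDerivAt_const y x)).fderiv]
  simp

theorem fderiv_suspendedField {z : (ℝ × ℝ) × Y} (hH : AnalyticAt ℝ H z.1)
    (hA : AnalyticAt ℝ A z.1) (e : (ℝ × ℝ) × Y) :
    fderiv ℝ (suspendedField H A B) z e
      = (fderiv ℝ (JDH H) z.1 e.1 + fderiv ℝ (fun x => A x z.2) z.1 e.1 + A z.1 e.2, B e.2) := by
  have h₁ : HasFDerivAt (fun z : (ℝ × ℝ) × Y => JDH H z.1) _ z :=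
    (analyticAt_JDH hH).differentiableAt.hasFDerivAt.comp z hasFDerivAt_fst
  have h₂ : HasFDerivAt (fun z : (ℝ × ℝ) × Y => A z.1) _ z :=
    hA.differentiableAt.hasFDerivAt.comp z hasFDerivAt_fst
  have h₃ : HasFDerivAt (fun z : (ℝ × ℝ) × Y => B z.2) _ z :=
    B.hasFDerivAt.comp z hasFDerivAt_snd
  have h : HasFDerivAt (suspendedField H A B) _ z :=
    (h₁.add (h₂.clm_apply hasFDerivAt_snd)).prodMk h₃
  rw [h.fderiv, fderiv_apply_const hA]
  refine Prod.ext ?_ rfl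
  simp only [ContinuousLinearMap.prod_apply, add_apply, ContinuousLinearMap.comp_apply,
    ContinuousLinearMap.coe_fst', ContinuousLinearMap.coe_snd', ContinuousLinearMap.flip_apply]
  abel

/-- A combination, with coefficients depending on the amplitude only, of symmetries whose phase
components cancel vanishes. -/
theorem SaddleConnection.sum_symmetries_eq_zero (hc : SaddleConnection H γ p p')
    (hO : ConnectionNhd γ p p' O)
    (hg : MelnikovForcing H γ p p' (fun w => A w.1 (linFlow B w.2 y)))
    (hA : ∀ x, AnalyticAt ℝ A x) {T : ℝ} (hT₀ : 0 < T) (hT : linFlow B T = 1) {q : ℕ}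
    {fs : Fin q → (ℝ × ℝ) × Y → (ℝ × ℝ) × Y}
    (hfs : ∀ j, ∀ x ∈ O, ∀ s ∈ Set.Ioo (-2 : ℝ) 2, ∀ τ,
      AnalyticAt ℝ (fs j) (suspension B y (x, s, τ)))
    (hcomm : ∀ j, ∀ x ∈ O, ∀ s ∈ Set.Ioo (-2 : ℝ) 2, ∀ τ,
      fderiv ℝ (fs j) (suspension B y (x, s, τ)) (suspendedField H A B (suspension B y (x, s, τ)))
        = fderiv ℝ (suspendedField H A B) (suspension B y (x, s, τ))
          (fs j (suspension B y (x, s, τ))))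
    {c : Fin q → ℝ → ℝ} (hca : ∀ j, AnalyticOnNhd ℝ (c j) (Set.Ioo (-2 : ℝ) 2))
    (hsum : ∀ x ∈ O, ∀ s ∈ Set.Ioo (-2 : ℝ) 2, ∀ τ,
      ∑ j, c j s • (fs j (suspension B y (x, s, τ))).2 = 0) :
    ∀ x ∈ O, ∀ s ∈ Set.Ioo (-2 : ℝ) 2, ∀ τ,
      ∑ j, c j s • (fs j (suspension B y (x, s, τ))).1 = 0 := by
  have hfc : ∀ j, ∀ x ∈ O, ∀ s ∈ Set.Ioo (-2 : ℝ) 2, ∀ τ,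
      AnalyticAt ℝ (fun w => fs j (suspension B y w)) (x, s, τ) := fun j x hx s hs τ =>
    AnalyticAt.comp (g := fs j) (f := suspension B y) (hfs j x hx s hs τ)
      (analyticAt_suspension B y _)
  have hf₁ : ∀ j, ∀ x ∈ O, ∀ s ∈ Set.Ioo (-2 : ℝ) 2, ∀ τ,
      AnalyticAt ℝ (fun w => (fs j (suspension B y w)).1) (x, s, τ) := fun j x hx s hs τ =>
    AnalyticAt.comp (g := Prod.fst) analyticAt_fst (hfc j x hx s hs τ)
  have hcc : ∀ j, ∀ x : ℝ × ℝ, ∀ s ∈ Set.Ioo (-2 : ℝ) 2, ∀ τ : ℝ,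
      AnalyticAt ℝ (fun w : (ℝ × ℝ) × ℝ × ℝ => c j w.2.1) (x, s, τ) := fun j x s hs τ =>
    AnalyticAt.comp (g := c j) (f := fun w : (ℝ × ℝ) × ℝ × ℝ => w.2.1) (hca j s hs)
      (analyticAt_fst.comp analyticAt_snd)
  refine hc.symmetry_eq_zero hO hg hT₀ two_pos
    (X := fun w => ∑ j, c j w.2.1 • (fs j (suspension B y w)).1)
    (fun x hx s hs τ => Finset.analyticAt_fun_sum _ fun j _ =>
      (hcc j x s hs τ).smul (hf₁ j x hx s hs τ))
    (fun x hx s hs τ => by simp only [suspension, linFlow_periodic hT]) ?_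
  intro x hx s hs τ
  set z := suspension B y (x, s, τ) with hz
  have hz₁ : z.1 = x := rfl
  have hz₂ : z.2 = s • linFlow B τ y := rfl
  have hterm : ∀ j, fderiv ℝ (fun w : (ℝ × ℝ) × ℝ × ℝ => c j w.2.1 • (fs j (suspension B y w)).1)
      (x, s, τ) (JDH H x + s • A x (linFlow B τ y), 0, 1)
      = c j s • (fderiv ℝ (JDH H) x (fs j z).1
        + s • fderiv ℝ (fun x => A x (linFlow B τ y)) x (fs j z).1 + A x (fs j z).2) := by
    intro j
    have hc₁ : HasFDerivAt (fun w : (ℝ × ℝ) × ℝ × ℝ => c j w.2.1) _ (x, s, τ) :=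
      HasFDerivAt.comp (g := c j) (x, s, τ) (hca j s hs).differentiableAt.hasFDerivAt
      ((ContinuousLinearMap.fst ℝ ℝ ℝ).comp (ContinuousLinearMap.snd ℝ (ℝ × ℝ) (ℝ × ℝ))).hasFDerivAt
    have hf : HasFDerivAt (fun w => (fs j (suspension B y w)).1) _ (x, s, τ) :=
      (ContinuousLinearMap.fst ℝ (ℝ × ℝ) Y).hasFDerivAt.comp (x, s, τ)
        (hfc j x hx s hs τ).differentiableAt.hasFDerivAt
    rw [(hc₁.fun_smul hf).fderiv]
    have h1 := fderiv_comp_suspension (hfs j x hx s hs τ)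
      (JDH H x + s • A x (linFlow B τ y), 0, 1)
    rw [← suspendedField_suspension, hcomm j x hx s hs τ,
      fderiv_suspendedField (hc.analytic _ trivial) (hA _), ← hz, hz₁, hz₂,
      fderiv_apply_const (hA x), map_smul, ← fderiv_apply_const (hA x)] at h1
    simp [h1, hz]
  have hda : ∀ j ∈ Finset.univ, DifferentiableAt ℝ
      (fun w : (ℝ × ℝ) × ℝ × ℝ => c j w.2.1 • (fs j (suspension B y w)).1) (x, s, τ) :=
    fun j _ => ((hcc j x s hs τ).smul (hf₁ j x hx s hs τ)).differentiableAt
  rw [fderiv_fun_sum hda, sum_apply]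
  simp only [hterm]
  have h0 := congrArg (A x) (hsum x hx s hs τ)
  simp only [map_sum, map_smul, map_zero] at h0
  simp only [smul_add, Finset.sum_add_distrib, ← hz] at h0 ⊢
  rw [h0, add_zero]
  simp only [map_sum, map_smul, Finset.smul_sum]
  simp only [smul_comm s]

end SuspendedSymmetries

section SuspendedNonintegrability
variable {Y : Type*} [NormedAddCommGroup Y] [NormedSpace ℝ Y] [FiniteDimensional ℝ Y]
variable {H : ℝ × ℝ → ℝ} {γ : ℝ → ℝ × ℝ} {p p' : ℝ × ℝ} {O : Set (ℝ × ℝ)}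
  {A : ℝ × ℝ → Y →L[ℝ] ℝ × ℝ} {B : Y →L[ℝ] Y}

/-- Too many commuting symmetries and first integrals cannot coexist near a saddle connection with
nonvanishing Melnikov integral. -/
theorem SaddleConnection.not_integrable_suspended (hc : SaddleConnection H γ p p')
    (hO : ConnectionNhd γ p p' O) (hA : ∀ x, AnalyticAt ℝ A x) {T : ℝ} (hT₀ : 0 < T)
    (hT : linFlow B T = 1) {δ : ℝ} (hδ : 0 < δ) {U : Set ((ℝ × ℝ) × Y)}
    (hU : ∀ x ∈ O, ∀ y ∈ Metric.ball (0 : Y) δ, ∀ s ∈ Set.Ioo (-2 : ℝ) 2, ∀ τ,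
      suspension B y (x, s, τ) ∈ U)
    {G : Set Y} (hGo : IsOpen G) (hGd : Dense G)
    (hG : ∀ y ∈ G, MelnikovForcing H γ p p' (fun w => A w.1 (linFlow B w.2 y)))
    {q m : ℕ} (hqm : Module.finrank ℝ Y < q + m)
    {fs : Fin q → (ℝ × ℝ) × Y → (ℝ × ℝ) × Y} {Fs : Fin m → (ℝ × ℝ) × Y → ℝ}
    (hfs : ∀ j, AnalyticOnNhd ℝ (fs j) U) (hFs : ∀ k, AnalyticOnNhd ℝ (Fs k) U)
    (hcomm : ∀ j, ∀ z ∈ U, fderiv ℝ (fs j) z (suspendedField H A B z)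
      = fderiv ℝ (suspendedField H A B) z (fs j z))
    (hF : ∀ k, ∀ z ∈ U, fderiv ℝ (Fs k) z (suspendedField H A B z) = 0)
    (hFf : ∀ k j, ∀ z ∈ U, fderiv ℝ (Fs k) z (fs j z) = 0)
    (hind : ∀ W ⊆ U, IsOpen W → W.Nonempty → ∃ z ∈ W, LinearIndependent ℝ (fun j => fs j z))
    (hind' : ∀ W ⊆ U, IsOpen W → W.Nonempty →
      ∃ z ∈ W, LinearIndependent ℝ (fun k => fderiv ℝ (Fs k) z)) : False := by
  have hsusp : ∀ (x : ℝ × ℝ) (s : ℝ) (y : Y), suspension B y (x, s, 0) = (x, s • y) := by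
    intro x s y; simp [suspension, linFlow_zero]
  have h1mem : (1 : ℝ) ∈ Set.Ioo (-2 : ℝ) 2 := by norm_num
  have hOU : ∀ x ∈ O, ∀ y ∈ Metric.ball (0 : Y) δ, (x, y) ∈ U := by
    intro x hx y hy
    simpa [hsusp] using hU x hx y hy 1 h1mem 0
  have hd : ∀ j, AnalyticOnNhd ℝ (fun z => (fs j z).2) U := fun j z hz =>
    AnalyticAt.comp (g := Prod.snd) analyticAt_snd (hfs j z hz)
  have hdeq : ∀ j, ∀ z ∈ U, fderiv ℝ (fun z => (fs j z).2) z (suspendedField H A B z)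
      = B (fs j z).2 := by
    intro j z hz
    have h : HasFDerivAt (fun z => (fs j z).2) _ z :=
      (ContinuousLinearMap.snd ℝ (ℝ × ℝ) Y).hasFDerivAt.comp z
        (hfs j z hz).differentiableAt.hasFDerivAt
    rw [h.fderiv]
    change (fderiv ℝ (fs j) z (suspendedField H A B z)).2 = _
    rw [hcomm j z hz, fderiv_suspendedField (hc.analytic _ trivial) (hA _)]
  -- the integrals do not depend on the position
  have hFx : ∀ k, ∀ x ∈ O, ∀ y ∈ Metric.ball (0 : Y) δ ∩ G, ∀ v,
      fderiv ℝ (Fs k) (x, y) (v, 0) = 0 := by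
    intro k x hx y hy v
    have h := (hc.equivariant hO (hG y hy.2) hT₀ hT (C := (0 : ℝ →L[ℝ] ℝ)) (by simp [linFlow])
      (φ := Fs k) (fun x hx s hs τ => hFs k _ (hU x hx y hy.1 s hs τ))
      (fun x hx s hs τ => by simpa using hF k _ (hU x hx y hy.1 s hs τ))).1 x hx 1 h1mem 0 v
    simpa [hsusp] using h
  have hdx := fun (j : Fin q) (y : Y) (hy : y ∈ Metric.ball (0 : Y) δ ∩ G) =>
    hc.equivariant hO (hG y hy.2) hT₀ hT hT (φ := fun z => (fs j z).2)
      (fun x hx s hs τ => hd j _ (hU x hx y hy.1 s hs τ))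
      (fun x hx s hs τ => hdeq j _ (hU x hx y hy.1 s hs τ))
  -- the phase components are linearly dependent
  have hdep : ∀ x ∈ O, ∀ y ∈ Metric.ball (0 : Y) δ,
      ¬ LinearIndependent ℝ (fun j => (fs j (x, y)).2) := by
    intro x hx y hy hli
    have hcont : ContinuousAt (fun z => fun j => (fs j z).2) (x, y) :=
      continuousAt_pi.2 fun j => (hd j _ (hOU x hx y hy)).continuousAt
    have hev : ∀ᶠ z in 𝓝 (x, y), LinearIndependent ℝ (fun j => (fs j z).2) :=
      hcont.eventually (isOpen_setOfPred_linearIndependent.mem_nhds hli)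
    have hev' : ∀ᶠ z in 𝓝 (x, y), z ∈ O ×ˢ Metric.ball (0 : Y) δ :=
      (hO.isOpen.prod Metric.isOpen_ball).mem_nhds ⟨hx, hy⟩
    obtain ⟨W, hW, hWo, hWm⟩ := eventually_nhds_iff.1 (hev.and hev')
    have hne : (W ∩ (Set.univ ×ˢ G)).Nonempty :=
      (dense_univ.prod hGd).inter_open_nonempty W hWo ⟨_, hWm⟩
    obtain ⟨z, hz, hzF⟩ := hind' (W ∩ (Set.univ ×ˢ G))
      (fun z hz => hOU z.1 (hW z hz.1).2.1 z.2 (hW z hz.1).2.2)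
      (hWo.inter (isOpen_univ.prod hGo)) hne
    obtain ⟨hzli, hzO⟩ := hW z hz.1
    have hzU : z ∈ U := hOU z.1 hzO.1 z.2 hzO.2
    have hsplit : ∀ k (e : (ℝ × ℝ) × Y), fderiv ℝ (Fs k) z e
        = fderiv ℝ (Fs k) z ((0 : ℝ × ℝ), e.2) := by
      intro k e
      have : e = (e.1, 0) + (0, e.2) := by simp
      conv_lhs => rw [this]
      rw [map_add, hFx k z.1 hzO.1 z.2 ⟨hzO.2, hz.2.2⟩, zero_add]
    have hli' : LinearIndependent ℝ (fun k => (fderiv ℝ (Fs k) z).comp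
        (ContinuousLinearMap.inr ℝ (ℝ × ℝ) Y)) := by
      rw [Fintype.linearIndependent_iff] at hzF ⊢
      intro g hg
      refine hzF g ?_
      refine ContinuousLinearMap.ext fun e => ?_
      have he := DFunLike.congr_fun hg e.2
      simp only [sum_apply, smul_apply, ContinuousLinearMap.comp_apply,
        ContinuousLinearMap.inr_apply, zero_apply] at he ⊢
      rw [← he]
      exact Finset.sum_congr rfl fun k _ => by rw [hsplit k e]
    have := card_add_card_le_of_annihilates hzli hli' fun k j => by
      have := hFf k j z hzU
      rw [hsplit] at this
      exact this
    omega
  -- a generic base point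
  have h0O : γ 0 ∈ O := hO.orbit_mem 0
  have hδ2 : Metric.ball (0 : Y) (δ / 2) ⊆ Metric.ball 0 δ := Metric.ball_subset_ball (by linarith)
  obtain ⟨⟨x₁, y₁⟩, hz₁, hli₁⟩ := hind (O ×ˢ (Metric.ball (0 : Y) (δ / 2) ∩ G))
    (fun z hz => hOU z.1 hz.1 z.2 (hδ2 hz.2.1))
    (hO.isOpen.prod (Metric.isOpen_ball.inter hGo)) (by
      obtain ⟨y, hy⟩ := hGd.inter_open_nonempty (Metric.ball (0 : Y) (δ / 2)) Metric.isOpen_ball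
        ⟨0, Metric.mem_ball_self (by linarith)⟩
      exact ⟨(γ 0, y), h0O, hy⟩)
  obtain ⟨hx₁, hy₁, hyG⟩ : x₁ ∈ O ∧ y₁ ∈ Metric.ball (0 : Y) (δ / 2) ∧ y₁ ∈ G :=
    ⟨hz₁.1, hz₁.2.1, hz₁.2.2⟩
  have hyδ := hδ2 hy₁
  have hsy : ∀ s ∈ Set.Ioo (-2 : ℝ) 2, s • y₁ ∈ Metric.ball (0 : Y) δ := by
    intro s hs
    rw [mem_ball_zero_iff] at hy₁ ⊢
    rw [norm_smul, Real.norm_eq_abs]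
    have : |s| ≤ 2 := (abs_lt.2 ⟨hs.1, hs.2⟩).le
    nlinarith [norm_nonneg y₁]
  have hline : ∀ s : ℝ, AnalyticAt ℝ (fun s : ℝ => (x₁, s • y₁)) s := fun s => by fun_prop
  have hpre : IsPreconnected (Set.Ioo (-2 : ℝ) 2) := isPreconnected_Ioo
  obtain ⟨c, hca, hcs, i, s₀, hs₀, hne⟩ := exists_analytic_relation (J := Set.Ioo (-2 : ℝ) 2)
    isOpen_Ioo hpre (δ := fun j s => (fs j (x₁, s • y₁)).2)
    (fun j s hs => AnalyticAt.comp (g := fun z => (fs j z).2) (f := fun s : ℝ => (x₁, s • y₁))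
      (hd j _ (hOU x₁ hx₁ _ (hsy s hs))) (hline s))
    (fun s hs => hdep x₁ hx₁ _ (hsy s hs)) ⟨1, h1mem⟩
  have hconst : ∀ j, ∀ x ∈ O, ∀ s ∈ Set.Ioo (-2 : ℝ) 2,
      (fs j (x, s • y₁)).2 = (fs j (x₁, s • y₁)).2 := by
    intro j x hx s hs
    have hfd : ∀ x ∈ O, HasFDerivAt (fun x => (fs j (x, s • y₁)).2) (0 : ℝ × ℝ →L[ℝ] Y) x := by
      intro x hx
      have h1 : HasFDerivAt (fun x : ℝ × ℝ => (x, s • y₁)) _ x :=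
        (hasFDerivAt_id (𝕜 := ℝ) x).prodMk (hasFDerivAt_const (s • y₁) x)
      have h2 := (hd j _ (hOU x hx _ (hsy s hs))).differentiableAt.hasFDerivAt.comp x h1
      refine h2.congr_fderiv ?_
      refine ContinuousLinearMap.ext fun v => ?_
      have h3 := (hdx j y₁ ⟨hyδ, hyG⟩).1 x hx s hs 0 v
      rw [hsusp] at h3
      exact h3
    exact hO.isOpen.is_const_of_fderiv_eq_zero (𝕜 := ℝ) hO.preconnected
      (fun x hx => (hfd x hx).differentiableAt.differentiableWithinAt)
      (fun x hx => (hfd x hx).fderiv) hx hx₁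
  have hzero := hc.sum_symmetries_eq_zero hO (hG y₁ hyG) hA hT₀ hT
    (fun j x hx s hs τ => hfs j _ (hU x hx y₁ hyδ s hs τ))
    (fun j x hx s hs τ => hcomm j _ (hU x hx y₁ hyδ s hs τ)) hca (by
      intro x hx s hs τ
      have h1 : ∀ j, (fs j (suspension B y₁ (x, s, τ))).2
          = linFlow B τ (fs j (x₁, s • y₁)).2 := fun j => by
        rw [(hdx j y₁ ⟨hyδ, hyG⟩).2 x hx s hs τ, hconst j x hx s hs]
      simp only [h1, ← map_smul, ← map_sum]
      rw [hcs s hs, map_zero])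
  have hrel : ∀ s ∈ Set.Ioo (-2 : ℝ) 2, ∑ j, c j s • fs j (x₁, s • y₁) = 0 := by
    intro s hs
    refine Prod.ext ?_ ?_
    · rw [Prod.fst_sum]
      simpa [hsusp] using hzero x₁ hx₁ s hs 0
    · rw [Prod.snd_sum]
      exact hcs s hs
  -- independence near amplitude one forces the coefficients to vanish
  have hcont : ContinuousAt (fun s : ℝ => fun j => fs j (x₁, s • y₁)) 1 :=
    continuousAt_pi.2 fun j => (AnalyticAt.comp (g := fs j) (f := fun s : ℝ => (x₁, s • y₁))
      (hfs j _ (hOU x₁ hx₁ _ (hsy 1 h1mem))) (hline 1)).continuousAt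
  have hev : ∀ᶠ s in 𝓝 (1 : ℝ), LinearIndependent ℝ (fun j => fs j (x₁, s • y₁)) :=
    hcont.eventually (isOpen_setOfPred_linearIndependent.mem_nhds (by simpa using hli₁))
  have hcz : c i =ᶠ[𝓝 1] 0 := by
    filter_upwards [hev, Ioo_mem_nhds h1mem.1 h1mem.2] with s hs hs'
    exact Fintype.linearIndependent_iff.1 hs _ (hrel s hs') i
  exact hne ((hca i).eqOn_zero_of_preconnected_of_eventuallyEq_zero hpre h1mem hcz hs₀)

end SuspendedNonintegrability

section Modes
variable {H : ℝ × ℝ → ℝ} {γ : ℝ → ℝ × ℝ} {p p' : ℝ × ℝ}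

theorem SaddleConnection.continuous (hc : SaddleConnection H γ p p') : Continuous γ :=
  continuous_iff_continuousAt.2 fun t => (hc.orbit t).continuousAt

theorem SaddleConnection.integrable_exp_mul (hc : SaddleConnection H γ p p') {r : ℝ × ℝ → ℂ}
    (hr : ∀ x, AnalyticAt ℝ r x) (hp : r p = 0) (hp' : r p' = 0) (ν : ℝ) :
    Integrable (fun t : ℝ => Complex.exp (Complex.I * ν * t) * r (γ t)) := by
  have hγ' : ∀ t, HasDerivAt (fun t => γ (-t)) (-JDH H (γ (-t))) t := fun t => by
    have := (hc.orbit (-t)).scomp t (hasDerivAt_neg t)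
    rw [neg_one_smul] at this
    exact this
  have hl' : Tendsto (fun t => γ (-t)) atTop (𝓝 p') := hc.lim'.comp tendsto_neg_atTop_atBot
  obtain ⟨lam, ξ, η, e₁, e₂, hs⟩ := hc.saddle
  obtain ⟨lam', ξ', η', e₁', e₂', hs'⟩ := hc.saddle'
  obtain ⟨C₁, -, μ, hμ, hexp⟩ := hs.exists_exp_bound hc.orbit hc.lim
  obtain ⟨C₁', -, μ', hμ', hexp'⟩ := hs'.neg.exists_exp_bound hγ' hl'
  have i1 := integrableOn_exp_mul_comp (ν := ν) hc.continuous hμ hexp hc.lim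
    (hr p).differentiableAt hp (fun t _ => (hr _).continuousAt)
  have i2 := integrableOn_exp_mul_comp (ν := -ν) (γ := fun t => γ (-t))
    (hc.continuous.comp continuous_neg) hμ' hexp' hl'
    (hr p').differentiableAt hp' (fun t _ => (hr _).continuousAt)
  have hcongr : (fun s : ℝ => Complex.exp (Complex.I * (-ν : ℝ) * s) * r (γ (-s)))
      = fun s : ℝ => (fun s : ℝ => Complex.exp (Complex.I * ν * s) * r (γ s)) (-s) := by
    funext s; simp
  rw [hcongr] at i2
  have i3 : IntegrableOn (fun s : ℝ => Complex.exp (Complex.I * ν * s) * r (γ s))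
      (Set.Iic 0) := by
    rw [integrableOn_Iic_iff_integrableOn_Iio]
    refine ((Measure.measurePreserving_neg (volume : Measure ℝ)).integrableOn_comp_preimage
      (Homeomorph.neg ℝ).measurableEmbedding).1 ?_
    rw [Set.neg_preimage, Set.neg_Iio, neg_zero]
    exact i2
  rw [← integrableOn_univ, ← Set.Iic_union_Ioi (a := (0 : ℝ))]
  exact i3.union i1

/-- The complex amplitude `DH · (a - i b)` of the real Fourier mode `a cos φ + b sin φ`. -/
noncomputable def modeAmplitude (H : ℝ × ℝ → ℝ) (a b : ℝ × ℝ → ℝ × ℝ) (x : ℝ × ℝ) : ℂ :=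
  (fderiv ℝ H x (a x) : ℝ) - Complex.I * (fderiv ℝ H x (b x) : ℝ)

theorem analyticAt_fderiv_apply_ofReal {a : ℝ × ℝ → ℝ × ℝ} {x : ℝ × ℝ} (hH : AnalyticAt ℝ H x)
    (ha : AnalyticAt ℝ a x) : AnalyticAt ℝ (fun x => ((fderiv ℝ H x (a x) : ℝ) : ℂ)) x :=
  AnalyticAt.comp (g := Complex.ofRealCLM) (Complex.ofRealCLM.analyticAt _)
    (AnalyticAt.clm_apply_fun hH.fderiv ha)

theorem analyticAt_modeAmplitude {a b : ℝ × ℝ → ℝ × ℝ} {x : ℝ × ℝ} (hH : AnalyticAt ℝ H x)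
    (ha : AnalyticAt ℝ a x) (hb : AnalyticAt ℝ b x) : AnalyticAt ℝ (modeAmplitude H a b) x :=
  (analyticAt_fderiv_apply_ofReal hH ha).fun_sub
    (analyticAt_const.fun_mul (analyticAt_fderiv_apply_ofReal hH hb))

theorem modeAmplitude_eq_zero {x : ℝ × ℝ} (h : JDH H x = 0) (a b : ℝ × ℝ → ℝ × ℝ) :
    modeAmplitude H a b x = 0 := by
  simp [modeAmplitude, SaddleConnection.fderiv_eq_zero_of_JDH h]

theorem re_exp_mul_modeAmplitude (a b : ℝ × ℝ → ℝ × ℝ) (x : ℝ × ℝ) (φ u v : ℝ) :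
    (Complex.exp (Complex.I * φ) * ((u + Complex.I * v) * modeAmplitude H a b x)).re
      = (Real.cos φ * u - Real.sin φ * v) * fderiv ℝ H x (a x)
        + (Real.sin φ * u + Real.cos φ * v) * fderiv ℝ H x (b x) := by
  rw [mul_comm Complex.I, Complex.exp_mul_I, ← Complex.ofReal_cos, ← Complex.ofReal_sin,
    modeAmplitude]
  simp [-Complex.ofReal_cos, -Complex.ofReal_sin]
  ring

theorem MelnikovForcing.of_sum {ι : Type*} [Fintype ι] [DecidableEq ι]
    {g : (ℝ × ℝ) × ℝ → ℝ × ℝ}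
    (hg : ∀ (τ : ℝ) (x : ℝ × ℝ), AnalyticAt ℝ (fun y => g (y, τ)) x) {freq : ι → ℝ}
    {r : ι → ℝ × ℝ → ℂ} (hr : ∀ k x, AnalyticAt ℝ (r k) x) {i : ι} (hi : freq i ≠ 0)
    (huniq : ∀ k, freq k = freq i → k = i) (hp : r i p = 0) (hp' : r i p' = 0)
    (hsum : ∀ (x : ℝ × ℝ) (τ : ℝ), ((fderiv ℝ H x (g (x, τ)) : ℝ) : ℂ)
      = ∑ k, Complex.exp (Complex.I * freq k * τ) * r k x)
    (hM : ∫ s : ℝ, Complex.exp (Complex.I * freq i * s) * r i (γ s) ≠ 0) :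
    MelnikovForcing H γ p p' g := by
  set ρ : ℝ → ℝ × ℝ → ℂ := fun μ x => ∑ k with freq k = μ, r k x with hρ
  have hρi : ρ (freq i) = r i := by
    funext x
    have : (Finset.univ.filter fun k => freq k = freq i) = {i} := by
      ext k
      simpa using ⟨huniq k, fun h => h ▸ rfl⟩
    rw [hρ]
    simp only [this, Finset.sum_singleton]
  refine ⟨hg, freq i, (Finset.univ.image freq).erase (freq i), ρ, hi, Finset.notMem_erase _ _,
    fun μ x => Finset.analyticAt_fun_sum _ fun k _ => hr k x, by rw [hρi, hp], by rw [hρi, hp'],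
    fun x τ => ?_, by rwa [hρi]⟩
  rw [Finset.add_sum_erase _ (fun μ : ℝ => Complex.exp (Complex.I * μ * τ) * ρ μ x)
    (Finset.mem_image_of_mem _ (Finset.mem_univ i)), hsum,
    ← Finset.sum_fiberwise_of_maps_to (fun k hk => Finset.mem_image_of_mem freq hk)]
  refine Finset.sum_congr rfl fun μ _ => ?_
  rw [hρ, Finset.mul_sum]
  refine Finset.sum_congr rfl fun k hk => ?_
  rw [(Finset.mem_filter.1 hk).2]

end Modes

section Forcing
variable {N : ℕ}

/-- The space of the parameters `(ε, u, v)`. -/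
abbrev ForcingSpace (N : ℕ) := ℝ × (Fin N → ℝ) × (Fin N → ℝ)

/-- The linear dependence of the autonomous system on `(ε, u, v)`. -/
noncomputable def forcingMap (a₀ : ℝ × ℝ → ℝ × ℝ) (a b : Fin N → ℝ × ℝ → ℝ × ℝ) (x : ℝ × ℝ) :
    ForcingSpace N →L[ℝ] ℝ × ℝ :=
  LinearMap.toContinuousLinearMap
    { toFun := fun y => y.1 • a₀ x + ∑ j, (y.2.1 j • a j x + y.2.2 j • b j x)
      map_add' := fun y z => by
        simp only [Prod.fst_add, Prod.snd_add, Pi.add_apply, add_smul, Finset.sum_add_distrib]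
        abel
      map_smul' := fun c y => by
        simp only [Prod.smul_fst, Prod.smul_snd, Pi.smul_apply, smul_eq_mul, mul_smul,
          RingHom.id_apply, smul_add, Finset.smul_sum] }

theorem forcingMap_apply (a₀ : ℝ × ℝ → ℝ × ℝ) (a b : Fin N → ℝ × ℝ → ℝ × ℝ) (x : ℝ × ℝ)
    (y : ForcingSpace N) :
    forcingMap a₀ a b x y = y.1 • a₀ x + ∑ j, (y.2.1 j • a j x + y.2.2 j • b j x) := rfl

theorem analyticAt_clm_of_apply {E V W : Type*} [NormedAddCommGroup E] [NormedSpace ℝ E]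
    [NormedAddCommGroup V] [NormedSpace ℝ V] [FiniteDimensional ℝ V] [NormedAddCommGroup W]
    [NormedSpace ℝ W] {A : E → V →L[ℝ] W} {x : E}
    (h : ∀ v, AnalyticAt ℝ (fun x => A x v) x) : AnalyticAt ℝ A x := by
  set bas := Module.finBasis ℝ V
  have e : A = fun x => ∑ i, ContinuousLinearMap.smulRightL ℝ V W
      (LinearMap.toContinuousLinearMap (bas.coord i)) (A x (bas i)) := by
    funext x
    refine ContinuousLinearMap.ext fun v => ?_
    conv_lhs => rw [← bas.sum_repr v, map_sum]
    simp only [map_smul, sum_apply, ContinuousLinearMap.smulRightL_apply_apply,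
      ContinuousLinearMap.smulRight_apply, LinearMap.coe_toContinuousLinearMap',
      Module.Basis.coord_apply]
  rw [e]
  exact Finset.analyticAt_fun_sum _ fun i _ =>
    AnalyticAt.comp (g := ContinuousLinearMap.smulRightL ℝ V W _)
      (ContinuousLinearMap.analyticAt _ _) (h (bas i))

theorem analyticAt_forcingMap {a₀ : ℝ × ℝ → ℝ × ℝ} {a b : Fin N → ℝ × ℝ → ℝ × ℝ} {x : ℝ × ℝ}
    (ha₀ : AnalyticAt ℝ a₀ x) (ha : ∀ j, AnalyticAt ℝ (a j) x)
    (hb : ∀ j, AnalyticAt ℝ (b j) x) : AnalyticAt ℝ (forcingMap a₀ a b) x := by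
  refine analyticAt_clm_of_apply fun y => ?_
  simp only [forcingMap_apply]
  exact (analyticAt_const.fun_smul ha₀).fun_add (Finset.analyticAt_fun_sum _ fun j _ =>
    (analyticAt_const.fun_smul (ha j)).fun_add (analyticAt_const.fun_smul (hb j)))

/-- The generator of the rotation of the oscillators `(u_j, v_j)`. -/
noncomputable def oscillator (N : ℕ) (ω : ℝ) : ForcingSpace N →L[ℝ] ForcingSpace N :=
  LinearMap.toContinuousLinearMap
    { toFun := fun y => (0, fun j => -((((j : ℕ) : ℝ) + 1) * ω * y.2.2 j),
        fun j => (((j : ℕ) : ℝ) + 1) * ω * y.2.1 j)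
      map_add' := fun y z => by
        ext <;> simp <;> ring
      map_smul' := fun c y => by
        ext <;> simp <;> ring }

theorem oscillator_apply (ω : ℝ) (y : ForcingSpace N) :
    oscillator N ω y = (0, fun j : Fin N => -((((j : ℕ) : ℝ) + 1) * ω * y.2.2 j),
      fun j : Fin N => (((j : ℕ) : ℝ) + 1) * ω * y.2.1 j) := rfl

theorem autonomousField_eq_suspendedField (ω : ℝ) (H : ℝ × ℝ → ℝ) (a₀ : ℝ × ℝ → ℝ × ℝ)
    (a b : Fin N → ℝ × ℝ → ℝ × ℝ) :
    autonomousField N ω H a₀ a b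
      = suspendedField H (forcingMap a₀ a b) (oscillator N ω) := by
  funext z
  simp only [autonomousField, suspendedField, forcingMap_apply, oscillator_apply, add_assoc]

theorem linFlow_oscillator_apply (ω τ : ℝ) (y : ForcingSpace N) :
    linFlow (oscillator N ω) τ y = (y.1,
      fun j : Fin N => Real.cos ((((j : ℕ) : ℝ) + 1) * ω * τ) * y.2.1 j
        - Real.sin ((((j : ℕ) : ℝ) + 1) * ω * τ) * y.2.2 j,
      fun j : Fin N => Real.sin ((((j : ℕ) : ℝ) + 1) * ω * τ) * y.2.1 j
        + Real.cos ((((j : ℕ) : ℝ) + 1) * ω * τ) * y.2.2 j) := by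
  have h := eq_linFlow_apply (oscillator N ω) (r := fun τ : ℝ => (y.1,
      fun j : Fin N => Real.cos ((((j : ℕ) : ℝ) + 1) * ω * τ) * y.2.1 j
        - Real.sin ((((j : ℕ) : ℝ) + 1) * ω * τ) * y.2.2 j,
      fun j : Fin N => Real.sin ((((j : ℕ) : ℝ) + 1) * ω * τ) * y.2.1 j
        + Real.cos ((((j : ℕ) : ℝ) + 1) * ω * τ) * y.2.2 j)) (fun τ => ?_) τ
  · simp only [mul_zero, Real.cos_zero, Real.sin_zero, one_mul, zero_mul, sub_zero,
      zero_add] at h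
    exact h.symm
  · have hl : ∀ c : ℝ, HasDerivAt (fun τ : ℝ => c * τ) c τ := fun c => by
      simpa using (hasDerivAt_id τ).const_mul c
    rw [oscillator_apply]
    refine (hasDerivAt_const τ y.1).prodMk ((hasDerivAt_pi.2 fun j => ?_).prodMk
      (hasDerivAt_pi.2 fun j => ?_))
    · convert ((hl _).cos.mul_const (y.2.1 j)).fun_sub ((hl _).sin.mul_const (y.2.2 j)) using 1
      ring
    · convert ((hl _).sin.mul_const (y.2.1 j)).fun_add ((hl _).cos.mul_const (y.2.2 j)) using 1
      ring

theorem linFlow_oscillator_period {ω : ℝ} (hω : 0 < ω) :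
    linFlow (oscillator N ω) (2 * Real.pi / ω) = 1 := by
  refine ContinuousLinearMap.ext fun y => ?_
  have e : ∀ j : Fin N, (((j : ℕ) : ℝ) + 1) * ω * (2 * Real.pi / ω)
      = ((j + 1 : ℕ) : ℝ) * (2 * Real.pi) := fun j => by
    push_cast; field_simp
  have hs : ∀ n : ℕ, Real.sin ((n : ℝ) * (2 * Real.pi)) = 0 := fun n => by
    have := Real.sin_nat_mul_pi (n * 2)
    rwa [Nat.cast_mul, Nat.cast_ofNat, mul_assoc] at this
  rw [linFlow_oscillator_apply]
  simp only [e, Real.cos_nat_mul_two_pi, hs, one_mul, zero_mul, sub_zero, zero_add]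
  rfl

variable {H : ℝ × ℝ → ℝ} {γ : ℝ → ℝ × ℝ} {p p' : ℝ × ℝ} {a₀ : ℝ × ℝ → ℝ × ℝ}
  {a b : Fin N → ℝ × ℝ → ℝ × ℝ}

theorem melnikovForcing_of_integral_ne_zero (hc : SaddleConnection H γ p p')
    (ha₀ : ∀ x, AnalyticAt ℝ a₀ x) (ha : ∀ j x, AnalyticAt ℝ (a j) x)
    (hb : ∀ j x, AnalyticAt ℝ (b j) x) {ω : ℝ} (hω : 0 < ω) {i : Fin N}
    (hM : ∫ s : ℝ, Complex.exp (Complex.I * (((((i : ℕ) : ℝ) + 1) * ω : ℝ) : ℂ) * s)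
      * modeAmplitude H (a i) (b i) (γ s) ≠ 0) {y : ForcingSpace N} (hy : y.2.1 i ≠ 0) :
    MelnikovForcing H γ p p'
      (fun w => forcingMap a₀ a b w.1 (linFlow (oscillator N ω) w.2 y)) := by
  have hH : ∀ x, AnalyticAt ℝ H x := fun x => hc.analytic x trivial
  set z : Fin N → ℂ := fun j => (y.2.1 j : ℂ) + Complex.I * (y.2.2 j : ℂ) with hz
  have hzi : z i ≠ 0 := fun h => hy (by simpa [hz] using congrArg Complex.re h)
  set ν : Fin N → ℝ := fun j => (((j : ℕ) : ℝ) + 1) * ω with hν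
  have hνpos : ∀ j, 0 < ν j := fun j => by positivity
  have hνinj : Function.Injective ν := fun j k h => by
    have := mul_right_cancel₀ hω.ne' h
    exact Fin.ext (by exact_mod_cast add_right_cancel this)
  set w : Fin N → ℝ × ℝ → ℂ := fun j x => z j * modeAmplitude H (a j) (b j) x with hw
  have hwa : ∀ j x, AnalyticAt ℝ (w j) x := fun j x =>
    analyticAt_const.fun_mul (analyticAt_modeAmplitude (hH x) (ha j x) (hb j x))
  refine MelnikovForcing.of_sum (ι := Unit ⊕ Fin N ⊕ Fin N) (i := Sum.inr (Sum.inl i))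
    (freq := Sum.elim (fun _ => 0) (Sum.elim ν fun j => -ν j))
    (r := Sum.elim (fun _ x => ((y.1 * fderiv ℝ H x (a₀ x) : ℝ) : ℂ))
      (Sum.elim (fun j x => (1 / 2) * w j x)
        fun j x => (1 / 2) * (starRingEnd ℂ) (w j x)))
    (fun τ x => ?_) ?_ (hνpos i).ne' ?_ ?_ ?_ (fun x τ => ?_) ?_
  · exact AnalyticAt.clm_apply_fun (v := fun _ => linFlow (oscillator N ω) τ y)
      (analyticAt_forcingMap (ha₀ x) (fun j => ha j x) fun j => hb j x) analyticAt_const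
  · rintro (k | k | k) x
    · simp only [Sum.elim_inl, Complex.ofReal_mul]
      exact analyticAt_const.fun_mul (analyticAt_fderiv_apply_ofReal (hH x) (ha₀ x))
    · exact analyticAt_const.fun_mul (hwa k x)
    · exact analyticAt_const.fun_mul
        (AnalyticAt.comp (g := Complex.conjCLE) (Complex.conjCLE.analyticAt _) (hwa k x))
  · rintro (k | k | k) h <;> simp only [Sum.elim_inl, Sum.elim_inr] at h
    · exact absurd h.symm (hνpos i).ne'
    · rw [hνinj h]
    · linarith [hνpos i, hνpos k]
  · simp [hw, modeAmplitude_eq_zero hc.apply_eq_zero]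
  · simp [hw, modeAmplitude_eq_zero hc.apply_eq_zero']
  · have hterm : ∀ j, (((Real.cos (ν j * τ) * y.2.1 j - Real.sin (ν j * τ) * y.2.2 j)
          * fderiv ℝ H x (a j x)
        + (Real.sin (ν j * τ) * y.2.1 j + Real.cos (ν j * τ) * y.2.2 j)
          * fderiv ℝ H x (b j x) : ℝ) : ℂ)
        = Complex.exp (Complex.I * ν j * τ) * ((1 / 2) * w j x)
          + Complex.exp (Complex.I * ((-ν j : ℝ) : ℂ) * τ)
            * ((1 / 2) * (starRingEnd ℂ) (w j x)) := fun j => by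
      rw [← re_exp_mul_modeAmplitude, Complex.re_eq_add_conj, map_mul, ← Complex.exp_conj]
      simp only [map_mul, Complex.conj_I, Complex.conj_ofReal, hw, hz]
      push_cast
      rw [show -Complex.I * (ν j * τ) = Complex.I * -ν j * τ by ring,
        show Complex.I * ((ν j : ℂ) * τ) = Complex.I * ν j * τ by ring]
      ring
    simp only [Fintype.sum_sum_type, Sum.elim_inl, Sum.elim_inr, Finset.univ_unique,
      Finset.sum_singleton, Complex.ofReal_zero, mul_zero, zero_mul, Complex.exp_zero, one_mul]
    rw [← Finset.sum_add_distrib, ← Finset.sum_congr rfl fun j _ => hterm j,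
      ← Complex.ofReal_sum, ← Complex.ofReal_add, linFlow_oscillator_apply, forcingMap_apply]
    simp only [map_add, map_sum, map_smul, smul_eq_mul]
    rfl
  · simp only [Sum.elim_inl, Sum.elim_inr]
    have e : (fun s : ℝ => Complex.exp (Complex.I * ν i * s) * ((1 / 2) * w i (γ s)))
        = fun s : ℝ => ((1 / 2) * z i) * (Complex.exp (Complex.I * ν i * s)
          * modeAmplitude H (a i) (b i) (γ s)) := by
      funext s; simp only [hw]; ring
    rw [e, integral_const_mul]
    exact mul_ne_zero (mul_ne_zero (by norm_num) hzi) hM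

theorem fderiv_apply_perturbation (x : ℝ × ℝ) (θ : ℝ) :
    D1 H x * (perturbation N a₀ a b x θ).1 + D2 H x * (perturbation N a₀ a b x θ).2
      = (((fderiv ℝ H x (a₀ x) : ℝ) : ℂ) + ∑ j : Fin N,
        Complex.exp (Complex.I * (((((j : ℕ) : ℝ) + 1) * θ : ℝ) : ℂ))
          * modeAmplitude H (a j) (b j) x).re := by
  have h : ∀ j : Fin N, (Complex.exp (Complex.I * (((((j : ℕ) : ℝ) + 1) * θ : ℝ) : ℂ))
          * modeAmplitude H (a j) (b j) x).re
      = Real.cos ((((j : ℕ) : ℝ) + 1) * θ) * fderiv ℝ H x (a j x)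
        + Real.sin ((((j : ℕ) : ℝ) + 1) * θ) * fderiv ℝ H x (b j x) := fun j => by
    simpa using re_exp_mul_modeAmplitude (H := H) (a j) (b j) x ((((j : ℕ) : ℝ) + 1) * θ) 1 0
  rw [Complex.add_re, Complex.re_sum, Finset.sum_congr rfl fun j _ => h j, Complex.ofReal_re,
    perturbation]
  have := fderiv_apply_eq_D1_D2 H x (perturbation N a₀ a b x θ)
  rw [perturbation] at this
  simp only [map_add, map_sum, map_smul, smul_eq_mul] at this
  rw [this]

/-- If all Fourier integrals along the connection vanish, the Melnikov function is constant. -/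
theorem exists_integral_ne_zero (hc : SaddleConnection H γ p p')
    (ha₀ : ∀ x, AnalyticAt ℝ a₀ x) (ha : ∀ j x, AnalyticAt ℝ (a j) x)
    (hb : ∀ j x, AnalyticAt ℝ (b j) x) {ω θ₁ θ₂ : ℝ}
    (hM : melnikov N ω H a₀ a b γ θ₁ ≠ melnikov N ω H a₀ a b γ θ₂) :
    ∃ i : Fin N, ∫ s : ℝ, Complex.exp (Complex.I * (((((i : ℕ) : ℝ) + 1) * ω : ℝ) : ℂ) * s)
      * modeAmplitude H (a i) (b i) (γ s) ≠ 0 := by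
  by_contra! hzero
  have hH : ∀ x, AnalyticAt ℝ H x := fun x => hc.analytic x trivial
  have i₀ : Integrable (fun s : ℝ => ((fderiv ℝ H (γ s) (a₀ (γ s)) : ℝ) : ℂ)) := by
    have := hc.integrable_exp_mul (r := fun x => ((fderiv ℝ H x (a₀ x) : ℝ) : ℂ))
      (fun x => analyticAt_fderiv_apply_ofReal (hH x) (ha₀ x))
      (by simp [SaddleConnection.fderiv_eq_zero_of_JDH hc.apply_eq_zero])
      (by simp [SaddleConnection.fderiv_eq_zero_of_JDH hc.apply_eq_zero']) 0
    simpa using this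
  have i₁ : ∀ j : Fin N, Integrable (fun s : ℝ =>
      Complex.exp (Complex.I * (((((j : ℕ) : ℝ) + 1) * ω : ℝ) : ℂ) * s)
        * modeAmplitude H (a j) (b j) (γ s)) := fun j =>
    hc.integrable_exp_mul (fun x => analyticAt_modeAmplitude (hH x) (ha j x) (hb j x))
      (modeAmplitude_eq_zero hc.apply_eq_zero _ _) (modeAmplitude_eq_zero hc.apply_eq_zero' _ _) _
  have key : ∀ θ, melnikov N ω H a₀ a b γ θ
      = (∫ s : ℝ, ((fderiv ℝ H (γ s) (a₀ (γ s)) : ℝ) : ℂ)).re := fun θ => by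
    have e : ∀ s : ℝ, (((fderiv ℝ H (γ s) (a₀ (γ s)) : ℝ) : ℂ) + ∑ j : Fin N,
        Complex.exp (Complex.I * (((((j : ℕ) : ℝ) + 1) * (ω * s + θ) : ℝ) : ℂ))
          * modeAmplitude H (a j) (b j) (γ s))
        = ((fderiv ℝ H (γ s) (a₀ (γ s)) : ℝ) : ℂ) + ∑ j : Fin N,
          Complex.exp (Complex.I * (((((j : ℕ) : ℝ) + 1) * θ : ℝ) : ℂ))
            * (Complex.exp (Complex.I * (((((j : ℕ) : ℝ) + 1) * ω : ℝ) : ℂ) * s)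
              * modeAmplitude H (a j) (b j) (γ s)) := fun s => by
      congr 1
      refine Finset.sum_congr rfl fun j _ => ?_
      rw [← mul_assoc, ← Complex.exp_add]
      congr 2
      push_cast
      ring
    have i₂ := integrable_finsetSum (Finset.univ : Finset (Fin N)) fun j _ =>
      (i₁ j).const_mul (Complex.exp (Complex.I * (((((j : ℕ) : ℝ) + 1) * θ : ℝ) : ℂ)))
    rw [melnikov]
    simp only [fderiv_apply_perturbation, e]
    have h := integral_re (𝕜 := ℂ) (i₀.add i₂)
    simp only [Pi.add_apply] at h
    refine h.trans ?_
    rw [integral_add i₀ i₂, integral_finsetSum _ fun j _ => (i₁ j).const_mul _]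
    simp only [integral_const_mul, hzero, mul_zero, Finset.sum_const_zero, add_zero]
    rfl
  exact hM (by rw [key, key])

theorem melnikov_comp_add (ω : ℝ) (xh : ℝ → ℝ × ℝ) (s θ : ℝ) :
    melnikov N ω H a₀ a b (fun t => xh (t + s)) θ = melnikov N ω H a₀ a b xh (θ - ω * s) := by
  rw [melnikov, melnikov]
  conv_rhs => rw [← integral_add_right_eq_self _ s]
  refine integral_congr_ae (Eventually.of_forall fun t => ?_)
  simp only [show ω * (t + s) + (θ - ω * s) = ω * t + θ by ring]

end Forcing

theorem SaddleConnection.exists_ball_subset {Y : Type*} [NormedAddCommGroup Y]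
    {H : ℝ × ℝ → ℝ} {γ : ℝ → ℝ × ℝ} {p p' : ℝ × ℝ} (hc : SaddleConnection H γ p p')
    {U : Set ((ℝ × ℝ) × Y)} (hU : IsOpen U) (hp : (p, 0) ∈ U) (hp' : (p', 0) ∈ U)
    (hγ : ∀ t, (γ t, 0) ∈ U) :
    ∃ O, ConnectionNhd γ p p' O ∧ ∃ δ > 0, O ×ˢ Metric.ball (0 : Y) δ ⊆ U := by
  have hK := (isCompact_insert_forward_orbit hc.continuous hc.lim).union
    (isCompact_insert_forward_orbit (γ := fun t => γ (-t)) (hc.continuous.comp continuous_neg)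
      (hc.lim'.comp tendsto_neg_atTop_atBot))
  obtain ⟨O, V, hO, hV, hKO, h0V, hOV⟩ := generalized_tube_lemma hK
    (isCompact_singleton (x := (0 : Y))) hU (by
      rintro ⟨x, y⟩ ⟨(rfl | ⟨t, -, rfl⟩) | (rfl | ⟨t, -, rfl⟩), rfl⟩
      exacts [hp, hγ t, hp', hγ (-t)])
  obtain ⟨δ, hδ, hball⟩ := Metric.isOpen_iff.1 hV 0 (h0V rfl)
  obtain ⟨O', hO', hcn⟩ := hc.exists_connectionNhd hO (hKO (Or.inl (Or.inl rfl)))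
    (hKO (Or.inr (Or.inl rfl))) (fun t => by
      rcases le_total 0 t with ht | ht
      · exact hKO (Or.inl (Or.inr ⟨t, ht, rfl⟩))
      · exact hKO (Or.inr (Or.inr ⟨-t, neg_nonneg.2 ht, by simp only [neg_neg]⟩)))
  exact ⟨O', hcn, δ, hδ, (Set.prod_mono hO' hball).trans hOV⟩

theorem exists_mem_of_ae_restrict {E : Type*} [TopologicalSpace E] [MeasureSpace E]
    [OpensMeasurableSpace E] [(volume : Measure E).IsOpenPosMeasure] {U W : Set E} {P : E → Prop}
    (h : ∀ᵐ x ∂(volume.restrict U), P x) (hWU : W ⊆ U) (hW : IsOpen W) (hne : W.Nonempty) :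
    ∃ x ∈ W, P x := by
  have : NeBot (ae (volume.restrict W)) := by
    rw [ae_neBot, Ne, Measure.restrict_eq_zero]
    exact (hW.measure_pos volume hne).ne'
  obtain ⟨x, hx, hxW⟩ := ((ae_restrict_of_ae_restrict_of_subset hWU h).and
    (ae_restrict_mem hW.measurableSet)).exists
  exact ⟨x, hxW, hx⟩

theorem isOpenPosMeasure_prod {X Y : Type*} [TopologicalSpace X] [TopologicalSpace Y]
    [MeasureSpace X] [MeasureSpace Y] [SFinite (volume : Measure Y)]
    (hX : (volume : Measure X).IsOpenPosMeasure) (hY : (volume : Measure Y).IsOpenPosMeasure) :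
    (volume : Measure (X × Y)).IsOpenPosMeasure :=
  Measure.prod.instIsOpenPosMeasure

theorem isOpenPosMeasure_phaseSpace (N : ℕ) :
    (volume : Measure (PhaseSpace N)).IsOpenPosMeasure :=
  isOpenPosMeasure_prod (isOpenPosMeasure_prod inferInstance inferInstance)
    (isOpenPosMeasure_prod inferInstance (isOpenPosMeasure_prod inferInstance inferInstance))

theorem exists_JDH_ne_zero {N : ℕ} {ω : ℝ} {H : ℝ × ℝ → ℝ} {a₀ : ℝ × ℝ → ℝ × ℝ}
    {a b : Fin N → ℝ × ℝ → ℝ × ℝ} {xh : ℝ → ℝ × ℝ} {θ₁ θ₂ : ℝ}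
    (hM : melnikov N ω H a₀ a b xh θ₁ ≠ melnikov N ω H a₀ a b xh θ₂) :
    ∃ t, JDH H (xh t) ≠ 0 := by
  by_contra! h
  have h₁ : ∀ t, D1 H (xh t) = 0 := fun t =>
    SaddleConnection.fderiv_eq_zero_of_JDH (h t) _
  have h₂ : ∀ t, D2 H (xh t) = 0 := fun t =>
    SaddleConnection.fderiv_eq_zero_of_JDH (h t) _
  simp [melnikov, h₁, h₂] at hM

theorem dense_coordinate_ne_zero {N : ℕ} (i : Fin N) :
    Dense {y : ForcingSpace N | y.2.1 i ≠ 0} := by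
  have hopen : IsOpenMap (fun y : ForcingSpace N => y.2.1 i) :=
    (isOpenMap_eval i).comp (isOpenMap_fst.comp isOpenMap_snd)
  exact (dense_compl_singleton (0 : ℝ)).preimage hopen

theorem SaddleConnection.not_bogoyavlenskijIntegrable {N : ℕ} {ω : ℝ} (hω : 0 < ω)
    {H : ℝ × ℝ → ℝ} {γ : ℝ → ℝ × ℝ} {p p' : ℝ × ℝ} (hc : SaddleConnection H γ p p')
    {a₀ : ℝ × ℝ → ℝ × ℝ} {a b : Fin N → ℝ × ℝ → ℝ × ℝ} (ha₀ : ∀ x, AnalyticAt ℝ a₀ x)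
    (ha : ∀ j x, AnalyticAt ℝ (a j) x) (hb : ∀ j x, AnalyticAt ℝ (b j) x) {θ₁ θ₂ : ℝ}
    (hM : melnikov N ω H a₀ a b γ θ₁ ≠ melnikov N ω H a₀ a b γ θ₂) {U : Set (PhaseSpace N)}
    (hU : IsOpen U) (hp : (p, 0) ∈ U) (hp' : (p', 0) ∈ U) (hγ : ∀ t, (γ t, 0) ∈ U) {q m : ℕ}
    (hq : 0 < q) (hqm : 2 * N + 1 < q + m) :
    ¬BogoyavlenskijIntegrable (autonomousField N ω H a₀ a b) U q m := by
  rintro ⟨fs, Fs, hf, hfs, hFs, hcomm, hind, hind', hFf⟩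
  have := isOpenPosMeasure_phaseSpace N
  obtain ⟨i, hi⟩ := exists_integral_ne_zero hc ha₀ ha hb hM
  obtain ⟨O, hO, δ, hδ, hball⟩ := hc.exists_ball_subset hU hp hp' hγ
  rw [autonomousField_eq_suspendedField] at hf
  have hT₀ : 0 < 2 * Real.pi / ω := by positivity
  have hT := linFlow_oscillator_period (N := N) hω
  obtain ⟨C, hC, hCb⟩ := exists_norm_linFlow_le hT₀ hT
  have hfd : ∀ z ∈ U, fderiv ℝ (fs ⟨0, hq⟩) z
      = fderiv ℝ (suspendedField H (forcingMap a₀ a b) (oscillator N ω)) z := fun z hz =>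
    Filter.EventuallyEq.fderiv_eq (by
      filter_upwards [hU.mem_nhds hz] with x hx using hf hq x hx)
  refine hc.not_integrable_suspended hO (fun x => analyticAt_forcingMap (ha₀ x)
    (fun j => ha j x) fun j => hb j x) hT₀ hT (δ := δ / (2 * C)) (by positivity)
    (fun x hx y hy s hs τ => hball ⟨hx, ?_⟩)
    (isOpen_ne_fun (f := fun y : ForcingSpace N => y.2.1 i) (g := fun _ => 0) (by fun_prop)
      continuous_const)
    (dense_coordinate_ne_zero i)
    (fun y hy => melnikovForcing_of_integral_ne_zero hc ha₀ ha hb hω hi hy) (q := q) (m := m)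
    ?_ hfs hFs (fun j z hz => ?_) (fun k z hz => ?_) hFf
    (fun W hWU hW hne => exists_mem_of_ae_restrict hind hWU hW hne)
    (fun W hWU hW hne => exists_mem_of_ae_restrict hind' hWU hW hne)
  · rw [mem_ball_zero_iff] at hy ⊢
    change ‖s • linFlow (oscillator N ω) τ y‖ < δ
    rw [norm_smul, Real.norm_eq_abs]
    have hs' : |s| ≤ 2 := (abs_lt.2 hs).le
    have h₁ := ((linFlow (oscillator N ω) τ).le_opNorm y).trans
      (mul_le_mul_of_nonneg_right (hCb τ) (norm_nonneg y))
    rw [lt_div_iff₀ (by positivity)] at hy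
    calc |s| * ‖linFlow (oscillator N ω) τ y‖ ≤ 2 * (C * ‖y‖) := by gcongr
      _ < δ := by linarith
  · simp only [Module.finrank_prod, Module.finrank_self, Module.finrank_fin_fun]
    omega
  · have := hcomm ⟨0, hq⟩ j z hz
    rw [hf hq z hz, hfd z hz] at this
    exact sub_eq_zero.1 this
  · have := hFf k ⟨0, hq⟩ z hz
    rwa [hf hq z hz] at this

/-- **Nonintegrability near homo- and heteroclinic orbits** (real-analytic consequence of
Theorem 1.1). Under (A1)–(A3), if the Melnikov function is not constant, then the
autonomous system `ẋ = JDH(x) + ε a₀(x) + Σ (a_j(x)u_j + b_j(x)v_j)`, `ε̇ = 0`,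
`u̇_j = −jωv_j`, `v̇_j = jωu_j` is not `(q, 2N+3−q)`-integrable in the Bogoyavlenskij
sense with real-analytic data on any open neighborhood `U` of
`Γ̂ = {(x^h(t),0,0,0)} ∪ {(x_±,0,0,0)}`, for any `1 ≤ q ≤ 2N+3`. -/
theorem nonintegrability_near_heteroclinic
    (N : ℕ) (ω : ℝ) (hω : 0 < ω)
    (H : ℝ × ℝ → ℝ) (hH : AnalyticOnNhd ℝ H Set.univ)
    (a₀ : ℝ × ℝ → ℝ × ℝ) (a b : Fin N → ℝ × ℝ → ℝ × ℝ)
    (ha₀ : AnalyticOnNhd ℝ a₀ Set.univ)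
    (ha : ∀ j, AnalyticOnNhd ℝ (a j) Set.univ)
    (hb : ∀ j, AnalyticOnNhd ℝ (b j) Set.univ)
    -- (A1): `x₊` and `x₋` are hyperbolic saddles of `ẋ = JDH(x)` with eigenvalues
    -- `±λ₊` resp. `±λ₋` (the case `x₊ = x₋` is allowed)
    (xp xm : ℝ × ℝ) (hxp : JDH H xp = 0) (hxm : JDH H xm = 0)
    (lamp lamm : ℝ) (hlamp : 0 < lamp) (hlamm : 0 < lamm)
    (vp wp vm wm : ℝ × ℝ) (hvp : vp ≠ 0) (hwp : wp ≠ 0) (hvm : vm ≠ 0) (hwm : wm ≠ 0)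
    (heigvp : fderiv ℝ (JDH H) xp vp = lamp • vp)
    (heigwp : fderiv ℝ (JDH H) xp wp = -lamp • wp)
    (heigvm : fderiv ℝ (JDH H) xm vm = lamm • vm)
    (heigwm : fderiv ℝ (JDH H) xm wm = -lamm • wm)
    -- (A2): a heteroclinic (if `x₊ = x₋`, homoclinic) orbit connecting `x₋` to `x₊`
    (xh : ℝ → ℝ × ℝ) (hxh : ∀ t, HasDerivAt xh (JDH H (xh t)) t)
    (hlimp : Tendsto xh atTop (𝓝 xp)) (hlimm : Tendsto xh atBot (𝓝 xm))
    -- absolute convergence of the Melnikov integral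
    (hMint : ∀ θ : ℝ, Integrable (fun t : ℝ =>
      D1 H (xh t) * (perturbation N a₀ a b (xh t) (ω * t + θ)).1
        + D2 H (xh t) * (perturbation N a₀ a b (xh t) (ω * t + θ)).2))
    -- the Melnikov function is not constant
    (hM : ∃ θ₁ θ₂ : ℝ, melnikov N ω H a₀ a b xh θ₁ ≠ melnikov N ω H a₀ a b xh θ₂) :
    ∀ U : Set (PhaseSpace N), IsOpen U →
      (Set.range (fun t : ℝ => (xh t, (0 : ℝ), (0 : Fin N → ℝ), (0 : Fin N → ℝ)))
        ∪ {(xp, 0, 0, 0), (xm, 0, 0, 0)}) ⊆ U →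
      ∀ q : ℕ, 1 ≤ q → q ≤ 2 * N + 3 →
        ¬ BogoyavlenskijIntegrable (autonomousField N ω H a₀ a b) U q (2 * N + 3 - q) := by
  intro U hU hsub q hq1 hq2
  obtain ⟨θ₁, θ₂, hθ⟩ := hM
  obtain ⟨s, hs⟩ := exists_JDH_ne_zero hθ
  obtain ⟨ξ, η, hsp⟩ := exists_saddlePoint (analyticAt_JDH (hH xp trivial)) hxp hlamp hvp hwp
    heigvp heigwp
  obtain ⟨ξ', η', hsm⟩ := exists_saddlePoint (analyticAt_JDH (hH xm trivial)) hxm hlamm hvm hwm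
    heigvm heigwm
  have hc : SaddleConnection H (fun t => xh (t + s)) xp xm :=
    { analytic := hH
      saddle := ⟨_, _, _, _, _, hsp⟩
      saddle' := ⟨_, _, _, _, _, hsm⟩
      orbit := fun t => (hxh (t + s)).comp_add_const t s
      lim := hlimp.comp (tendsto_atTop_add_const_right _ s tendsto_id)
      lim' := hlimm.comp (tendsto_atBot_add_const_right _ s tendsto_id)
      ne := by rwa [zero_add] }
  refine hc.not_bogoyavlenskijIntegrable hω (fun x => ha₀ x trivial) (fun j x => ha j x trivial)
    (fun j x => hb j x trivial) (θ₁ := θ₁ + ω * s) (θ₂ := θ₂ + ω * s) ?_ hU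
    (hsub (Or.inr (Or.inl rfl))) (hsub (Or.inr (Or.inr rfl)))
    (fun t => hsub (Or.inl ⟨t + s, rfl⟩)) hq1 (by omega)
  rwa [melnikov_comp_add, melnikov_comp_add, add_sub_cancel_right, add_sub_cancel_right]
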